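/- Let K be a number field with K ≠ ℚ and let Δ ≥ 3 be the absolute value of its discriminant. Then the Dedekind zeta function ζ_K has at most one zero ρ = β + iγ with 0 < β < 1 in the region |γ| ≤ (4·log Δ)^{-1} and β ≥ 1 − (4·log Δ)^{-1}; moreover, if such a zero exists, it is real and simple (its order as a zero of ζ_K equals one). -/

import Mathlib

open scoped Classical

noncomputable section

/-- `zeta` is the (unique) analytic continuation of the Dedekind zeta function of the
number field `K`: it is analytic away from `s = 1` and agrees with the Dirichlet series
`∑_𝔞 (N𝔞)^{-s}` (sum over nonzero integral ideals) for `Re s > 1`. -/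
def IsDedekindZeta (K : Type) [Field K] [NumberField K] (zeta : ℂ → ℂ) : Prop :=
  DifferentiableOn ℂ zeta {s : ℂ | s ≠ 1} ∧
    ∀ s : ℂ, 1 < s.re →
      zeta s = ∑' I : {I : Ideal (NumberField.RingOfIntegers K) // I ≠ ⊥},
        (Ideal.absNorm (I : Ideal (NumberField.RingOfIntegers K)) : ℂ) ^ (-s)

section

open MeasureTheory Filter Topology in
lemma sl_summable_pi {ι : Type*} [Fintype ι] (f : ℤ → ℝ) (h0 : ∀ k, 0 ≤ f k) (hf : Summable f) :
    Summable (fun m : ι → ℤ => ∏ i, f (m i)) := by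
  refine summable_of_sum_le (c := ∏ _i : ι, ∑' k, f k) (fun m => Finset.prod_nonneg fun i _ => h0 _) ?_
  intro s
  have hs : s ⊆ Fintype.piFinset (fun i : ι => s.image (fun m => m i)) := by
    intro m hm
    rw [Fintype.mem_piFinset]
    intro i
    exact Finset.mem_image_of_mem _ hm
  calc ∑ m ∈ s, ∏ i, f (m i) ≤ ∑ m ∈ Fintype.piFinset (fun i : ι => s.image (fun m => m i)), ∏ i, f (m i) :=
        Finset.sum_le_sum_of_subset_of_nonneg hs fun m _ _ => Finset.prod_nonneg fun i _ => h0 _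
    _ = ∏ i, ∑ k ∈ s.image (fun m => m i), f k := (Finset.prod_univ_sum _ _).symm
    _ ≤ _ := Finset.prod_le_prod (fun i _ => Finset.sum_nonneg fun k _ => h0 k)
        (fun i _ => hf.sum_le_tsum _ (fun k _ => h0 k))

lemma sl_summable_int {c : ℝ} (hc : 0 < c) : Summable (fun k : ℤ => Real.exp (-c * (k:ℝ)^2)) := by
  have h1 : Summable (fun n : ℕ => Real.exp (-c * (n:ℝ))) := by
    have := Real.summable_exp_nat_mul_iff.mpr (neg_lt_zero.mpr hc)
    exact this.congr fun n => by rw [mul_comm]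
  have h2 : Summable (fun n : ℕ => Real.exp (-c * (n:ℝ)^2)) := by
    refine Summable.of_nonneg_of_le (fun m => (Real.exp_pos _).le) (fun m => ?_) h1
    apply Real.exp_le_exp.mpr
    have : (m:ℝ) ≤ (m:ℝ)^2 := by exact_mod_cast Nat.le_self_pow two_ne_zero m
    nlinarith
  refine Summable.of_nat_of_neg ?_ ?_
  · simpa using h2
  · simpa using h2

lemma sl_summable_norm {ι : Type*} [Fintype ι] {c : ℝ} (hc : 0 < c) :
    Summable (fun m : ι → ℤ => Real.exp (-c * ∑ i, (m i : ℝ)^2)) := by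
  refine (sl_summable_pi (ι := ι) _ (fun k => (Real.exp_pos _).le) (sl_summable_int hc)).congr fun m => ?_
  rw [← Real.exp_sum, Finset.mul_sum]

/-- the quadratic form -/
def slQ {ι : Type*} [Fintype ι] (B : Matrix ι ι ℝ) (x : ι → ℝ) : ℝ := ∑ i, (B.mulVec x i)^2

lemma slQ_lower {ι : Type*} [Fintype ι] (B : Matrix ι ι ℝ) (hB : B.det ≠ 0) :
    ∃ c : ℝ, 0 < c ∧ ∀ x, c * ∑ i, (x i)^2 ≤ slQ B x := by
  obtain ⟨C, hC0, hC⟩ : ∃ C : ℝ, 0 < C ∧ ∀ y : ι → ℝ, ∑ i, (B⁻¹.mulVec y i)^2 ≤ C * ∑ i, (y i)^2 := by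
    refine ⟨1 + ∑ i, ∑ j, (B⁻¹ i j)^2, by positivity, fun y => ?_⟩
    have : ∑ i, (B⁻¹.mulVec y i)^2 ≤ (∑ i, ∑ j, (B⁻¹ i j)^2) * ∑ i, (y i)^2 := by
      rw [Finset.sum_mul]
      exact Finset.sum_le_sum fun i _ => Finset.sum_mul_sq_le_sq_mul_sq _ _ _
    nlinarith [Finset.sum_nonneg (fun i (_ : i ∈ Finset.univ) => sq_nonneg (y i))]
  refine ⟨C⁻¹, by positivity, fun x => ?_⟩
  have := hC (B.mulVec x)
  rw [Matrix.mulVec_mulVec, Matrix.nonsing_inv_mul _ (by simpa using hB), Matrix.one_mulVec] at this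
  rw [inv_mul_le_iff₀ hC0]
  exact this

lemma slQ_cont {ι : Type*} [Fintype ι] (B : Matrix ι ι ℝ) : Continuous (slQ B) := by
  unfold slQ Matrix.mulVec dotProduct
  fun_prop

lemma slQ_summable {ι : Type*} [Fintype ι] (B : Matrix ι ι ℝ) (hB : B.det ≠ 0) :
    Summable (fun m : ι → ℤ => Real.exp (-Real.pi * slQ B (fun i => (m i : ℝ)))) := by
  obtain ⟨c, hc, h⟩ := slQ_lower B hB
  refine Summable.of_nonneg_of_le (fun m => (Real.exp_pos _).le) (fun m => ?_)
    (sl_summable_norm (ι := ι) (c := Real.pi * c) (by positivity))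
  apply Real.exp_le_exp.mpr
  nlinarith [h (fun i => (m i : ℝ)), Real.pi_pos]

lemma sl_aux_transl {p c q t r : ℝ} (h : p * (c * (t / 2 - r)) ≤ p * q) :
    -p * q ≤ p * c * r + -(p * c / 2) * t := by linarith

/-- translates bound -/
lemma slQ_transl {ι : Type*} [Fintype ι] (B : Matrix ι ι ℝ) (hB : B.det ≠ 0) (R : ℝ) :
    ∃ u : (ι → ℤ) → ℝ, Summable u ∧ ∀ x : ι → ℝ, (∀ i, |x i| ≤ R) → ∀ m : ι → ℤ,
      Real.exp (-Real.pi * slQ B (fun i => x i + (m i : ℝ))) ≤ u m := by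
  obtain ⟨c, hc, h⟩ := slQ_lower B hB
  have hs : Summable (fun m : ι → ℤ => Real.exp (Real.pi * c * ∑ _i : ι, R^2) *
      Real.exp (-(Real.pi * c / 2) * ∑ i, (m i : ℝ)^2)) :=
    Summable.mul_left _ (sl_summable_norm (ι := ι) (c := Real.pi * c / 2) (by positivity))
  refine ⟨_, hs, fun x hx m => ?_⟩
  rw [← Real.exp_add]
  apply Real.exp_le_exp.mpr
  have h1 := h (fun i => x i + (m i : ℝ))
  have h2 : ∑ i, ((m i : ℝ)^2/2 - R^2) ≤ ∑ i, (x i + (m i : ℝ))^2 := by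
    refine Finset.sum_le_sum fun i _ => ?_
    have := sq_le_sq' (abs_le.mp (hx i)).1 (abs_le.mp (hx i)).2
    nlinarith [sq_nonneg (2 * x i + m i)]
  rw [Finset.sum_sub_distrib, ← Finset.sum_div] at h2
  exact sl_aux_transl
    (mul_le_mul_of_nonneg_left ((mul_le_mul_of_nonneg_left h2 hc.le).trans h1) Real.pi_pos.le)

open MeasureTheory in
lemma slFT {ι : Type*} [Fintype ι] (B : Matrix ι ι ℝ) (hB : B.det ≠ 0) (k : ι → ℝ) :
    ∫ x : ι → ℝ, Complex.exp (-Real.pi * slQ B x - 2 * Real.pi * Complex.I * ∑ i, (k i : ℂ) * x i) =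
      (|B.det|⁻¹ : ℝ) * Complex.exp (-Real.pi * slQ (B⁻¹.transpose) k) := by
  have hmap := Real.map_matrix_volume_pi_eq_smul_volume_pi hB
  -- function of u = B x
  set H : (ι → ℝ) → ℂ := fun u => Complex.exp (-Real.pi * ∑ i, (u i : ℂ)^2 +
    ∑ i, (-2 * Real.pi * Complex.I * (B⁻¹.transpose.mulVec k i : ℂ)) * u i) with hH
  have e1 : ∀ x, Complex.exp (-Real.pi * slQ B x - 2 * Real.pi * Complex.I * ∑ i, (k i : ℂ) * x i)
      = H (Matrix.toLin' B x) := by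
    intro x
    simp only [hH, slQ, Matrix.toLin'_apply]
    congr 1
    have : ∑ i, (k i : ℂ) * x i = ∑ i, (B⁻¹.transpose.mulVec k i : ℂ) * (B.mulVec x i : ℝ) := by
      have : k ⬝ᵥ x = (B⁻¹.transpose.mulVec k) ⬝ᵥ (B.mulVec x) := by
        rw [Matrix.mulVec_transpose, ← Matrix.dotProduct_mulVec, Matrix.mulVec_mulVec,
          Matrix.nonsing_inv_mul _ (by simpa using hB), Matrix.one_mulVec]
      have := congrArg (fun r : ℝ => (r : ℂ)) this
      simpa [dotProduct] using this
    rw [this, Finset.mul_sum]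
    push_cast
    rw [sub_eq_add_neg, ← Finset.sum_neg_distrib]
    congr 1
    refine Finset.sum_congr rfl fun i _ => ?_
    ring
  simp_rw [e1]
  have hcont : Continuous H := by
    simp only [hH]; fun_prop
  rw [← integral_map (φ := Matrix.toLin' B) (f := H)
    (LinearMap.continuous_of_finiteDimensional _).aemeasurable hcont.aestronglyMeasurable, hmap,
    integral_smul_measure]
  simp only [hH]
  have h2 := GaussianFourier.integral_cexp_neg_mul_sum_add (b := (Real.pi : ℂ)) (by simp [Real.pi_pos])
    (fun i => (-2 * Real.pi * Complex.I * (B⁻¹.transpose.mulVec k i : ℂ)))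
  have hpi : (Real.pi : ℂ) ≠ 0 := by exact_mod_cast Real.pi_ne_zero
  rw [h2, div_self hpi, Complex.one_cpow, one_mul, ENNReal.toReal_ofReal (abs_nonneg _), abs_inv]
  rw [Complex.real_smul]
  congr 2
  unfold slQ
  push_cast
  rw [Finset.mul_sum, Finset.sum_div]
  refine Finset.sum_congr rfl fun i _ => ?_
  field_simp
  ring_nf
  simp

end

section

open MeasureTheory in
lemma sl_integral_unfold {ι : Type*} [Fintype ι] (h : (ι → ℝ) → ℂ) (hi : Integrable h) :
    ∫ x, h x = ∑' m : ι → ℤ, ∫ x in {x : ι → ℝ | ∀ i, x i ∈ Set.Ioc (0:ℝ) (0 + 1)},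
      h (fun i => x i + (m i : ℝ)) := by
  have hF := ZSpan.isAddFundamentalDomain (Pi.basisFun ℝ ι) volume
  have : VAddInvariantMeasure (Submodule.span ℤ (Set.range (Pi.basisFun ℝ ι))) (ι → ℝ) volume :=
    (inferInstance : VAddInvariantMeasure (Submodule.span ℤ (Set.range (Pi.basisFun ℝ ι))).toAddSubgroup _ _)
  have h1 := hF.integral_eq_tsum'' h hi
  rw [h1]
  let e := ((Pi.basisFun ℝ ι).restrictScalars ℤ).equivFun
  have he : ∀ m : ι → ℤ, ((e.symm m : Submodule.span ℤ (Set.range (Pi.basisFun ℝ ι))) : ι → ℝ) =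
      fun i => (m i : ℝ) := by
    intro m
    simp only [e, Module.Basis.equivFun_symm_apply]
    ext i
    simp [Finset.sum_apply, Pi.single_apply]
  rw [← e.symm.toEquiv.tsum_eq]
  refine tsum_congr fun m => ?_
  have hset : (ZSpan.fundamentalDomain (Pi.basisFun ℝ ι)) =ᵐ[volume]
      {x : ι → ℝ | ∀ i, x i ∈ Set.Ioc (0:ℝ) (0 + 1)} := by
    rw [ZSpan.fundamentalDomain_pi_basisFun]
    have : {x : ι → ℝ | ∀ i, x i ∈ Set.Ioc (0:ℝ) (0 + 1)} = Set.pi Set.univ fun _ => Set.Ioc (0:ℝ) 1 := by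
      ext; simp
    rw [this]
    exact Measure.univ_pi_Ico_ae_eq_Icc.trans Measure.univ_pi_Ioc_ae_eq_Icc.symm
  rw [setIntegral_congr_set hset]
  refine integral_congr_ae (ae_of_all _ fun x => ?_)
  have := he m
  change h ((e.symm m : ι → ℝ) + x) = _
  rw [this]
  congr 1
  ext i
  simp [add_comm]

lemma sl_periodize_cont {ι : Type*} [Fintype ι] (B : Matrix ι ι ℝ) (hB : B.det ≠ 0) :
    Continuous (fun x : ι → ℝ => ∑' m : ι → ℤ, (Real.exp (-Real.pi * slQ B (fun i => x i + (m i : ℝ))) : ℂ)) := by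
  rw [continuous_iff_continuousAt]
  intro x0
  obtain ⟨u, hu, hb⟩ := slQ_transl B hB (‖x0‖ + 1)
  have hc : ContinuousOn (fun x : ι → ℝ => ∑' m : ι → ℤ, (Real.exp (-Real.pi * slQ B (fun i => x i + (m i : ℝ))) : ℂ))
      (Metric.ball x0 1) := by
    refine continuousOn_tsum (fun m => ?_) hu (fun m x hx => ?_)
    · have := slQ_cont B
      have h2 : Continuous fun x : ι → ℝ => slQ B (fun i => x i + (m i : ℝ)) := this.comp (by fun_prop)
      exact (Complex.continuous_ofReal.comp (Real.continuous_exp.comp (continuous_const.mul h2))).continuousOn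
    · rw [Complex.norm_real, Real.norm_of_nonneg (Real.exp_pos _).le]
      refine hb x (fun i => ?_) m
      have h1 : |x i| ≤ ‖x‖ := norm_le_pi_norm x i
      have h2 : ‖x‖ ≤ ‖x0‖ + ‖x - x0‖ := by
        have := norm_add_le x0 (x - x0); simpa using this
      rw [Metric.mem_ball, dist_eq_norm] at hx
      linarith
  exact hc.continuousAt (Metric.ball_mem_nhds _ one_pos)

lemma sl_tsum_shift {ι : Type*} [Fintype ι] (G : (ι → ℝ) → ℂ) (x : ι → ℝ) (y : ι → ℝ)
    (h : ∀ i, ((x i : ℝ) : UnitAddCircle) = ((y i : ℝ) : UnitAddCircle)) :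
    ∑' m : ι → ℤ, G (fun i => x i + (m i : ℝ)) = ∑' m : ι → ℤ, G (fun i => y i + (m i : ℝ)) := by
  have : ∀ i, ∃ n : ℤ, y i = x i + n := by
    intro i
    have h2 := h i
    rw [← sub_eq_zero, ← AddCircle.coe_sub, AddCircle.coe_eq_zero_iff] at h2
    obtain ⟨n, hn⟩ := h2
    refine ⟨-n, ?_⟩
    simp at hn
    push_cast; linarith
  choose n hn using this
  rw [← (Equiv.addRight n).tsum_eq]
  refine tsum_congr fun m => ?_
  congr 1
  ext i
  simp [hn i]
  ring

open MeasureTheory in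
theorem sl_poisson {ι : Type*} [Fintype ι] (B : Matrix ι ι ℝ) (hB : B.det ≠ 0) :
    ∑' m : ι → ℤ, Real.exp (-Real.pi * slQ B (fun i => (m i : ℝ))) =
      |B.det|⁻¹ * ∑' m : ι → ℤ, Real.exp (-Real.pi * slQ (B⁻¹.transpose) (fun i => (m i : ℝ))) := by
  set G : (ι → ℝ) → ℂ := fun x => (Real.exp (-Real.pi * slQ B x) : ℂ) with hG
  set F0 : (ι → ℝ) → ℂ := fun x => ∑' m : ι → ℤ, G (fun i => x i + (m i : ℝ)) with hF0
  have hF0c : Continuous F0 := sl_periodize_cont B hB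
  let π : (ι → ℝ) → UnitAddTorus ι := fun x i => (x i : UnitAddCircle)
  have hπ : IsOpenQuotientMap π := by
    have : ∀ i : ι, IsOpenQuotientMap (fun x : ℝ => (x : UnitAddCircle)) := fun i =>
      QuotientAddGroup.isOpenQuotientMap_mk
    exact IsOpenQuotientMap.piMap this
  let F1 : UnitAddTorus ι → ℂ := fun t => F0 (fun i => (t i).out)
  have hF1 : ∀ x, F1 (π x) = F0 x := by
    intro x
    apply sl_tsum_shift G
    intro i
    exact Quotient.out_eq' (π x i)
  let F : C(UnitAddTorus ι, ℂ) := ⟨F1, by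
    rw [hπ.isQuotientMap.continuous_iff]
    have : F1 ∘ π = F0 := funext hF1
    rwa [this]⟩
  have hcoeff : ∀ k : ι → ℤ, UnitAddTorus.mFourierCoeff F k =
      (|B.det|⁻¹ : ℝ) * Complex.exp (-Real.pi * slQ (B⁻¹.transpose) (fun i => (k i : ℝ))) := by
    intro k
    rw [← slFT B hB, UnitAddTorus.mFourierCoeff_eq_integral _ _ 0]
    set h : (ι → ℝ) → ℂ := fun x => Complex.exp (-Real.pi * slQ B x - 2 * Real.pi * Complex.I * ∑ i, ((k i : ℝ) : ℂ) * x i) with hh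
    have hnorm : ∀ x, ‖h x‖ = Real.exp (-Real.pi * slQ B x) := by
      intro x
      rw [hh, Complex.norm_exp]
      congr 1
      simp
    have hcont : Continuous h := by
      have := slQ_cont B
      simp only [hh]
      fun_prop
    have hhs : ∀ x : ι → ℝ, ∀ m : ι → ℤ, h (fun i => x i + (m i : ℝ)) =
        UnitAddTorus.mFourier (-k) (π x) * G (fun i => x i + (m i : ℝ)) := by
      intro x m
      simp only [hh, hG, UnitAddTorus.mFourier, ContinuousMap.coe_mk, π, Pi.neg_apply, fourier_coe_apply]
      rw [← Complex.exp_sum, Complex.ofReal_exp, ← Complex.exp_add, Complex.exp_eq_exp_iff_exists_int]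
      refine ⟨-∑ i, k i * m i, ?_⟩
      push_cast
      simp only [mul_add, Finset.sum_add_distrib, Finset.mul_sum, Finset.sum_mul, ← Finset.sum_neg_distrib]
      have : ∀ i, 2 * (Real.pi:ℂ) * Complex.I * -(k i : ℂ) * (x i : ℂ) / 1 = -(2 * (Real.pi:ℂ) * Complex.I * ((k i : ℂ) * (x i : ℂ))) := fun i => by ring
      simp only [this, Finset.sum_neg_distrib]
      have : ∀ i, -((k i : ℂ) * (m i : ℂ)) * (2 * (Real.pi:ℂ) * Complex.I) = -(2 * (Real.pi:ℂ) * Complex.I * ((k i : ℂ) * (m i : ℂ))) := fun i => by ring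
      simp only [this, Finset.sum_neg_distrib]
      ring
    obtain ⟨u, hu, hb⟩ := slQ_transl B hB 1
    have hcube : ∀ x ∈ {x : ι → ℝ | ∀ i, x i ∈ Set.Ioc (0:ℝ) (0 + 1)}, ∀ i, |x i| ≤ 1 := by
      intro x hx i
      have := hx i
      rw [abs_le]
      constructor <;> linarith [this.1, this.2]
    have hint : Integrable h := by
      obtain ⟨c, hc, hlow⟩ := slQ_lower B hB
      have hg : Integrable (fun x : ι → ℝ => ∏ i, Real.exp (-(Real.pi * c) * (x i)^2)) :=
        Integrable.fintype_prod (fun i => integrable_exp_neg_mul_sq (by positivity))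
      refine hg.mono' hcont.aestronglyMeasurable (ae_of_all _ fun x => ?_)
      rw [hnorm, ← Real.exp_sum, ← Finset.mul_sum]
      apply Real.exp_le_exp.mpr
      nlinarith [hlow x, Real.pi_pos]
    rw [sl_integral_unfold h hint]
    have hmeas : MeasurableSet {x : ι → ℝ | ∀ i, x i ∈ Set.Ioc (0:ℝ) (0 + 1)} := by
      have : {x : ι → ℝ | ∀ i, x i ∈ Set.Ioc (0:ℝ) (0 + 1)} = Set.pi Set.univ fun _ => Set.Ioc (0:ℝ) (0+1) := by
        ext; simp
      rw [this]
      exact MeasurableSet.univ_pi fun i => measurableSet_Ioc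
    have hvol : volume {x : ι → ℝ | ∀ i, x i ∈ Set.Ioc (0:ℝ) (0 + 1)} = 1 := by
      have : {x : ι → ℝ | ∀ i, x i ∈ Set.Ioc (0:ℝ) (0 + 1)} = Set.pi Set.univ fun _ => Set.Ioc (0:ℝ) (0+1) := by
        ext; simp
      rw [this, Real.volume_pi_Ioc]; simp
    have hHas := hasSum_integral_of_summable_integral_norm
      (μ := volume.restrict {x : ι → ℝ | ∀ i, x i ∈ Set.Ioc (0:ℝ) (0 + 1)})
      (F := fun (m : ι → ℤ) (x : ι → ℝ) => h (fun i => x i + (m i : ℝ))) (fun m => ?_) ?_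
    · rw [hHas.tsum_eq]
      refine setIntegral_congr_fun hmeas fun x hx => ?_
      simp only [hhs]
      rw [tsum_mul_left]
      change _ • F1 (π x) = _
      rw [hF1]
      rfl
    · refine Integrable.integrableOn ?_
      exact hint.comp_add_right (fun i => (m i : ℝ))
    · refine Summable.of_nonneg_of_le (fun m => integral_nonneg fun x => norm_nonneg _) (fun m => ?_) hu
      have : ∫ x in {x : ι → ℝ | ∀ i, x i ∈ Set.Ioc (0:ℝ) (0 + 1)}, ‖h (fun i => x i + (m i : ℝ))‖ ≤
          ∫ x in {x : ι → ℝ | ∀ i, x i ∈ Set.Ioc (0:ℝ) (0 + 1)}, u m := by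
        refine setIntegral_mono_on ?_ ?_ hmeas fun x hx => ?_
        · exact (hint.comp_add_right (fun i => (m i : ℝ))).norm.integrableOn
        · exact integrableOn_const (by rw [hvol]; simp)
        · rw [hnorm]; exact hb x (hcube x hx) m
      refine this.trans (le_of_eq ?_)
      rw [setIntegral_const, Measure.real, hvol]; simp
  have hB' : (B⁻¹.transpose).det ≠ 0 := by
    rw [Matrix.det_transpose, Matrix.det_nonsing_inv]
    simpa using hB
  have hsum : Summable (UnitAddTorus.mFourierCoeff F) := by
    have := ((slQ_summable _ hB').mul_left (|B.det|⁻¹))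
    have h2 := Complex.ofRealCLM.summable this
    refine h2.congr fun k => ?_
    rw [hcoeff]
    simp
  have hfin := (UnitAddTorus.hasSum_mFourier_series_apply_of_summable hsum (π 0)).tsum_eq
  have e1 : F (π 0) = ((∑' m : ι → ℤ, Real.exp (-Real.pi * slQ B (fun i => (m i : ℝ))) : ℝ) : ℂ) := by
    change F1 (π 0) = _
    rw [hF1, Complex.ofReal_tsum]
    simp [hF0, hG]
  have e2 : ∀ k : ι → ℤ, UnitAddTorus.mFourierCoeff F k • UnitAddTorus.mFourier k (π 0) =
      ((|B.det|⁻¹ * Real.exp (-Real.pi * slQ (B⁻¹.transpose) (fun i => (k i : ℝ))) : ℝ) : ℂ) := by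
    intro k
    rw [hcoeff]
    have : UnitAddTorus.mFourier k (π 0) = 1 := by
      simp [UnitAddTorus.mFourier, π]
    rw [this]
    simp
  rw [e1, tsum_congr e2, ← Complex.ofReal_tsum, tsum_mul_left] at hfin
  exact_mod_cast hfin.symm

end

section

open NumberField

/-- the quadratic form on K -/
def slq {K : Type} [Field K] [NumberField K] (y : InfinitePlace K → ℝ) (x : K) : ℝ :=
  ∑ φ : K →+* ℂ, y (InfinitePlace.mk φ) * ‖φ x‖ ^ 2

lemma sl_trace_sum {K : Type} [Field K] [NumberField K] (x : K) :
    ((Algebra.trace ℚ K x : ℚ) : ℝ) = ∑ φ : K →+* ℂ, (φ x).re := by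
  have h := trace_eq_sum_embeddings (K := ℚ) (L := K) ℂ (x := x)
  have h2 : ∑ σ : K →ₐ[ℚ] ℂ, σ x = ∑ φ : K →+* ℂ, φ x :=
    (Fintype.sum_equiv (RingHom.equivRatAlgHom K ℂ) _ _ (fun _ => by
      simp [RingHom.equivRatAlgHom_apply])).symm
  rw [h2] at h
  have h3 := congrArg Complex.re h
  simpa using h3

/-- conjugation as a permutation of embeddings -/
def slConj (K : Type) [Field K] : Equiv.Perm (K →+* ℂ) :=
  (ComplexEmbedding.involutive_conjugate K).toPerm

lemma slConj_apply {K : Type} [Field K] (φ : K →+* ℂ) (x : K) :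
    slConj K φ x = (starRingEnd ℂ) (φ x) := by
  simp [slConj]

lemma slConj_mk {K : Type} [Field K] (φ : K →+* ℂ) :
    InfinitePlace.mk (slConj K φ) = InfinitePlace.mk φ := by
  simp [slConj]

lemma sl_odd_sum {K : Type} [Field K] [NumberField K] (F : (K →+* ℂ) → ℝ)
    (h : ∀ φ, F (slConj K φ) = - F φ) : ∑ φ, F φ = 0 := by
  have h1 := Equiv.sum_comp (slConj K) F
  simp_rw [h, Finset.sum_neg_distrib] at h1
  linarith

/-- the real matrix -/
def slM {K : Type} [Field K] [NumberField K] (ε : ℝ) (y : InfinitePlace K → ℝ)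
    (b : (K →+* ℂ) → K) : Matrix (K →+* ℂ) (K →+* ℂ) ℝ :=
  fun φ i => y (InfinitePlace.mk φ) * ((φ (b i)).re + ε * (φ (b i)).im)

lemma slM_mul {K : Type} [Field K] [NumberField K] (y y' : InfinitePlace K → ℝ)
    (hy : ∀ w, y w * y' w = 1)
    (b b' : (K →+* ℂ) → K) (i k : K →+* ℂ) :
    ((slM 1 y b).transpose * slM (-1) y' b') i k = ((Algebra.trace ℚ K (b i * b' k) : ℚ) : ℝ) := by
  rw [sl_trace_sum, Matrix.mul_apply]
  simp only [Matrix.transpose_apply, slM]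
  rw [← sub_eq_zero, ← Finset.sum_sub_distrib]
  have : ∀ φ : K →+* ℂ, y (InfinitePlace.mk φ) * ((φ (b i)).re + 1 * (φ (b i)).im) *
      (y' (InfinitePlace.mk φ) * ((φ (b' k)).re + -1 * (φ (b' k)).im)) - (φ (b i * b' k)).re =
      (φ (b i)).im * (φ (b' k)).re - (φ (b i)).re * (φ (b' k)).im := by
    intro φ
    rw [map_mul, Complex.mul_re]
    linear_combination (((φ (b i)).re + (φ (b i)).im) * ((φ (b' k)).re - (φ (b' k)).im)) * hy (InfinitePlace.mk φ)
  simp_rw [this]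
  apply sl_odd_sum
  intro φ
  simp only [slConj_apply, Complex.conj_re, Complex.conj_im]
  ring

lemma slM_Q {K : Type} [Field K] [NumberField K] (y : InfinitePlace K → ℝ) (ε : ℝ) (hε : ε ^ 2 = 1)
    (b : (K →+* ℂ) → K) (m : (K →+* ℂ) → ℤ) :
    slQ (slM ε y b) (fun i => (m i : ℝ)) = slq (fun w => y w ^ 2) (∑ i, m i • b i) := by
  unfold slQ slq
  have h1 : ∀ φ : K →+* ℂ, (slM ε y b).mulVec (fun i => (m i : ℝ)) φ =
      y (InfinitePlace.mk φ) * ((φ (∑ i, m i • b i)).re + ε * (φ (∑ i, m i • b i)).im) := by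
    intro φ
    simp only [Matrix.mulVec, dotProduct, slM, map_sum, map_zsmul, Complex.re_sum, Complex.im_sum,
      Finset.mul_sum, ← Finset.sum_add_distrib]
    refine Finset.sum_congr rfl fun i _ => ?_
    simp
    ring
  simp_rw [h1]
  rw [← sub_eq_zero, ← Finset.sum_sub_distrib]
  apply sl_odd_sum
  intro φ
  simp only [slConj_apply, slConj_mk, Complex.conj_re, Complex.conj_im]
  rw [Complex.sq_norm, Complex.sq_norm, Complex.normSq_apply, Complex.normSq_apply]
  simp only [Complex.conj_re, Complex.conj_im]
  set u := (φ (∑ i, m i • b i)).re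
  set v := (φ (∑ i, m i • b i)).im
  linear_combination (2 * (y (InfinitePlace.mk φ))^2 * v^2) * hε

lemma slM_det_scale {K : Type} [Field K] [NumberField K] (y : InfinitePlace K → ℝ) (ε : ℝ)
    (b : (K →+* ℂ) → K) :
    (slM ε y b).det = (∏ φ : K →+* ℂ, y (InfinitePlace.mk φ)) * (slM ε (fun _ => 1) b).det := by
  have : slM ε y b = Matrix.diagonal (fun φ : K →+* ℂ => y (InfinitePlace.mk φ)) * slM ε (fun _ => 1) b := by
    ext φ i
    rw [Matrix.diagonal_mul]
    simp [slM]
  rw [this, Matrix.det_mul, Matrix.det_diagonal]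

lemma slM_det_conj {K : Type} [Field K] [NumberField K] (b : (K →+* ℂ) → K) :
    |(slM (-1) (fun _ => 1) b).det| = |(slM 1 (fun _ => 1) b).det| := by
  have : slM (-1) (fun _ => 1) b = (slM 1 (fun _ => 1) b).submatrix (slConj K) id := by
    ext φ i
    simp [slM, slConj_apply]
  rw [this, Matrix.det_permute, abs_mul]
  have h2 : |((Equiv.Perm.sign (slConj K) : ℤ) : ℝ)| = 1 := by
    rcases Int.units_eq_one_or (Equiv.Perm.sign (slConj K)) with h | h <;> simp [h]
  rw [h2, one_mul]

lemma slM_det_sq {K : Type} [Field K] [NumberField K] (b : (K →+* ℂ) → K) :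
    (slM 1 (fun _ => 1) b).det ^ 2 = |((Algebra.discr ℚ b : ℚ) : ℝ)| := by
  have h : (slM 1 (fun _ => (1:ℝ)) b).transpose * slM (-1) (fun _ => 1) b =
      (Algebra.traceMatrix ℚ b).map (fun q : ℚ => (q : ℝ)) := by
    ext i k
    rw [slM_mul _ _ (by simp)]
    simp [Algebra.traceMatrix_apply, Algebra.traceForm_apply]
  have h2 := congrArg (fun M => |Matrix.det M|) h
  simp only [Matrix.det_mul, Matrix.det_transpose, abs_mul, slM_det_conj] at h2
  rw [← sq, sq_abs] at h2
  rw [h2, Algebra.discr_def]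
  congr 1
  exact (RingHom.map_det (algebraMap ℚ ℝ) _).symm

/-- Poisson summation for a `ℚ`-basis. -/
lemma sl_poisson_basis {K : Type} [Field K] [NumberField K] (b : Module.Basis (K →+* ℂ) ℚ K)
    (y : InfinitePlace K → ℝ) (hy : ∀ w, 0 < y w) :
    ∑' m : (K →+* ℂ) → ℤ, Real.exp (-Real.pi * slq y (∑ i, m i • b i)) =
      (Real.sqrt (|((Algebra.discr ℚ b : ℚ) : ℝ)| * ∏ φ : K →+* ℂ, y (InfinitePlace.mk φ)))⁻¹ *
      ∑' m : (K →+* ℂ) → ℤ, Real.exp (-Real.pi * slq (fun w => (y w)⁻¹) (∑ i, m i • b.traceDual i))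
    ∧ Summable (fun m : (K →+* ℂ) → ℤ => Real.exp (-Real.pi * slq y (∑ i, m i • b i))) := by
  have hs : ∀ w, Real.sqrt (y w) * (Real.sqrt (y w))⁻¹ = 1 := fun w =>
    mul_inv_cancel₀ (Real.sqrt_pos.mpr (hy w)).ne'
  set B := slM 1 (fun w => Real.sqrt (y w)) b with hB
  set C := slM (-1) (fun w => (Real.sqrt (y w))⁻¹) b.traceDual with hC
  have hBC : B.transpose * C = 1 := by
    ext i k
    rw [slM_mul _ _ hs, Module.Basis.trace_mul_traceDual, Matrix.one_apply]
    split_ifs <;> simp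
  have hdet : B.det ≠ 0 := by
    have := congrArg Matrix.det hBC
    rw [Matrix.det_mul, Matrix.det_transpose, Matrix.det_one] at this
    exact left_ne_zero_of_mul_eq_one this
  have hCi : B⁻¹.transpose = C := by
    rw [Matrix.transpose_nonsing_inv]
    exact Matrix.inv_eq_right_inv hBC
  have hQ : ∀ m : (K →+* ℂ) → ℤ, slQ B (fun i => (m i : ℝ)) = slq y (∑ i, m i • b i) := by
    intro m
    rw [hB, slM_Q _ _ (by norm_num)]
    congr 1
    ext w
    exact Real.sq_sqrt (hy w).le
  have hQ' : ∀ m : (K →+* ℂ) → ℤ, slQ C (fun i => (m i : ℝ)) =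
      slq (fun w => (y w)⁻¹) (∑ i, m i • b.traceDual i) := by
    intro m
    rw [hC, slM_Q _ _ (by norm_num)]
    congr 1
    ext w
    rw [inv_pow, Real.sq_sqrt (hy w).le]
  have h := sl_poisson B hdet
  simp_rw [hCi, hQ, hQ'] at h
  have hS := slQ_summable B hdet
  simp_rw [hQ] at hS
  refine ⟨?_, hS⟩
  rw [h]
  congr 2
  rw [← Real.sqrt_sq_eq_abs, hB, slM_det_scale, mul_pow, slM_det_sq, mul_comm, ← Finset.prod_pow]
  congr 2
  refine Finset.prod_congr rfl fun φ _ => ?_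
  exact Real.sq_sqrt (hy _).le

lemma sl_slq_cont {K : Type} [Field K] [NumberField K] (x : K) :
    Continuous (fun y : InfinitePlace K → ℝ => slq y x) := by
  unfold slq; fun_prop

/-- theta function of a fractional ideal -/
def slTheta {K : Type} [Field K] [NumberField K] (I : Set K) (y : InfinitePlace K → ℝ) : ENNReal :=
  ∑' x : I, ENNReal.ofReal (Real.exp (-Real.pi * slq y x))

lemma sl_theta_basis {K : Type} [Field K] [NumberField K] (b : Module.Basis (K →+* ℂ) ℚ K)
    (y : InfinitePlace K → ℝ) (hy : ∀ w, 0 < y w) (I : Set K)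
    (hI : ∀ x, x ∈ I ↔ x ∈ Submodule.span ℤ (Set.range b)) :
    slTheta I y = ENNReal.ofReal (∑' m : (K →+* ℂ) → ℤ, Real.exp (-Real.pi * slq y (∑ i, m i • b i))) := by
  rw [ENNReal.ofReal_tsum_of_nonneg (fun _ => (Real.exp_pos _).le) (sl_poisson_basis b y hy).2]
  unfold slTheta
  let e : ((K →+* ℂ) → ℤ) ≃ I :=
    (b.restrictScalars ℤ).equivFun.symm.toEquiv.trans (Equiv.subtypeEquivRight (fun x => (hI x).symm))
  rw [← Equiv.tsum_eq e]
  refine tsum_congr fun m => ?_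
  congr 5
  simp [e, Module.Basis.equivFun_symm_apply]

end

section

open NumberField

/-- unit fractional ideals -/
abbrev slI (K : Type) [Field K] [NumberField K] := (FractionalIdeal (nonZeroDivisors (𝓞 K)) K)ˣ

def slN {K : Type} [Field K] [NumberField K] (I : slI K) : ℝ :=
  ((FractionalIdeal.absNorm (I : FractionalIdeal (nonZeroDivisors (𝓞 K)) K) : ℚ) : ℝ)

def slD (K : Type) [Field K] [NumberField K] : ℝ := ((discr K).natAbs : ℝ)

lemma slD_pos (K : Type) [Field K] [NumberField K] : 0 < slD K := by
  unfold slD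
  exact_mod_cast Int.natAbs_pos.mpr (discr_ne_zero K)

lemma slN_pos {K : Type} [Field K] [NumberField K] (I : slI K) : 0 < slN I := by
  unfold slN
  have h1 : (0:ℚ) ≤ FractionalIdeal.absNorm (I : FractionalIdeal (nonZeroDivisors (𝓞 K)) K) :=
    FractionalIdeal.absNorm_nonneg _
  have h2 : FractionalIdeal.absNorm (I : FractionalIdeal (nonZeroDivisors (𝓞 K)) K) ≠ 0 := by
    simp
  exact_mod_cast lt_of_le_of_ne h1 h2.symm

def slDual {K : Type} [Field K] [NumberField K] (I : slI K) : slI K :=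
  Units.mk0 (FractionalIdeal.dual ℤ ℚ (I : FractionalIdeal (nonZeroDivisors (𝓞 K)) K))
    (FractionalIdeal.dual_ne_zero ℤ ℚ I.ne_zero)

def slDiff (K : Type) [Field K] [NumberField K] : slI K := slDual 1

lemma slDual_eq {K : Type} [Field K] [NumberField K] (I : slI K) : slDual I = slDiff K * I⁻¹ := by
  apply Units.ext
  simp only [slDual, slDiff, Units.val_mul, Units.val_mk0, Units.val_one, Units.val_inv_eq_inv_val]
  exact FractionalIdeal.dual_eq_mul_inv ℤ ℚ _

lemma slN_mul {K : Type} [Field K] [NumberField K] (I J : slI K) : slN (I * J) = slN I * slN J := by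
  simp [slN]

lemma slN_inv {K : Type} [Field K] [NumberField K] (I : slI K) : slN (I⁻¹) = (slN I)⁻¹ := by
  simp [slN]

lemma slN_diff (K : Type) [Field K] [NumberField K] : slN (slDiff K) = (slD K)⁻¹ := by
  have h1 := coeIdeal_differentIdeal ℤ ℚ K (𝓞 K)
  have h2 := congrArg FractionalIdeal.absNorm h1
  rw [FractionalIdeal.coeIdeal_absNorm, absNorm_differentIdeal K (𝓞 K), map_inv₀] at h2
  unfold slN slD slDiff slDual
  simp only [Units.val_mk0, Units.val_one]
  rw [eq_comm, inv_eq_iff_eq_inv]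
  exact_mod_cast h2

lemma slN_dual {K : Type} [Field K] [NumberField K] (I : slI K) :
    slN (slDual I) = (slN I * slD K)⁻¹ := by
  rw [slDual_eq, slN_mul, slN_inv, slN_diff, mul_inv, mul_comm]

lemma sl_exists_basis {K : Type} [Field K] [NumberField K] (I : slI K) :
    ∃ b : Module.Basis (K →+* ℂ) ℚ K,
      (∀ x, x ∈ (I : FractionalIdeal (nonZeroDivisors (𝓞 K)) K) ↔ x ∈ Submodule.span ℤ (Set.range b)) ∧
      |((Algebra.discr ℚ b : ℚ) : ℝ)| = slN I ^ 2 * slD K := by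
  have hc1 : Fintype.card (Module.Free.ChooseBasisIndex ℤ (𝓞 K)) = Module.finrank ℚ K := by
    rw [← RingOfIntegers.rank, Module.finrank_eq_card_chooseBasisIndex]
  have hc2 : Fintype.card (Module.Free.ChooseBasisIndex ℤ (I : FractionalIdeal (nonZeroDivisors (𝓞 K)) K)) = Module.finrank ℚ K := by
    rw [Module.finrank_eq_card_basis (basisOfFractionalIdeal K I)]
  have e : Module.Free.ChooseBasisIndex ℤ (𝓞 K) ≃ Module.Free.ChooseBasisIndex ℤ (I : FractionalIdeal (nonZeroDivisors (𝓞 K)) K) :=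
    Fintype.equivOfCardEq (hc1.trans hc2.symm)
  have e' : Module.Free.ChooseBasisIndex ℤ (𝓞 K) ≃ (K →+* ℂ) :=
    Fintype.equivOfCardEq (hc1.trans (Embeddings.card K ℂ).symm)
  let b0 := (basisOfFractionalIdeal K I).reindex e.symm
  refine ⟨b0.reindex e', ?_, ?_⟩
  · intro x
    rw [Module.Basis.range_reindex, Module.Basis.range_reindex, mem_span_basisOfFractionalIdeal]
    rfl
  · have h1 : Algebra.discr ℚ (b0.reindex e') = Algebra.discr ℚ b0 := by
      rw [Module.Basis.coe_reindex]
      exact Algebra.discr_reindex ℚ b0 e'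
    have h2 := Algebra.discr_of_matrix_vecMul (A := ℚ) (integralBasis K) ((integralBasis K).toMatrix b0)
    rw [Module.Basis.toMatrix_map_vecMul, ← Module.Basis.det_apply] at h2
    have h3 := det_basisOfFractionalIdeal_eq_absNorm K I e
    rw [h1, h2, ← coe_discr, ← sq_abs, h3]
    unfold slN slD
    push_cast
    rw [abs_mul, abs_of_nonneg (sq_nonneg _), Nat.cast_natAbs, Int.cast_abs]

/-- carrier -/
def slSet {K : Type} [Field K] [NumberField K] (I : slI K) : Set K :=
  {x | x ∈ (I : FractionalIdeal (nonZeroDivisors (𝓞 K)) K)}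

lemma sl_theta_FE {K : Type} [Field K] [NumberField K] (I : slI K)
    (y : InfinitePlace K → ℝ) (hy : ∀ w, 0 < y w) :
    slTheta (slSet I) y = ENNReal.ofReal
      ((slN I * Real.sqrt (slD K * ∏ φ : K →+* ℂ, y (InfinitePlace.mk φ)))⁻¹) *
      slTheta (slSet (slDual I)) (fun w => (y w)⁻¹) := by
  obtain ⟨b, hb, hd⟩ := sl_exists_basis I
  have hdual : ∀ x, x ∈ slSet (slDual I) ↔ x ∈ Submodule.span ℤ (Set.range b.traceDual) := by
    intro x
    have h := Submodule.traceDual_span_of_basis ℤ (K := ℚ)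
      ((I : FractionalIdeal (nonZeroDivisors (𝓞 K)) K) : Submodule (𝓞 K) K) b (by
        ext x
        rw [← hb x]
        rfl)
    rw [← FractionalIdeal.coe_dual ℤ ℚ I.ne_zero] at h
    rw [← h]
    rfl
  rw [sl_theta_basis b y hy (slSet I) hb, (sl_poisson_basis b y hy).1, ENNReal.ofReal_mul (by positivity),
    sl_theta_basis b.traceDual (fun w => (y w)⁻¹) (fun w => inv_pos.mpr (hy w)) _ hdual, hd, mul_assoc,
    Real.sqrt_mul (sq_nonneg _), Real.sqrt_sq (slN_pos I).le]

lemma sl_theta_ne_top {K : Type} [Field K] [NumberField K] (I : slI K)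
    (y : InfinitePlace K → ℝ) (hy : ∀ w, 0 < y w) : slTheta (slSet I) y ≠ ⊤ := by
  obtain ⟨b, hb, hd⟩ := sl_exists_basis I
  rw [sl_theta_basis b y hy (slSet I) hb]
  exact ENNReal.ofReal_ne_top

end

section

open NumberField NumberField.Units NumberField.Units.dirichletUnitTheorem MeasureTheory

/-- the log coordinates -/
def slEll {K : Type} [Field K] [NumberField K] (z : logSpace K) (w : InfinitePlace K) : ℝ :=
  (if h : w ≠ w₀ then z ⟨w, h⟩ else - ∑ i, z i) / (w.mult : ℝ)

lemma slEll_add {K : Type} [Field K] [NumberField K] (z z' : logSpace K) (w : InfinitePlace K) :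
    slEll (z + z') w = slEll z w + slEll z' w := by
  unfold slEll
  rw [← add_div]
  congr 1
  split_ifs
  · rfl
  · simp [Finset.sum_add_distrib]; ring

lemma slEll_smul {K : Type} [Field K] [NumberField K] (c : ℝ) (z : logSpace K) (w : InfinitePlace K) :
    slEll (c • z) w = c * slEll z w := by
  unfold slEll
  rw [← mul_div_assoc]
  congr 1
  split_ifs
  · rfl
  · simp [Finset.mul_sum]

lemma slEll_neg {K : Type} [Field K] [NumberField K] (z : logSpace K) (w : InfinitePlace K) :
    slEll (-z) w = - slEll z w := by
  have := slEll_smul (-1) z w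
  simpa using this

lemma sl_mult_pos {K : Type} [Field K] (w : InfinitePlace K) : (0:ℝ) < (w.mult : ℝ) := by
  exact_mod_cast w.mult_pos

lemma slEll_sum {K : Type} [Field K] [NumberField K] (z : logSpace K) :
    ∑ w : InfinitePlace K, (w.mult : ℝ) * slEll z w = 0 := by
  unfold slEll
  have : ∀ w : InfinitePlace K, (w.mult : ℝ) * ((if h : w ≠ w₀ then z ⟨w, h⟩ else - ∑ i, z i) / (w.mult : ℝ)) =
      if h : w ≠ w₀ then z ⟨w, h⟩ else - ∑ i, z i := by
    intro w
    have := (sl_mult_pos w).ne'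
    field_simp
  simp_rw [this]
  rw [← Fintype.sum_subtype_add_sum_subtype (fun w : InfinitePlace K => w ≠ w₀)]
  have h1 : ∑ i : {w : InfinitePlace K // w ≠ w₀}, (if h : i.1 ≠ w₀ then z ⟨i.1, h⟩ else - ∑ i, z i) = ∑ i, z i := by
    refine Finset.sum_congr rfl fun i _ => ?_
    rw [dif_pos i.2]
  have h2 : ∑ i : {w : InfinitePlace K // ¬ (w ≠ w₀)}, (if h : i.1 ≠ w₀ then z ⟨i.1, h⟩ else - ∑ i, z i) = - ∑ i, z i := by
    have : Unique {w : InfinitePlace K // ¬ (w ≠ w₀)} := ⟨⟨⟨w₀, by simp⟩⟩, fun a => Subtype.ext (by simpa using a.2)⟩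
    rw [Fintype.sum_unique]
    exact dif_neg (this.default.2)
  rw [h1, h2]; ring

lemma slEll_cont {K : Type} [Field K] [NumberField K] (w : InfinitePlace K) :
    Continuous (fun z : logSpace K => slEll z w) := by
  unfold slEll
  split_ifs
  · fun_prop
  · fun_prop

lemma slEll_unit {K : Type} [Field K] [NumberField K] (u : (𝓞 K)ˣ) (w : InfinitePlace K) :
    slEll (logEmbedding K (Additive.ofMul u)) w = Real.log (w (algebraMap (𝓞 K) K u)) := by
  unfold slEll
  have := (sl_mult_pos w).ne'
  split_ifs with h
  · rw [logEmbedding_component]; field_simp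
  · rw [sum_logEmbedding_component]
    have : w = w₀ := by simpa using h
    subst this; field_simp

/-- the point in the positive cone with log-norm coordinate `t` -/
def slY {K : Type} [Field K] [NumberField K] (t : ℝ) (z : logSpace K) (w : InfinitePlace K) : ℝ :=
  Real.exp (t + 2 * slEll z w)

lemma slY_cont {K : Type} [Field K] [NumberField K] :
    Continuous (fun p : ℝ × logSpace K => slY (K := K) p.1 p.2) := by
  refine continuous_pi fun w => ?_
  unfold slY
  have := (slEll_cont w).comp (continuous_snd (X := ℝ) (Y := logSpace K))
  fun_prop

lemma sl_sum_emb {K : Type} [Field K] [NumberField K] (F : InfinitePlace K → ℝ) :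
    ∑ φ : K →+* ℂ, F (InfinitePlace.mk φ) = ∑ w, (w.mult : ℝ) * F w := by
  rw [← Finset.sum_fiberwise Finset.univ (fun φ : K →+* ℂ => InfinitePlace.mk φ)]
  refine Finset.sum_congr rfl fun w _ => ?_
  rw [Finset.sum_congr rfl (g := fun _ => F w) (fun φ hφ => by rw [(Finset.mem_filter.mp hφ).2]),
    Finset.sum_const, nsmul_eq_mul]
  congr 2
  convert InfinitePlace.card_filter_mk_eq w

lemma slq_eq {K : Type} [Field K] [NumberField K] (y : InfinitePlace K → ℝ) (x : K) :
    slq y x = ∑ w : InfinitePlace K, (w.mult : ℝ) * (y w * (w x) ^ 2) := by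
  unfold slq
  rw [← sl_sum_emb (fun w => y w * (w x)^2)]
  rfl

lemma slY_prod {K : Type} [Field K] [NumberField K] (t : ℝ) (z : logSpace K) :
    ∏ φ : K →+* ℂ, slY t z (InfinitePlace.mk φ) = Real.exp (Module.finrank ℚ K * t) := by
  unfold slY
  rw [← Real.exp_sum, sl_sum_emb (fun w => t + 2 * slEll z w)]
  congr 1
  have h := slEll_sum z
  have h2 : ∑ w : InfinitePlace K, (w.mult : ℝ) = Module.finrank ℚ K := by
    exact_mod_cast InfinitePlace.sum_mult_eq (K := K)
  calc ∑ w : InfinitePlace K, (w.mult : ℝ) * (t + 2 * slEll z w)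
      = (∑ w : InfinitePlace K, (w.mult : ℝ)) * t + 2 * ∑ w : InfinitePlace K, (w.mult : ℝ) * slEll z w := by
        rw [Finset.sum_mul, Finset.mul_sum, ← Finset.sum_add_distrib]
        exact Finset.sum_congr rfl fun w _ => by ring
    _ = _ := by rw [h, h2]; ring

lemma slq_unit {K : Type} [Field K] [NumberField K] (u : (𝓞 K)ˣ) (x : K) (t : ℝ) (z : logSpace K) :
    slq (slY t z) (algebraMap (𝓞 K) K u * x) =
      slq (slY t (logEmbedding K (Additive.ofMul u) + z)) x := by
  rw [slq_eq, slq_eq]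
  refine Finset.sum_congr rfl fun w _ => ?_
  unfold slY
  rw [slEll_add, slEll_unit, map_mul]
  have h : 0 < w (algebraMap (𝓞 K) K u) := by
    rw [InfinitePlace.pos_iff]
    simp
  have : Real.exp (t + 2 * (Real.log (w (algebraMap (𝓞 K) K u)) + slEll z w)) =
      Real.exp (t + 2 * slEll z w) * w (algebraMap (𝓞 K) K u) ^ 2 := by
    rw [show t + 2 * (Real.log (w (algebraMap (𝓞 K) K u)) + slEll z w) =
      (t + 2 * slEll z w) + (Real.log (w (algebraMap (𝓞 K) K u)) + Real.log (w (algebraMap (𝓞 K) K u))) by ring,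
      Real.exp_add (t + 2 * slEll z w), Real.exp_add (Real.log _), Real.exp_log h]
    ring
  rw [this]; ring

/-- fundamental domain for the units -/
def slDom (K : Type) [Field K] [NumberField K] : Set (logSpace K) :=
  ZSpan.fundamentalDomain (Module.Basis.ofZLatticeBasis ℝ (unitLattice K) (basisUnitLattice K))

instance slInv (K : Type) [Field K] [NumberField K] :
    VAddInvariantMeasure (unitLattice K) (logSpace K) volume :=
  (inferInstance : VAddInvariantMeasure (unitLattice K).toAddSubgroup (logSpace K) volume)

lemma slDom_fund (K : Type) [Field K] [NumberField K] :
    IsAddFundamentalDomain (unitLattice K) (slDom K) volume :=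
  ZLattice.isAddFundamentalDomain (basisUnitLattice K) volume

lemma slDom_meas (K : Type) [Field K] [NumberField K] : MeasurableSet (slDom K) :=
  ZSpan.fundamentalDomain_measurableSet _

lemma slDom_bdd (K : Type) [Field K] [NumberField K] : Bornology.IsBounded (slDom K) :=
  ZSpan.fundamentalDomain_isBounded _

lemma slDom_neg (K : Type) [Field K] [NumberField K] :
    IsAddFundamentalDomain (unitLattice K) ((fun z => -z) ⁻¹' slDom K) volume := by
  refine (slDom_fund K).preimage_of_equiv (f := fun z => -z) (e := fun g => -g) ?_ ?_ ?_
  · exact (Measure.measurePreserving_neg volume).quasiMeasurePreserving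
  · exact neg_involutive.bijective
  · intro g x
    simp [Submodule.vadd_def, add_comm]

end

section

open NumberField NumberField.Units NumberField.Units.dirichletUnitTheorem MeasureTheory

lemma sl_countable (K : Type) [Field K] [NumberField K] : Countable K :=
  (Module.finBasis ℚ K).equivFun.toEquiv.countable_iff.mpr inferInstance

lemma slTheta_meas {K : Type} [Field K] [NumberField K] (I : Set K) :
    Measurable (fun y : InfinitePlace K → ℝ => slTheta I y) := by
  have := sl_countable K
  unfold slTheta
  refine Measurable.tsum fun x => ?_
  have := (sl_slq_cont (x:K)).measurable
  fun_prop

lemma slThetaY_meas {K : Type} [Field K] [NumberField K] (I : Set K) :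
    Measurable (fun p : ℝ × logSpace K => slTheta I (slY p.1 p.2)) :=
  (slTheta_meas I).comp slY_cont.measurable

lemma slThetaY_meas' {K : Type} [Field K] [NumberField K] (I : Set K) (t : ℝ) :
    Measurable (fun z : logSpace K => slTheta I (slY t z)) := by
  have h : Measurable (fun z : logSpace K => slY (K := K) t z) := by
    refine measurable_pi_lambda _ fun w => ?_
    unfold slY
    have := (slEll_cont w).measurable
    fun_prop
  exact (slTheta_meas I).comp h

lemma slq_mono {K : Type} [Field K] [NumberField K] (y y' : InfinitePlace K → ℝ)
    (h : ∀ w, y w ≤ y' w) (x : K) : slq y x ≤ slq y' x := by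
  unfold slq
  gcongr
  exact h _

lemma slTheta_anti {K : Type} [Field K] [NumberField K] (I : Set K) (y y' : InfinitePlace K → ℝ)
    (h : ∀ w, y w ≤ y' w) : slTheta I y' ≤ slTheta I y := by
  unfold slTheta
  refine ENNReal.tsum_le_tsum fun x => ENNReal.ofReal_le_ofReal (Real.exp_le_exp.mpr ?_)
  have := slq_mono y y' h x
  nlinarith [Real.pi_pos]

lemma slTheta_mono {K : Type} [Field K] [NumberField K] (I J : Set K) (hIJ : I ⊆ J)
    (y : InfinitePlace K → ℝ) : slTheta I y ≤ slTheta J y := by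
  unfold slTheta
  exact ENNReal.tsum_mono_subtype (fun x : K => ENNReal.ofReal (Real.exp (-Real.pi * slq y x))) hIJ

lemma slTheta_zero {K : Type} [Field K] [NumberField K] (I : slI K) (y : InfinitePlace K → ℝ) :
    slTheta (slSet I) y = 1 + slTheta (slSet I \ {0}) y := by
  have h0 : (0:K) ∈ slSet I := by
    show (0:K) ∈ (I : FractionalIdeal (nonZeroDivisors (𝓞 K)) K)
    exact FractionalIdeal.zero_mem _
  have : slSet I = {0} ∪ (slSet I \ {0}) := by
    rw [Set.union_sdiff_cancel]; simpa using h0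
  unfold slTheta
  conv_lhs => rw [this]
  rw [ENNReal.summable.tsum_union_disjoint (f := fun x : K => ENNReal.ofReal (Real.exp (-Real.pi * slq y x))) Set.disjoint_sdiff_right ENNReal.summable]
  congr 1
  rw [tsum_singleton (0:K) (fun x : K => ENNReal.ofReal (Real.exp (-Real.pi * slq y x)))]
  simp [slq]

lemma sl_unit_smul {K : Type} [Field K] [NumberField K] (I : slI K) (u : (𝓞 K)ˣ) (x : K) :
    algebraMap (𝓞 K) K u * x ∈ slSet I ↔ x ∈ slSet I := by
  have key : ∀ (v : (𝓞 K)) (x : K), x ∈ slSet I → algebraMap (𝓞 K) K v * x ∈ slSet I := by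
    intro v x hx
    have := Submodule.smul_mem ((I : FractionalIdeal (nonZeroDivisors (𝓞 K)) K) : Submodule (𝓞 K) K) v hx
    rwa [Algebra.smul_def] at this
  constructor
  · intro h
    have := key (u⁻¹ : (𝓞 K)ˣ) _ h
    rwa [← mul_assoc, ← map_mul, Units.inv_mul, map_one, one_mul] at this
  · exact key u x

lemma slTheta_unit {K : Type} [Field K] [NumberField K] (I : slI K) (u : (𝓞 K)ˣ) (t : ℝ) (z : logSpace K) :
    slTheta (slSet I) (slY t (logEmbedding K (Additive.ofMul u) + z)) = slTheta (slSet I) (slY t z) := by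
  unfold slTheta
  simp_rw [← slq_unit]
  let e : slSet I ≃ slSet I :=
    { toFun := fun x => ⟨algebraMap (𝓞 K) K u * x, (sl_unit_smul I u x).mpr x.2⟩
      invFun := fun x => ⟨algebraMap (𝓞 K) K (u⁻¹ : (𝓞 K)ˣ) * x, (sl_unit_smul I u⁻¹ x).mpr x.2⟩
      left_inv := fun x => by
        apply Subtype.ext
        show algebraMap (𝓞 K) K (u⁻¹ : (𝓞 K)ˣ) * (algebraMap (𝓞 K) K u * x) = x
        rw [← mul_assoc, ← map_mul, Units.inv_mul, map_one, one_mul]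
      right_inv := fun x => by
        apply Subtype.ext
        show algebraMap (𝓞 K) K u * (algebraMap (𝓞 K) K (u⁻¹ : (𝓞 K)ˣ) * x) = x
        rw [← mul_assoc, ← map_mul, Units.mul_inv, map_one, one_mul] }
  exact Equiv.tsum_eq e (fun x : slSet I => ENNReal.ofReal (Real.exp (-Real.pi * slq (slY t z) x)))

lemma sl_mem_lattice {K : Type} [Field K] [NumberField K] (l : unitLattice K) :
    ∃ u : (𝓞 K)ˣ, logEmbedding K (Additive.ofMul u) = l := by
  obtain ⟨x, -, hx⟩ := l.2
  exact ⟨Additive.toMul x, hx⟩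

/-- theta integrated over the unit fundamental domain -/
def slF {K : Type} [Field K] [NumberField K] (I : slI K) (t : ℝ) : ENNReal :=
  ∫⁻ z in slDom K, slTheta (slSet I) (slY t z)

def slF' {K : Type} [Field K] [NumberField K] (I : slI K) (t : ℝ) : ENNReal :=
  ∫⁻ z in slDom K, slTheta (slSet I \ {0}) (slY t z)

def slVol (K : Type) [Field K] [NumberField K] : ENNReal := (volume : Measure (logSpace K)) (slDom K)

lemma slVol_ne_top (K : Type) [Field K] [NumberField K] : slVol K ≠ ⊤ :=
  (slDom_bdd K).measure_lt_top.ne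

lemma slF_eq {K : Type} [Field K] [NumberField K] (I : slI K) (t : ℝ) :
    slF I t = slVol K + slF' I t := by
  unfold slF slF' slVol
  simp_rw [slTheta_zero]
  rw [lintegral_add_left measurable_const]
  simp

lemma slF_FE {K : Type} [Field K] [NumberField K] (I : slI K) (t : ℝ) :
    slF I t = ENNReal.ofReal ((slN I * Real.sqrt (slD K * Real.exp (Module.finrank ℚ K * t)))⁻¹) *
      slF (slDual I) (-t) := by
  unfold slF
  have h1 : ∀ z, slTheta (slSet I) (slY t z) =
      ENNReal.ofReal ((slN I * Real.sqrt (slD K * Real.exp (Module.finrank ℚ K * t)))⁻¹) *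
       slTheta (slSet (slDual I)) (slY (-t) (-z)) := by
    intro z
    rw [sl_theta_FE I (slY t z) (fun w => Real.exp_pos _), slY_prod]
    congr 2
    ext w
    unfold slY
    rw [slEll_neg, ← Real.exp_neg]
    congr 1; ring
  simp_rw [h1]
  rw [lintegral_const_mul' _ _ ENNReal.ofReal_ne_top]
  congr 1
  set g : logSpace K → ENNReal := fun z => slTheta (slSet (slDual I)) (slY (-t) z) with hg
  have hgm : Measurable g := slThetaY_meas' _ _
  rw [(slDom_fund K).setLIntegral_eq (slDom_neg K) g]
  · have := (Measure.measurePreserving_neg (volume : Measure (logSpace K))).setLIntegral_comp_preimage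
      ((slDom_meas K).preimage measurable_neg) hgm
    rw [← this]
    congr 2
    ext z
    simp
  · intro l z
    obtain ⟨u, hu⟩ := sl_mem_lattice l
    rw [Submodule.vadd_def, ← hu]
    exact slTheta_unit _ u _ _

lemma slq_pos {K : Type} [Field K] [NumberField K] (x : K) (hx : x ≠ 0) : 0 < slq (fun _ => 1) x := by
  unfold slq
  refine Finset.sum_pos (fun φ _ => ?_) Finset.univ_nonempty
  have : 0 < ‖φ x‖ := norm_pos_iff.mpr (by simpa using hx)
  positivity

lemma slq_smul {K : Type} [Field K] [NumberField K] (c : ℝ) (x : K) :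
    slq (fun _ => c) x = c * slq (fun _ => 1) x := by
  unfold slq
  rw [Finset.mul_sum]; simp

lemma slq_lower {K : Type} [Field K] [NumberField K] (I : slI K) :
    ∃ m : ℝ, 0 < m ∧ ∀ x ∈ slSet I, x ≠ 0 → m ≤ slq (fun _ => 1) x := by
  have h := sl_theta_ne_top I (fun _ => 1) (fun _ => one_pos)
  have hfin := ENNReal.finite_const_le_of_tsum_ne_top h (ε := ENNReal.ofReal (Real.exp (-Real.pi)))
    (by simp [Real.exp_pos])
  have hfin2 : {x : K | x ∈ slSet I ∧ x ≠ 0 ∧ slq (fun _ => 1) x ≤ 1}.Finite := by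
    refine (hfin.image Subtype.val).subset ?_
    rintro x ⟨hx, -, hx1⟩
    refine ⟨⟨x, hx⟩, ?_, rfl⟩
    show ENNReal.ofReal (Real.exp (-Real.pi)) ≤ ENNReal.ofReal (Real.exp (-Real.pi * slq (fun _ => 1) x))
    apply ENNReal.ofReal_le_ofReal
    apply Real.exp_le_exp.mpr
    nlinarith [Real.pi_pos]
  by_cases hne : {x : K | x ∈ slSet I ∧ x ≠ 0 ∧ slq (fun _ => 1) x ≤ 1}.Nonempty
  · obtain ⟨a, ha, hmin⟩ := Set.exists_min_image _ (fun x : K => slq (fun _ => 1) x) hfin2 hne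
    refine ⟨min 1 (slq (fun _ => 1) a), lt_min one_pos (slq_pos _ ha.2.1), fun x hx hx0 => ?_⟩
    rcases le_total (slq (fun _ => 1) x) 1 with h1 | h1
    · exact (min_le_right _ _).trans (hmin x ⟨hx, hx0, h1⟩)
    · exact (min_le_left _ _).trans h1
  · refine ⟨1, one_pos, fun x hx hx0 => ?_⟩
    by_contra h1
    exact hne ⟨x, hx, hx0, (not_le.mp h1).le⟩

lemma slDom_lower (K : Type) [Field K] [NumberField K] :
    ∃ d : ℝ, 0 < d ∧ ∀ z ∈ slDom K, ∀ (t : ℝ) (w : InfinitePlace K), d * Real.exp t ≤ slY t z w := by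
  obtain ⟨R, hR⟩ := (slDom_bdd K).subset_closedBall 0
  have hc := isCompact_closedBall (0 : logSpace K) R
  have : ∀ w : InfinitePlace K, ∃ M : ℝ, ∀ z ∈ slDom K, -M ≤ slEll z w := by
    intro w
    obtain ⟨M, hM⟩ := (hc.bddBelow_image (slEll_cont w).continuousOn)
    exact ⟨-M, fun z hz => by rw [neg_neg]; exact hM ⟨z, hR hz, rfl⟩⟩
  choose M hM using this
  refine ⟨Real.exp (-(2 * ∑ w, |M w|)), Real.exp_pos _, fun z hz t w => ?_⟩
  unfold slY
  rw [← Real.exp_add]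
  apply Real.exp_le_exp.mpr
  have h1 := hM w z hz
  have h2 : |M w| ≤ ∑ w, |M w| := Finset.single_le_sum (f := fun w => |M w|) (fun _ _ => abs_nonneg _) (Finset.mem_univ w)
  have h3 := le_abs_self (M w)
  linarith

lemma slF_ne_top {K : Type} [Field K] [NumberField K] (I : slI K) (t : ℝ) : slF I t ≠ ⊤ := by
  obtain ⟨d, hd, h⟩ := slDom_lower K
  have : slF I t ≤ ∫⁻ z in slDom K, slTheta (slSet I) (fun _ => d * Real.exp t) :=
    setLIntegral_mono measurable_const (fun z hz => slTheta_anti _ _ _ (fun w => h z hz t w))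
  refine ne_top_of_le_ne_top ?_ this
  rw [setLIntegral_const]
  exact ENNReal.mul_ne_top (sl_theta_ne_top _ _ (fun _ => by positivity)) (slVol_ne_top K)

lemma slF_anti {K : Type} [Field K] [NumberField K] (I : slI K) : Antitone (slF I) := by
  intro t t' htt
  unfold slF
  refine lintegral_mono fun z => slTheta_anti _ _ _ fun w => ?_
  unfold slY
  gcongr

lemma slF'_decay {K : Type} [Field K] [NumberField K] (I : slI K) :
    ∃ a C : ℝ, 0 < a ∧ ∀ t, 0 ≤ t → slF' I t ≤ ENNReal.ofReal (C * Real.exp (-a * Real.exp t)) := by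
  obtain ⟨d, hd, h⟩ := slDom_lower K
  obtain ⟨m, hm, hq⟩ := slq_lower I
  set T := slTheta (slSet I) (fun _ => d) with hT
  have hTt : T ≠ ⊤ := sl_theta_ne_top _ _ (fun _ => hd)
  set a := Real.pi * d * m with ha
  refine ⟨a, (T * slVol K).toReal * Real.exp a, by positivity, fun t ht => ?_⟩
  have ht1 : 1 ≤ Real.exp t := Real.one_le_exp ht
  have key : ∀ z ∈ slDom K, slTheta (slSet I \ {0}) (slY t z) ≤ ENNReal.ofReal (Real.exp (-a * (Real.exp t - 1))) * T := by
    intro z hz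
    calc slTheta (slSet I \ {0}) (slY t z) ≤ slTheta (slSet I \ {0}) (fun _ => d * Real.exp t) :=
          slTheta_anti _ _ _ (fun w => h z hz t w)
      _ ≤ ENNReal.ofReal (Real.exp (-a * (Real.exp t - 1))) * slTheta (slSet I \ {0}) (fun _ => d) := by
          unfold slTheta
          rw [← ENNReal.tsum_mul_left]
          refine ENNReal.tsum_le_tsum fun x => ?_
          rw [← ENNReal.ofReal_mul (Real.exp_pos _).le, ← Real.exp_add]
          apply ENNReal.ofReal_le_ofReal
          apply Real.exp_le_exp.mpr
          rw [slq_smul, slq_smul d]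
          have h1 := hq x x.2.1 x.2.2
          have h2 : 0 ≤ Real.pi * d * (Real.exp t - 1) := by
            have := Real.pi_pos
            have : 0 ≤ Real.exp t - 1 := by linarith
            positivity
          have h3 := mul_le_mul_of_nonneg_left h1 h2
          rw [ha]
          nlinarith
      _ ≤ _ := by
          gcongr
          exact slTheta_mono _ _ Set.sdiff_subset _
  calc slF' I t ≤ ∫⁻ z in slDom K, ENNReal.ofReal (Real.exp (-a * (Real.exp t - 1))) * T :=
        setLIntegral_mono measurable_const key
    _ = ENNReal.ofReal (Real.exp (-a * (Real.exp t - 1))) * (T * slVol K) := by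
        rw [setLIntegral_const, mul_assoc]; rfl
    _ = _ := by
        rw [← ENNReal.ofReal_toReal (ENNReal.mul_ne_top hTt (slVol_ne_top K)), ← ENNReal.ofReal_mul (Real.exp_pos _).le]
        congr 1
        rw [ENNReal.toReal_ofReal ENNReal.toReal_nonneg, mul_assoc, ← Real.exp_add, mul_comm]
        congr 2
        ring

end

section

open NumberField NumberField.Units NumberField.Units.dirichletUnitTheorem MeasureTheory

lemma sl_gamma_int {s r : ℝ} (hs : 0 < s) (hr : 0 < r) :
    Integrable (fun v : ℝ => Real.exp (s * v) * Real.exp (-(r * Real.exp v))) ∧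
    ∫ v : ℝ, Real.exp (s * v) * Real.exp (-(r * Real.exp v)) = (1 / r) ^ s * Real.Gamma s := by
  have him : Real.exp '' Set.univ = Set.Ioi 0 := by
    rw [Set.image_univ, Real.range_exp]
  have hder : ∀ x ∈ (Set.univ : Set ℝ), HasDerivWithinAt Real.exp (Real.exp x) Set.univ x :=
    fun x _ => (Real.hasDerivAt_exp x).hasDerivWithinAt
  have hfun : (fun v : ℝ => |Real.exp v| • ((Real.exp v) ^ (s - 1) * Real.exp (-(r * Real.exp v)))) =
      fun v => Real.exp (s * v) * Real.exp (-(r * Real.exp v)) := by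
    ext v
    rw [abs_of_pos (Real.exp_pos _), smul_eq_mul, ← mul_assoc, ← Real.exp_mul, ← Real.exp_add]
    congr 2; ring
  have h1 := integral_image_eq_integral_abs_deriv_smul MeasurableSet.univ hder Real.exp_injective.injOn
    (fun t : ℝ => t ^ (s - 1) * Real.exp (-(r * t)))
  have h2 := integrableOn_image_iff_integrableOn_abs_deriv_smul MeasurableSet.univ hder Real.exp_injective.injOn
    (fun t : ℝ => t ^ (s - 1) * Real.exp (-(r * t)))
  rw [him] at h1 h2
  rw [hfun, Real.integral_rpow_mul_exp_neg_mul_Ioi hs hr, setIntegral_univ] at h1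
  rw [hfun, integrableOn_univ] at h2
  refine ⟨h2.mp ?_, h1.symm⟩
  have := integrableOn_rpow_mul_exp_neg_mul_rpow (p := 1) (s := s - 1) (b := r) (by linarith) one_pos hr
  simpa using this

/-- gamma factor -/
def slG (K : Type) [Field K] [NumberField K] (σ : ℝ) : ℝ :=
  ∏ w : InfinitePlace K, (1 / (Real.pi * w.mult)) ^ ((w.mult : ℝ) * σ / 2) * Real.Gamma ((w.mult : ℝ) * σ / 2)

/-- the linear map `(t,z) ↦ (t + 2 ℓ_w z)_w` -/
def slL (K : Type) [Field K] [NumberField K] : (ℝ × logSpace K) →ₗ[ℝ] (InfinitePlace K → ℝ) where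
  toFun p w := p.1 + 2 * slEll p.2 w
  map_add' p q := by
    ext w
    simp only [Prod.fst_add, Prod.snd_add, slEll_add, Pi.add_apply]; ring
  map_smul' c p := by
    ext w
    simp only [Prod.smul_fst, Prod.smul_snd, slEll_smul, Pi.smul_apply, smul_eq_mul, RingHom.id_apply]; ring

lemma sl_sum_mult (K : Type) [Field K] [NumberField K] :
    ∑ w : InfinitePlace K, (w.mult : ℝ) = Module.finrank ℚ K := by
  exact_mod_cast InfinitePlace.sum_mult_eq (K := K)

lemma slL_sum {K : Type} [Field K] [NumberField K] (t : ℝ) (z : logSpace K) :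
    ∑ w : InfinitePlace K, (w.mult : ℝ) * (t + 2 * slEll z w) = Module.finrank ℚ K * t := by
  calc ∑ w : InfinitePlace K, (w.mult : ℝ) * (t + 2 * slEll z w)
      = (∑ w : InfinitePlace K, (w.mult : ℝ)) * t + 2 * ∑ w : InfinitePlace K, (w.mult : ℝ) * slEll z w := by
        rw [Finset.sum_mul, Finset.mul_sum, ← Finset.sum_add_distrib]
        exact Finset.sum_congr rfl fun w _ => by ring
    _ = _ := by rw [slEll_sum, sl_sum_mult]; ring

lemma slL_inj (K : Type) [Field K] [NumberField K] : Function.Injective (slL K) := by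
  rw [← LinearMap.ker_eq_bot, LinearMap.ker_eq_bot']
  rintro ⟨t, z⟩ h
  have h' : ∀ w, t + 2 * slEll z w = 0 := fun w => congrFun h w
  have hs := slL_sum t z
  simp_rw [h', mul_zero, Finset.sum_const_zero] at hs
  have hn : (0:ℝ) < Module.finrank ℚ K := by exact_mod_cast Module.finrank_pos
  have ht : t = 0 := by
    rcases mul_eq_zero.mp hs.symm with h | h
    · exact absurd h hn.ne'
    · exact h
  subst ht
  have hz : z = 0 := by
    ext i
    have h1 := h' i.1
    unfold slEll at h1
    rw [dif_pos i.2] at h1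
    have := (sl_mult_pos i.1).ne'
    field_simp at h1
    simpa using h1
  simp [hz]

def slLe (K : Type) [Field K] [NumberField K] : (ℝ × logSpace K) ≃L[ℝ] (InfinitePlace K → ℝ) :=
  (LinearEquiv.ofInjectiveOfFinrankEq (slL K) (slL_inj K) (by
    rw [Module.finrank_prod, Module.finrank_self, Module.finrank_fintype_fun_eq_card, Module.finrank_fintype_fun_eq_card,
      Fintype.card_subtype_compl, Fintype.card_subtype_eq]
    have : 0 < Fintype.card (InfinitePlace K) := Fintype.card_pos
    omega)).toContinuousLinearEquiv

lemma slLe_apply {K : Type} [Field K] [NumberField K] (t : ℝ) (z : logSpace K) (w : InfinitePlace K) :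
    slLe K (t, z) w = t + 2 * slEll z w := rfl

instance slHaar (K : Type) [Field K] [NumberField K] :
    (Measure.map (slLe K) ((volume : Measure ℝ).prod (volume : Measure (logSpace K)))).IsAddHaarMeasure :=
  ContinuousLinearEquiv.isAddHaarMeasure_map _ _

def slc (K : Type) [Field K] [NumberField K] : NNReal :=
  (Measure.map (slLe K) ((volume : Measure ℝ).prod (volume : Measure (logSpace K)))).addHaarScalarFactor
    (volume : Measure (InfinitePlace K → ℝ))

lemma slc_spec (K : Type) [Field K] [NumberField K] : 0 < slc K ∧
    ∀ f : (InfinitePlace K → ℝ) → ENNReal, Measurable f →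
      ∫⁻ t : ℝ, ∫⁻ z : logSpace K, f (fun w => t + 2 * slEll z w) = slc K * ∫⁻ v, f v := by
  refine ⟨Measure.addHaarScalarFactor_pos_of_isAddHaarMeasure _ _, fun f hf => ?_⟩
  have h1 := Measure.isAddLeftInvariant_eq_smul
    (Measure.map (slLe K) ((volume : Measure ℝ).prod (volume : Measure (logSpace K)))) volume
  have hm : Measurable (slLe K) := (slLe K).continuous.measurable
  have h2 := lintegral_map hf hm (μ := (volume : Measure ℝ).prod (volume : Measure (logSpace K)))
  rw [lintegral_prod (fun p => f (slLe K p)) (hf.comp hm).aemeasurable] at h2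
  rw [show (∫⁻ t : ℝ, ∫⁻ z : logSpace K, f (fun w => t + 2 * slEll z w)) =
    ∫⁻ t : ℝ, ∫⁻ z : logSpace K, f (slLe K (t, z)) from rfl, ← h2, h1]
  rw [lintegral_smul_measure]
  rfl

lemma sl_mellin_x {K : Type} [Field K] [NumberField K] (x : K) (hx : x ≠ 0) {σ : ℝ} (hσ : 0 < σ) :
    ∫⁻ t : ℝ, ∫⁻ z : logSpace K, ENNReal.ofReal (Real.exp (Module.finrank ℚ K * σ / 2 * t)) *
      ENNReal.ofReal (Real.exp (-Real.pi * slq (slY t z) x)) =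
    slc K * ENNReal.ofReal (slG K σ) * ENNReal.ofReal (((|Algebra.norm ℚ x| : ℚ) : ℝ) ^ (-σ)) := by
  have hwx : ∀ w : InfinitePlace K, 0 < w x := fun w => InfinitePlace.pos_iff.mpr hx
  set F : InfinitePlace K → ℝ → ℝ := fun w v =>
    Real.exp (((w.mult : ℝ) * σ / 2) * v) * Real.exp (-((Real.pi * w.mult * (w x)^2) * Real.exp v)) with hF
  have hFi : ∀ w, Integrable (F w) ∧ ∫ v, F w v =
      (1 / (Real.pi * w.mult * (w x)^2)) ^ ((w.mult : ℝ) * σ / 2) * Real.Gamma ((w.mult : ℝ) * σ / 2) := by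
    intro w
    have := sl_mult_pos w
    have := hwx w
    have := Real.pi_pos
    exact sl_gamma_int (by positivity) (by positivity)
  have hFm : ∀ w, Measurable (F w) := fun w => by
    simp only [hF]; fun_prop
  have h1 : ∀ t (z : logSpace K), ENNReal.ofReal (Real.exp (Module.finrank ℚ K * σ / 2 * t)) *
      ENNReal.ofReal (Real.exp (-Real.pi * slq (slY t z) x)) =
      (fun v : InfinitePlace K → ℝ => ENNReal.ofReal (∏ w, F w (v w))) (fun w => t + 2 * slEll z w) := by
    intro t z
    rw [← ENNReal.ofReal_mul (Real.exp_pos _).le, ← Real.exp_add]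
    congr 1
    simp only [hF, ← Real.exp_add]
    rw [← Real.exp_sum]
    congr 1
    rw [Finset.sum_add_distrib, slq_eq, Finset.mul_sum]
    congr 1
    · rw [show (Module.finrank ℚ K : ℝ) * σ / 2 * t = σ / 2 * (Module.finrank ℚ K * t) by ring, ← slL_sum t z, Finset.mul_sum]
      exact Finset.sum_congr rfl fun w _ => by ring
    · refine Finset.sum_congr rfl fun w _ => ?_
      unfold slY; ring
  simp_rw [h1]
  rw [(slc_spec K).2 (fun v : InfinitePlace K → ℝ => ENNReal.ofReal (∏ w, F w (v w))) (by fun_prop), mul_assoc]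
  congr 1
  have hint : Integrable (fun v : InfinitePlace K → ℝ => ∏ w, F w (v w)) volume :=
    Integrable.fintype_prod (fun w => (hFi w).1)
  rw [← ofReal_integral_eq_lintegral_ofReal hint (Filter.Eventually.of_forall fun v =>
    Finset.prod_nonneg fun w _ => by simp only [hF]; positivity),
    integral_fintype_prod_volume_eq_prod, ← ENNReal.ofReal_mul (by
      unfold slG
      exact Finset.prod_nonneg fun w _ => mul_nonneg (by positivity) (Real.Gamma_nonneg_of_nonneg (by positivity)))]
  congr 1
  rw [← InfinitePlace.prod_eq_abs_norm, ← Real.finsetProd_rpow _ _ (fun w _ => by have := hwx w; positivity)]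
  unfold slG
  rw [← Finset.prod_mul_distrib]
  refine Finset.prod_congr rfl fun w _ => ?_
  rw [(hFi w).2]
  have h3 : (1 / (Real.pi * w.mult * (w x)^2)) ^ ((w.mult : ℝ) * σ / 2) =
      (1 / (Real.pi * w.mult)) ^ ((w.mult : ℝ) * σ / 2) * (w x ^ w.mult) ^ (-σ) := by
    have := sl_mult_pos w
    have h4 := hwx w
    have := Real.pi_pos
    rw [← one_div_mul_one_div, Real.mul_rpow (by positivity) (by positivity)]
    congr 1
    rw [one_div, Real.inv_rpow (by positivity), ← Real.rpow_neg (by positivity), ← Real.rpow_natCast, ← Real.rpow_natCast,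
      ← Real.rpow_mul h4.le, ← Real.rpow_mul h4.le]
    congr 1
    push_cast; ring
  rw [h3]; ring

end

section

open NumberField NumberField.Units NumberField.Units.dirichletUnitTheorem MeasureTheory

lemma sl_tsum_hom {G H : Type} [Group G] [Group H] (f : G →* H) :
    ∃ s : f.range → G, (∀ p, f (s p) = p) ∧
      ∀ F : G → ENNReal, ∑' g, F g = ∑' p : f.range, ∑' k : f.ker, F (k * s p) := by
  have h : ∀ p : f.range, ∃ g, f g = p := fun p => p.2
  choose s hs using h
  refine ⟨s, hs, fun F => ?_⟩
  rw [← ENNReal.tsum_prod (f := fun (p : f.range) (k : f.ker) => F (k * s p))]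
  let e : f.range × f.ker ≃ G :=
    { toFun := fun q => q.2 * s q.1
      invFun := fun g => (⟨f g, g, rfl⟩, ⟨g * (s ⟨f g, g, rfl⟩)⁻¹, by
        rw [MonoidHom.mem_ker, map_mul, map_inv, hs]; simp⟩)
      left_inv := by
        rintro ⟨p, k⟩
        have h1 : f (k * s p) = p := by rw [map_mul, hs, MonoidHom.mem_ker.mp k.2, one_mul]
        have h2 : (⟨f (k * s p), k * s p, rfl⟩ : f.range) = p := Subtype.ext h1
        refine Prod.ext h2 ?_
        apply Subtype.ext
        simp only [h2]
        group
      right_inv := by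
        intro g
        simp }
  exact (e.tsum_eq F).symm

lemma sl_unit_sum {K : Type} [Field K] [NumberField K] (H : logSpace K → ENNReal) :
    ∑' u : (𝓞 K)ˣ, H (logEmbedding K (Additive.ofMul u)) =
      Nat.card (torsion K) * ∑' l : unitLattice K, H l := by
  let f : (𝓞 K)ˣ →* Multiplicative (logSpace K) :=
    { toFun := fun u => Multiplicative.ofAdd (logEmbedding K (Additive.ofMul u))
      map_one' := by simp
      map_mul' := fun a b => by simp [ofAdd_add] }
  obtain ⟨s, hs, hF⟩ := sl_tsum_hom f
  rw [hF]
  have h1 : ∀ (p : f.range) (k : f.ker), logEmbedding K (Additive.ofMul ((k : (𝓞 K)ˣ) * s p)) =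
      Multiplicative.toAdd (p : Multiplicative (logSpace K)) := by
    intro p k
    have : f (k * s p) = p := by rw [map_mul, hs, MonoidHom.mem_ker.mp k.2, one_mul]
    rw [← this]; rfl
  simp_rw [h1]
  have hk : f.ker = torsion K := by
    ext u
    rw [← logEmbedding_eq_zero_iff, MonoidHom.mem_ker]
    rfl
  have h2 : ∀ c : ENNReal, ∑' k : f.ker, c = Nat.card (torsion K) * c := by
    intro c
    rw [hk]
    have := Fintype.ofFinite (torsion K)
    rw [tsum_fintype, Finset.sum_const, Finset.card_univ, nsmul_eq_mul, Nat.card_eq_fintype_card]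
  simp_rw [h2]
  rw [ENNReal.tsum_mul_left]
  congr 1
  let e : f.range ≃ unitLattice K :=
    { toFun := fun p => ⟨Multiplicative.toAdd p.1, by
        obtain ⟨u, hu⟩ := p.2
        exact ⟨Additive.ofMul u, trivial, by rw [← hu]; rfl⟩⟩
      invFun := fun l => ⟨Multiplicative.ofAdd l.1, by
        obtain ⟨u, hu⟩ := sl_mem_lattice l
        exact ⟨u, by rw [← hu]; rfl⟩⟩
      left_inv := fun p => rfl
      right_inv := fun l => rfl }
  exact e.tsum_eq (fun l : unitLattice K => H l)

lemma sl_unfold {K : Type} [Field K] [NumberField K] (H : logSpace K → ENNReal) :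
    ∑' u : (𝓞 K)ˣ, ∫⁻ z in slDom K, H (logEmbedding K (Additive.ofMul u) + z) =
      Nat.card (torsion K) * ∫⁻ z, H z := by
  rw [sl_unit_sum (fun l => ∫⁻ z in slDom K, H (l + z)), (slDom_fund K).lintegral_eq_tsum'' H]
  rfl

abbrev slP (K : Type) [Field K] [NumberField K] : Kˣ →* slI K := toPrincipalIdeal (𝓞 K) K

lemma slP_le {K : Type} [Field K] [NumberField K] (x : Kˣ) (I : slI K) :
    (slP K x : FractionalIdeal (nonZeroDivisors (𝓞 K)) K) ≤ I ↔ (x : K) ∈ slSet I := by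
  rw [coe_toPrincipalIdeal, FractionalIdeal.spanSingleton_le_iff_mem]
  rfl

lemma slP_norm {K : Type} [Field K] [NumberField K] (x : Kˣ) :
    slN (slP K x) = ((|Algebra.norm ℚ (x : K)| : ℚ) : ℝ) := by
  unfold slN
  rw [coe_toPrincipalIdeal, FractionalIdeal.absNorm_span_singleton]

lemma slP_ker {K : Type} [Field K] [NumberField K] (F : Kˣ → ENNReal) :
    ∑' k : (slP K).ker, F k = ∑' u : (𝓞 K)ˣ, F (Units.map (algebraMap (𝓞 K) K).toMonoidHom u) := by
  have hmem : ∀ x : K, x ∈ (1 : FractionalIdeal (nonZeroDivisors (𝓞 K)) K) → ∃ a : 𝓞 K, algebraMap (𝓞 K) K a = x := by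
    intro x hx
    exact (FractionalIdeal.mem_one_iff _).mp hx
  have hker : ∀ x : Kˣ, x ∈ (slP K).ker → ∃ a : 𝓞 K, algebraMap (𝓞 K) K a = x := by
    intro x hx
    apply hmem
    have h1 : (slP K x : FractionalIdeal (nonZeroDivisors (𝓞 K)) K) ≤ ((1 : slI K) : FractionalIdeal (nonZeroDivisors (𝓞 K)) K) := by
      rw [MonoidHom.mem_ker.mp hx]
    exact (slP_le x 1).mp h1
  have hle : ∀ a : 𝓞 K, ∀ x : Kˣ, algebraMap (𝓞 K) K a = x →
      (slP K x : FractionalIdeal (nonZeroDivisors (𝓞 K)) K) ≤ 1 := by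
    intro a x hax
    rw [coe_toPrincipalIdeal, FractionalIdeal.spanSingleton_le_iff_mem]
    exact (FractionalIdeal.mem_one_iff _).mpr ⟨a, hax⟩
  let g : (𝓞 K)ˣ → (slP K).ker := fun u => ⟨Units.map (algebraMap (𝓞 K) K).toMonoidHom u, by
    rw [MonoidHom.mem_ker, toPrincipalIdeal_eq_iff]
    refine le_antisymm ?_ ?_
    · rw [FractionalIdeal.spanSingleton_le_iff_mem]
      exact (FractionalIdeal.mem_one_iff _).mpr ⟨u, rfl⟩
    · intro y hy
      obtain ⟨a, ha⟩ := (FractionalIdeal.mem_one_iff _).mp hy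
      refine (FractionalIdeal.mem_spanSingleton _).mpr ⟨a * (u⁻¹ : (𝓞 K)ˣ), ?_⟩
      rw [← ha, Algebra.smul_def]
      show algebraMap (𝓞 K) K (a * (u⁻¹ : (𝓞 K)ˣ)) * algebraMap (𝓞 K) K u = _
      rw [← map_mul, mul_assoc, Units.inv_mul, mul_one]⟩
  have hg : Function.Bijective g := by
    constructor
    · intro u v huv
      have h1 : (algebraMap (𝓞 K) K) u = (algebraMap (𝓞 K) K) v :=
        congrArg (fun k : (slP K).ker => ((k : Kˣ) : K)) huv
      exact Units.ext (FaithfulSMul.algebraMap_injective (𝓞 K) K h1)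
    · rintro ⟨x, hx⟩
      obtain ⟨a, ha⟩ := hker x hx
      obtain ⟨b, hb⟩ := hker x⁻¹ (inv_mem hx)
      have hab : a * b = 1 := by
        apply FaithfulSMul.algebraMap_injective (𝓞 K) K
        rw [map_mul, ha, hb, map_one]
        simp
      refine ⟨⟨a, b, hab, by rw [mul_comm, hab]⟩, ?_⟩
      apply Subtype.ext
      apply Units.ext
      exact ha
  exact ((Equiv.ofBijective g hg).tsum_eq (fun k : (slP K).ker => F k)).symm

lemma sl_theta_units {K : Type} [Field K] [NumberField K] (I : slI K) (y : InfinitePlace K → ℝ) :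
    slTheta (slSet I \ {0}) y = ∑' x : Kˣ, if (x : K) ∈ slSet I then
      ENNReal.ofReal (Real.exp (-Real.pi * slq y x)) else 0 := by
  unfold slTheta
  rw [tsum_subtype (slSet I \ {0}) (fun x : K => ENNReal.ofReal (Real.exp (-Real.pi * slq y x)))]
  set g : K → ENNReal := (slSet I \ {0}).indicator (fun x : K => ENNReal.ofReal (Real.exp (-Real.pi * slq y x))) with hg
  have hinj : Function.Injective (fun x : Kˣ => (x : K)) := Units.val_injective
  have hsup : Function.support g ⊆ Set.range (fun x : Kˣ => (x : K)) := by
    intro x hx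
    have : x ∈ slSet I \ {0} := Set.mem_of_indicator_ne_zero hx
    exact ⟨Units.mk0 x this.2, rfl⟩
  rw [← hinj.tsum_eq hsup]
  refine tsum_congr fun x => ?_
  simp only [hg, Set.indicator, Set.mem_sdiff, Set.mem_singleton_iff, Units.ne_zero, not_false_eq_true, and_true]

def slW (K : Type) [Field K] [NumberField K] : ENNReal := Nat.card (torsion K) * slc K

lemma slW_pos (K : Type) [Field K] [NumberField K] : 0 < slW K := by
  unfold slW
  refine ENNReal.mul_pos ?_ ?_
  · exact_mod_cast Nat.card_pos.ne'
  · exact_mod_cast (slc_spec K).1.ne'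

lemma slW_ne_top (K : Type) [Field K] [NumberField K] : slW K ≠ ⊤ := by
  unfold slW
  exact ENNReal.mul_ne_top (ENNReal.natCast_ne_top _) ENNReal.coe_ne_top

lemma sl_e_meas {K : Type} [Field K] [NumberField K] (σ : ℝ) (x : K) :
    Measurable (fun p : ℝ × logSpace K => ENNReal.ofReal (Real.exp (Module.finrank ℚ K * σ / 2 * p.1)) *
      ENNReal.ofReal (Real.exp (-Real.pi * slq (slY p.1 p.2) x))) := by
  have h1 : Measurable (fun p : ℝ × logSpace K => slq (slY p.1 p.2) x) := by
    have h : ∀ w, Measurable (fun p : ℝ × logSpace K => slY p.1 p.2 w) := fun w =>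
      (measurable_pi_apply w).comp slY_cont.measurable
    unfold slq
    refine Finset.measurable_sum _ fun φ _ => ?_
    exact (h _).mul_const _
  fun_prop

lemma sl_mellin_F {K : Type} [Field K] [NumberField K] (I : slI K) {σ : ℝ} (hσ : 0 < σ) :
    ∫⁻ t : ℝ, ENNReal.ofReal (Real.exp (Module.finrank ℚ K * σ / 2 * t)) * slF' I t =
    slW K * ENNReal.ofReal (slG K σ) * ∑' P : (slP K).range,
      if ((P : slI K) : FractionalIdeal (nonZeroDivisors (𝓞 K)) K) ≤ I then ENNReal.ofReal (slN (P : slI K) ^ (-σ)) else 0 := by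
  have hc := sl_countable K
  have hcu : Countable Kˣ := Units.val_injective.countable
  have hcu' : Countable (𝓞 K)ˣ := by
    have : Countable (𝓞 K) := (FaithfulSMul.algebraMap_injective (𝓞 K) K).countable
    exact Units.val_injective.countable
  set e : K → ℝ → logSpace K → ENNReal := fun x t z =>
    ENNReal.ofReal (Real.exp (Module.finrank ℚ K * σ / 2 * t)) *
      ENNReal.ofReal (Real.exp (-Real.pi * slq (slY t z) x)) with he
  have hem : ∀ x, Measurable (fun p : ℝ × logSpace K => e x p.1 p.2) := fun x => sl_e_meas σ x
  have hem2 : ∀ x t, Measurable (fun z : logSpace K => e x t z) := fun x t =>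
    (hem x).comp (measurable_const.prodMk measurable_id)
  have hem3 : ∀ x, Measurable (fun t => ∫⁻ z in slDom K, e x t z) := fun x =>
    (hem x).lintegral_prod_right'
  have h1 : ∀ t, ENNReal.ofReal (Real.exp (Module.finrank ℚ K * σ / 2 * t)) * slF' I t =
      ∑' x : Kˣ, if (x : K) ∈ slSet I then ∫⁻ z in slDom K, e x t z else 0 := by
    intro t
    unfold slF'
    rw [← lintegral_const_mul _ (slThetaY_meas' _ t)]
    simp_rw [sl_theta_units, ← ENNReal.tsum_mul_left]
    rw [lintegral_tsum]
    · refine tsum_congr fun x => ?_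
      split_ifs with h
      · rfl
      · simp
    · intro x
      split_ifs with h
      · exact (hem2 x t).aemeasurable
      · simp
  simp_rw [h1]
  rw [lintegral_tsum]
  swap
  · intro x
    split_ifs with h
    · exact (hem3 x).aemeasurable
    · simp
  obtain ⟨s, hs, hF⟩ := sl_tsum_hom (slP K)
  rw [hF, ← ENNReal.tsum_mul_left]
  refine tsum_congr fun p => ?_
  have hmem : ∀ k : (slP K).ker, (((k : Kˣ) * s p : Kˣ) : K) ∈ slSet I ↔
      ((p : slI K) : FractionalIdeal (nonZeroDivisors (𝓞 K)) K) ≤ I := by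
    intro k
    rw [← slP_le, map_mul, MonoidHom.mem_ker.mp k.2, one_mul, hs]
  simp_rw [hmem]
  split_ifs with hp
  swap
  · simp
  rw [slP_ker (fun k => ∫⁻ t, ∫⁻ z in slDom K, e ((k * s p : Kˣ) : K) t z)]
  rw [← lintegral_tsum (fun u => (hem3 _).aemeasurable)]
  have h2 : ∀ (u : (𝓞 K)ˣ) t z, e ((Units.map (algebraMap (𝓞 K) K).toMonoidHom u * s p : Kˣ) : K) t z =
      e (s p) t (logEmbedding K (Additive.ofMul u) + z) := by
    intro u t z
    simp only [he]
    rw [← slq_unit]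
    rfl
  simp_rw [h2]
  have h3 : ∀ t, ∑' u : (𝓞 K)ˣ, ∫⁻ z in slDom K, e (s p) t (logEmbedding K (Additive.ofMul u) + z) =
      Nat.card (torsion K) * ∫⁻ z, e (s p) t z := fun t => sl_unfold (fun z => e (s p) t z)
  simp_rw [h3]
  rw [lintegral_const_mul _ ((hem (s p)).lintegral_prod_right'), sl_mellin_x _ (s p).ne_zero hσ, ← hs p, slP_norm]
  unfold slW
  ring

end

section

open NumberField NumberField.Units NumberField.Units.dirichletUnitTheorem MeasureTheory

def slLc {K : Type} [Field K] [NumberField K] (I : slI K) : ℝ :=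
  -(2 / Module.finrank ℚ K) * Real.log (slN I * Real.sqrt (slD K))

def slA {K : Type} [Field K] [NumberField K] (I : slI K) (u : ℝ) : ENNReal := slF I (u + slLc I)
def slA' {K : Type} [Field K] [NumberField K] (I : slI K) (u : ℝ) : ENNReal := slF' I (u + slLc I)

lemma sl_npos (K : Type) [Field K] [NumberField K] : (0:ℝ) < Module.finrank ℚ K := by
  exact_mod_cast Module.finrank_pos

lemma slLc_dual {K : Type} [Field K] [NumberField K] (I : slI K) : slLc (slDual I) = - slLc I := by
  unfold slLc
  have h1 := slN_pos I
  have h2 := slD_pos K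
  have h3 := Real.sqrt_pos.mpr h2
  have : slN (slDual I) * Real.sqrt (slD K) = (slN I * Real.sqrt (slD K))⁻¹ := by
    rw [slN_dual]
    have := Real.mul_self_sqrt h2.le
    field_simp
    nlinarith
  rw [this, Real.log_inv]; ring

lemma slA_FE {K : Type} [Field K] [NumberField K] (I : slI K) (u : ℝ) :
    slA I u = ENNReal.ofReal (Real.exp (-(Module.finrank ℚ K / 2 * u))) * slA (slDual I) (-u) := by
  unfold slA
  rw [slF_FE, slLc_dual, show -(u + slLc I) = -u + -slLc I by ring]
  congr 2
  have h1 := slN_pos I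
  have h2 := slD_pos K
  have h3 := Real.sqrt_pos.mpr h2
  have h4 := sl_npos K
  rw [Real.sqrt_mul h2.le, ← mul_assoc, Real.exp_neg]
  congr 1
  rw [Real.sqrt_eq_rpow (Real.exp _), ← Real.exp_mul]
  nth_rewrite 1 [← Real.exp_log (show 0 < slN I * Real.sqrt (slD K) by positivity)]
  rw [← Real.exp_add]
  congr 1
  unfold slLc
  field_simp
  ring

lemma slA_eq {K : Type} [Field K] [NumberField K] (I : slI K) (u : ℝ) :
    slA I u = slVol K + slA' I u := slF_eq _ _

lemma sl_mellin_A {K : Type} [Field K] [NumberField K] (I : slI K) {σ : ℝ} (hσ : 0 < σ) :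
    ∫⁻ u : ℝ, ENNReal.ofReal (Real.exp (Module.finrank ℚ K * σ / 2 * u)) * slA' I u =
    slW K * ENNReal.ofReal (slG K σ) * ENNReal.ofReal (slD K ^ (σ/2)) * ∑' P : (slP K).range,
      if (((P : slI K) * I⁻¹ : slI K) : FractionalIdeal (nonZeroDivisors (𝓞 K)) K) ≤ 1 then
        ENNReal.ofReal (slN ((P : slI K) * I⁻¹) ^ (-σ)) else 0 := by
  have h1 := slN_pos I
  have h2 := slD_pos K
  have h4 := sl_npos K
  have h3 := Real.sqrt_pos.mpr h2
  have e1 : ∀ u, ENNReal.ofReal (Real.exp (Module.finrank ℚ K * σ / 2 * u)) * slA' I u =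
      ENNReal.ofReal ((slN I * Real.sqrt (slD K)) ^ σ) * (fun t => ENNReal.ofReal (Real.exp (Module.finrank ℚ K * σ / 2 * t)) * slF' I t) (u + slLc I) := by
    intro u
    unfold slA'
    simp only
    rw [← mul_assoc, ← ENNReal.ofReal_mul (by positivity)]
    congr 2
    rw [Real.rpow_def_of_pos (by positivity), ← Real.exp_add]
    congr 1
    unfold slLc
    field_simp
    ring
  simp_rw [e1]
  rw [lintegral_const_mul' _ _ ENNReal.ofReal_ne_top,
    lintegral_add_right_eq_self (fun t => ENNReal.ofReal (Real.exp (Module.finrank ℚ K * σ / 2 * t)) * slF' I t),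
    sl_mellin_F I hσ, Real.mul_rpow h1.le h3.le, ENNReal.ofReal_mul (by positivity)]
  have e2 : Real.sqrt (slD K) ^ σ = slD K ^ (σ/2) := by
    rw [Real.sqrt_eq_rpow, ← Real.rpow_mul h2.le]; congr 1; ring
  rw [e2]
  have e3 : ∀ P : (slP K).range, ENNReal.ofReal (slN I ^ σ) * (if ((P : slI K) : FractionalIdeal (nonZeroDivisors (𝓞 K)) K) ≤ I then ENNReal.ofReal (slN (P : slI K) ^ (-σ)) else 0) =
      if (((P : slI K) * I⁻¹ : slI K) : FractionalIdeal (nonZeroDivisors (𝓞 K)) K) ≤ 1 then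
        ENNReal.ofReal (slN ((P : slI K) * I⁻¹) ^ (-σ)) else 0 := by
    intro P
    have h5 := slN_pos (P : slI K)
    have hiff : ((P : slI K) : FractionalIdeal (nonZeroDivisors (𝓞 K)) K) ≤ I ↔
        (((P : slI K) * I⁻¹ : slI K) : FractionalIdeal (nonZeroDivisors (𝓞 K)) K) ≤ 1 := by
      constructor
      · intro h
        have := mul_le_mul_left h ((I⁻¹ : slI K) : FractionalIdeal (nonZeroDivisors (𝓞 K)) K)
        rwa [← Units.val_mul, ← Units.val_mul, mul_inv_cancel, Units.val_one] at this
      · intro h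
        have := mul_le_mul_left h (I : FractionalIdeal (nonZeroDivisors (𝓞 K)) K)
        rwa [← Units.val_mul, inv_mul_cancel_right, one_mul] at this
    simp only [hiff]
    split_ifs
    · rw [← ENNReal.ofReal_mul (by positivity), slN_mul, slN_inv, Real.mul_rpow h5.le (by positivity),
        Real.inv_rpow h1.le, Real.rpow_neg h1.le, inv_inv, mul_comm]
    · simp
  simp_rw [← e3]
  rw [ENNReal.tsum_mul_left]
  ring

abbrev slQuo (K : Type) [Field K] [NumberField K] := slI K ⧸ (slP K).range

instance slQuo_fin (K : Type) [Field K] [NumberField K] : Finite (slQuo K) :=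
  Finite.of_equiv _ (ClassGroup.equiv (R := 𝓞 K) K).toEquiv

instance slQuo_fintype (K : Type) [Field K] [NumberField K] : Fintype (slQuo K) := Fintype.ofFinite _

lemma sl_class_sum {K : Type} [Field K] [NumberField K] (s : slQuo K → slI K)
    (hs : Function.Bijective (fun C => ((s C : slI K) : slQuo K))) (F : slI K → ENNReal) :
    ∑ C : slQuo K, ∑' P : (slP K).range, F (P * (s C)⁻¹) = ∑' J, F J := by
  rw [← tsum_fintype (L := SummationFilter.unconditional _), ← ENNReal.tsum_prod (f := fun (C : slQuo K) (P : (slP K).range) => F (P * (s C)⁻¹))]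
  let g : slQuo K × (slP K).range → slI K := fun q => q.2 * (s q.1)⁻¹
  have hmk : ∀ q, ((g q : slI K) : slQuo K) = ((s q.1 : slI K) : slQuo K)⁻¹ := by
    rintro ⟨C, P⟩
    simp only [g]
    rw [QuotientGroup.mk_mul, QuotientGroup.mk_inv, (QuotientGroup.eq_one_iff _).mpr P.2, one_mul]
  have hg : Function.Bijective g := by
    constructor
    · rintro ⟨C, P⟩ ⟨C', P'⟩ h
      have h1 := (hmk (C, P)).symm.trans ((congrArg (fun x : slI K => (x : slQuo K)) h).trans (hmk (C', P')))
      have h2 := hs.1 (inv_injective h1)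
      simp only at h2
      subst h2
      simp only [g, mul_left_inj] at h
      exact Prod.ext rfl (Subtype.ext h)
    · intro J
      obtain ⟨C, hC⟩ := hs.2 ((J : slQuo K)⁻¹)
      refine ⟨(C, ⟨J * s C, ?_⟩), ?_⟩
      · rw [← QuotientGroup.eq_one_iff, QuotientGroup.mk_mul]
        simp only at hC
        rw [hC, mul_inv_cancel]
      · simp [g]
  exact (Equiv.ofBijective g hg).tsum_eq F

def slRep {K : Type} [Field K] [NumberField K] (C : slQuo K) : slI K := Quotient.out C

lemma slRep_mk {K : Type} [Field K] [NumberField K] (C : slQuo K) : ((slRep C : slI K) : slQuo K) = C :=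
  QuotientGroup.out_eq' C

lemma slRep_bij (K : Type) [Field K] [NumberField K] :
    Function.Bijective (fun C : slQuo K => ((slRep C : slI K) : slQuo K)) := by
  simp_rw [slRep_mk]; exact Function.bijective_id

lemma slRep_dual_bij (K : Type) [Field K] [NumberField K] :
    Function.Bijective (fun C : slQuo K => ((slDual (slRep C) : slI K) : slQuo K)) := by
  simp_rw [slDual_eq, QuotientGroup.mk_mul, QuotientGroup.mk_inv, slRep_mk]
  exact (Group.mulLeft_bijective _).comp (Equiv.inv (slQuo K)).bijective

lemma sl_ideal_sum {K : Type} [Field K] [NumberField K] (σ : ℝ) :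
    (∑' J : slI K, if (J : FractionalIdeal (nonZeroDivisors (𝓞 K)) K) ≤ 1 then ENNReal.ofReal (slN J ^ (-σ)) else 0) =
    ∑' I : {I : Ideal (𝓞 K) // I ≠ ⊥}, ENNReal.ofReal ((Ideal.absNorm (I : Ideal (𝓞 K)) : ℝ) ^ (-σ)) := by
  set F : slI K → ENNReal := fun J => if (J : FractionalIdeal (nonZeroDivisors (𝓞 K)) K) ≤ 1 then ENNReal.ofReal (slN J ^ (-σ)) else 0 with hF
  let g : {I : Ideal (𝓞 K) // I ≠ ⊥} → slI K := fun I => Units.mk0 (I.1 : FractionalIdeal (nonZeroDivisors (𝓞 K)) K)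
    (FractionalIdeal.coeIdeal_ne_zero.mpr I.2)
  have hinj : Function.Injective g := by
    intro I J h
    have := congrArg (fun x : slI K => (x : FractionalIdeal (nonZeroDivisors (𝓞 K)) K)) h
    exact Subtype.ext (FractionalIdeal.coeIdeal_injective this)
  have hsup : Function.support F ⊆ Set.range g := by
    intro J hJ
    have h1 : (J : FractionalIdeal (nonZeroDivisors (𝓞 K)) K) ≤ 1 := by
      by_contra h
      exact hJ (by simp only [hF]; rw [if_neg h])
    obtain ⟨I, hI⟩ := FractionalIdeal.le_one_iff_exists_coeIdeal.mp h1
    refine ⟨⟨I, ?_⟩, Units.ext hI⟩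
    rintro rfl
    exact J.ne_zero (by rw [← hI]; simp)
  rw [← hinj.tsum_eq hsup]
  refine tsum_congr fun I => ?_
  simp only [hF]
  rw [if_pos (show ((g I : slI K) : FractionalIdeal (nonZeroDivisors (𝓞 K)) K) ≤ 1 from FractionalIdeal.coeIdeal_le_one)]
  unfold slN
  simp only [g, Units.val_mk0]
  rw [FractionalIdeal.coeIdeal_absNorm]
  simp

lemma sl_mellin_total {K : Type} [Field K] [NumberField K] (s : slQuo K → slI K)
    (hs : Function.Bijective (fun C => ((s C : slI K) : slQuo K))) {σ : ℝ} (hσ : 0 < σ) :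
    ∑ C, ∫⁻ u : ℝ, ENNReal.ofReal (Real.exp (Module.finrank ℚ K * σ / 2 * u)) * slA' (s C) u =
    slW K * ENNReal.ofReal (slG K σ) * ENNReal.ofReal (slD K ^ (σ/2)) *
      ∑' I : {I : Ideal (𝓞 K) // I ≠ ⊥}, ENNReal.ofReal ((Ideal.absNorm (I : Ideal (𝓞 K)) : ℝ) ^ (-σ)) := by
  simp_rw [sl_mellin_A _ hσ]
  rw [← Finset.mul_sum, ← sl_ideal_sum, sl_class_sum s hs (fun J => if (J : FractionalIdeal (nonZeroDivisors (𝓞 K)) K) ≤ 1 then ENNReal.ofReal (slN J ^ (-σ)) else 0)]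

end

section

open NumberField NumberField.Units NumberField.Units.dirichletUnitTheorem MeasureTheory

lemma slA_ne_top {K : Type} [Field K] [NumberField K] (I : slI K) (u : ℝ) : slA I u ≠ ⊤ := slF_ne_top _ _
lemma slA'_ne_top {K : Type} [Field K] [NumberField K] (I : slI K) (u : ℝ) : slA' I u ≠ ⊤ := by
  have := slA_ne_top I u
  rw [slA_eq] at this
  exact fun h => this (by rw [h]; simp)

lemma slA'_meas {K : Type} [Field K] [NumberField K] (I : slI K) : Measurable (slA' I) := by
  have h : Measurable (slF' I) := (slThetaY_meas (slSet I \ {0})).lintegral_prod_right'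
  exact h.comp (measurable_id.add_const _)

def slf {K : Type} [Field K] [NumberField K] (s : slQuo K → slI K) (τ : ℝ) : ℝ :=
  ∑ C, (slA (s C) (Real.log τ)).toReal
def slf' {K : Type} [Field K] [NumberField K] (s : slQuo K → slI K) (τ : ℝ) : ℝ :=
  ∑ C, (slA' (s C) (Real.log τ)).toReal
def slf0 (K : Type) [Field K] [NumberField K] : ℝ := ∑ _C : slQuo K, (slVol K).toReal

lemma slf_eq {K : Type} [Field K] [NumberField K] (s : slQuo K → slI K) (τ : ℝ) :
    slf s τ - slf0 K = slf' s τ := by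
  unfold slf slf' slf0
  rw [← Finset.sum_sub_distrib]
  refine Finset.sum_congr rfl fun C _ => ?_
  rw [slA_eq, ENNReal.toReal_add (slVol_ne_top K) (slA'_ne_top _ _)]; ring

lemma slf'_nonneg {K : Type} [Field K] [NumberField K] (s : slQuo K → slI K) (τ : ℝ) : 0 ≤ slf' s τ :=
  Finset.sum_nonneg fun _ _ => ENNReal.toReal_nonneg

lemma slf_int {K : Type} [Field K] [NumberField K] (s : slQuo K → slI K) :
    LocallyIntegrableOn (fun τ => (slf s τ : ℂ)) (Set.Ioi 0) := by
  rw [locallyIntegrableOn_iff isOpen_Ioi.isLocallyClosed]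
  intro k hk hkc
  have : AntitoneOn (slf s) k := by
    intro a ha b hb hab
    unfold slf
    refine Finset.sum_le_sum fun C _ => ENNReal.toReal_mono (slA_ne_top _ _) ?_
    refine slF_anti _ ?_
    have := Real.log_le_log (hk ha) hab
    linarith
  exact (this.integrableOn_isCompact hkc).ofReal

lemma slf_top {K : Type} [Field K] [NumberField K] (s : slQuo K → slI K) (r : ℝ) :
    (fun τ => (slf s τ : ℂ) - (slf0 K : ℂ)) =O[Filter.atTop] (fun x : ℝ => x ^ r) := by
  have h1 : (fun τ => (slf s τ : ℂ) - (slf0 K : ℂ)) = fun τ => ((slf' s τ : ℝ) : ℂ) := by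
    ext τ; rw [← slf_eq]; simp
  rw [h1, Complex.isBigO_ofReal_left]
  have h2 : slf' s = fun τ => ∑ C, (slA' (s C) (Real.log τ)).toReal := rfl
  rw [h2]
  refine Asymptotics.IsBigO.fun_sum (s := Finset.univ) (A := fun C τ => (slA' (s C) (Real.log τ)).toReal) (fun C _ => ?_)
  obtain ⟨a, D, ha, h⟩ := slF'_decay (s C)
  have hb : 0 < a * Real.exp (slLc (s C)) := mul_pos ha (Real.exp_pos _)
  refine Asymptotics.IsBigO.trans ?_ (isLittleO_exp_neg_mul_rpow_atTop hb r).isBigO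
  refine Asymptotics.IsBigO.of_bound |D| ?_
  filter_upwards [Filter.eventually_ge_atTop (Real.exp (-slLc (s C)))] with τ hτ
  have hτ0 : 0 < τ := lt_of_lt_of_le (Real.exp_pos _) hτ
  have h3 : 0 ≤ Real.log τ + slLc (s C) := by
    have := Real.log_le_log (Real.exp_pos _) hτ
    rw [Real.log_exp] at this; linarith
  have h4 := h _ h3
  rw [Real.exp_add, Real.exp_log hτ0] at h4
  rw [Real.norm_of_nonneg ENNReal.toReal_nonneg, Real.norm_of_nonneg (Real.exp_pos _).le]
  refine ENNReal.toReal_le_of_le_ofReal (by positivity) (h4.trans (ENNReal.ofReal_le_ofReal ?_))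
  rw [show -a * (τ * Real.exp (slLc (s C))) = -(a * Real.exp (slLc (s C))) * τ by ring]
  exact mul_le_mul_of_nonneg_right (le_abs_self D) (Real.exp_pos _).le

lemma slf_FE {K : Type} [Field K] [NumberField K] (s : slQuo K → slI K) (x : ℝ) (hx : 0 < x) :
    slf s (1 / x) = x ^ ((Module.finrank ℚ K : ℝ) / 2) * slf (fun C => slDual (s C)) x := by
  unfold slf
  rw [Finset.mul_sum]
  refine Finset.sum_congr rfl fun C _ => ?_
  rw [slA_FE, ENNReal.toReal_mul, ENNReal.toReal_ofReal (Real.exp_pos _).le, one_div, Real.log_inv, neg_neg]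
  congr 1
  rw [Real.rpow_def_of_pos hx]
  congr 1; ring

def slPair (K : Type) [Field K] [NumberField K] : WeakFEPair ℂ where
  f := fun τ => (slf slRep τ : ℂ)
  g := fun τ => (slf (fun C => slDual (slRep (K := K) C)) τ : ℂ)
  k := (Module.finrank ℚ K : ℝ) / 2
  ε := 1
  f₀ := slf0 K
  g₀ := slf0 K
  hf_int := slf_int _
  hg_int := slf_int _
  hk := by have := sl_npos K; positivity
  hε := one_ne_zero
  h_feq := fun x hx => by rw [slf_FE _ x hx]; simp
  hf_top := slf_top _
  hg_top := slf_top _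

def slZ (K : Type) [Field K] [NumberField K] (σ : ℝ) : ENNReal :=
  ∑' I : {I : Ideal (𝓞 K) // I ≠ ⊥}, ENNReal.ofReal ((Ideal.absNorm (I : Ideal (𝓞 K)) : ℝ) ^ (-σ))

lemma slG_pos (K : Type) [Field K] [NumberField K] {σ : ℝ} (hσ : 0 < σ) : 0 < slG K σ := by
  unfold slG
  refine Finset.prod_pos fun w _ => mul_pos ?_ (Real.Gamma_pos_of_pos ?_)
  · have := sl_mult_pos w
    have := Real.pi_pos
    positivity
  · have := sl_mult_pos w
    positivity

lemma sl_mellin_val {K : Type} [Field K] [NumberField K] (s : slQuo K → slI K)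
    (hs : Function.Bijective (fun C => ((s C : slI K) : slQuo K))) (P : WeakFEPair ℂ)
    (hf : P.f = fun τ => (slf s τ : ℂ)) (hf0 : P.f₀ = slf0 K) (hk : P.k = (Module.finrank ℚ K : ℝ) / 2)
    {σ : ℝ} (hσ : 1 < σ) :
    slZ K σ ≠ ⊤ ∧ P.Λ (Module.finrank ℚ K * σ / 2 : ℝ) =
      (((slW K).toReal * slG K σ * slD K ^ (σ/2) * (slZ K σ).toReal : ℝ) : ℂ) := by
  have hn := sl_npos K
  set a : ℝ := Module.finrank ℚ K * σ / 2 with ha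
  have hm := P.hasMellin (s := (a : ℂ)) (by rw [hk, Complex.ofReal_re, ha]; nlinarith)
  obtain ⟨hm1, hm2⟩ := hm
  have hcongr : Set.EqOn (fun t : ℝ => (t : ℂ) ^ ((a : ℂ) - 1) • (P.f t - P.f₀))
      (fun t : ℝ => ((t ^ (a - 1) * slf' s t : ℝ) : ℂ)) (Set.Ioi 0) := by
    intro t ht
    have ht' : (0:ℝ) ≤ t := le_of_lt ht
    simp only [hf, hf0]
    rw [← Complex.ofReal_sub, slf_eq, smul_eq_mul, Complex.ofReal_mul, Complex.ofReal_cpow ht']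
    simp
  have hi : IntegrableOn (fun t : ℝ => t ^ (a - 1) * slf' s t) (Set.Ioi 0) := by
    have h1 := (integrableOn_congr_fun hcongr measurableSet_Ioi).mp hm1
    have h2 := h1.re
    unfold IntegrableOn
    simpa using h2
  have hΛ : P.Λ (a : ℂ) = ((∫ t in Set.Ioi 0, t ^ (a - 1) * slf' s t : ℝ) : ℂ) := by
    rw [← hm2, mellin, setIntegral_congr_fun measurableSet_Ioi hcongr]
    exact integral_ofReal
  have hnn : 0 ≤ᵐ[volume.restrict (Set.Ioi 0)] (fun t : ℝ => t ^ (a - 1) * slf' s t) := by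
    refine (ae_restrict_iff' measurableSet_Ioi).mpr (Filter.Eventually.of_forall fun t ht => ?_)
    exact mul_nonneg (Real.rpow_nonneg (le_of_lt ht) _) (slf'_nonneg _ _)
  have hint : ∫⁻ t in Set.Ioi 0, ENNReal.ofReal (t ^ (a - 1) * slf' s t) =
      slW K * ENNReal.ofReal (slG K σ) * ENNReal.ofReal (slD K ^ (σ/2)) * slZ K σ := by
    have him : Real.exp '' Set.univ = Set.Ioi 0 := by
      rw [Set.image_univ, Real.range_exp]
    have hder : ∀ x ∈ (Set.univ : Set ℝ), HasDerivWithinAt Real.exp (Real.exp x) Set.univ x :=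
      fun x _ => (Real.hasDerivAt_exp x).hasDerivWithinAt
    have h1 := lintegral_image_eq_lintegral_abs_deriv_mul MeasurableSet.univ hder Real.exp_injective.injOn
      (fun t : ℝ => ENNReal.ofReal (t ^ (a - 1) * slf' s t))
    rw [him] at h1
    rw [h1, Measure.restrict_univ, slZ, ← sl_mellin_total s hs (by linarith : 0 < σ),
      ← lintegral_finsetSum _ (fun C _ => by
        have := slA'_meas (s C)
        fun_prop)]
    refine lintegral_congr fun u => ?_
    rw [abs_of_pos (Real.exp_pos _), ← ENNReal.ofReal_mul (Real.exp_pos _).le, ← mul_assoc,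
      ENNReal.ofReal_mul (by positivity), ← Finset.mul_sum]
    congr 1
    · congr 1
      rw [← Real.exp_mul, ← Real.exp_add]
      congr 1; ring
    · unfold slf'
      rw [Real.log_exp, ENNReal.ofReal_sum_of_nonneg (fun _ _ => ENNReal.toReal_nonneg)]
      exact Finset.sum_congr rfl fun C _ => ENNReal.ofReal_toReal (slA'_ne_top _ _)
  have hG := slG_pos K (by linarith : 0 < σ)
  have hD := slD_pos K
  have hfin : slW K * ENNReal.ofReal (slG K σ) * ENNReal.ofReal (slD K ^ (σ/2)) * slZ K σ ≠ ⊤ := by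
    rw [← hint]
    exact ((hasFiniteIntegral_iff_ofReal hnn).mp hi.2).ne
  constructor
  · intro h
    rw [h] at hfin
    apply hfin
    apply ENNReal.mul_top
    have h1 := (slW_pos K).ne'
    have h2 : ENNReal.ofReal (slG K σ) ≠ 0 := by simpa using hG
    have h3 : ENNReal.ofReal (slD K ^ (σ/2)) ≠ 0 := by
      have : 0 < slD K ^ (σ/2) := by positivity
      simpa using this
    exact mul_ne_zero (mul_ne_zero h1 h2) h3
  · rw [hΛ, integral_eq_lintegral_of_nonneg_ae hnn hi.1, hint]
    congr 1
    rw [ENNReal.toReal_mul, ENNReal.toReal_mul, ENNReal.toReal_mul, ENNReal.toReal_ofReal hG.le,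
      ENNReal.toReal_ofReal (by positivity)]

lemma sl_analytic_eq {f g : ℂ → ℂ} (hf : Differentiable ℂ f) (hg : Differentiable ℂ g) (b : ℝ)
    (h : ∀ x : ℝ, b < x → f x = g x) : f = g := by
  have h1 : AnalyticOnNhd ℂ f Set.univ := fun z _ => hf.analyticAt z
  have h2 : AnalyticOnNhd ℂ g Set.univ := fun z _ => hg.analyticAt z
  refine h1.eq_of_frequently_eq (z₀ := ((b + 1 : ℝ) : ℂ)) h2 ?_
  have hne : (nhdsWithin (b+1) {b+1}ᶜ).NeBot := inferInstance
  have ht : Filter.Tendsto (fun x : ℝ => (x : ℂ)) (nhdsWithin (b+1) {b+1}ᶜ) (nhdsWithin ((b+1 : ℝ) : ℂ) {((b+1 : ℝ) : ℂ)}ᶜ) := by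
    refine tendsto_nhdsWithin_iff.mpr ⟨(Complex.continuous_ofReal.tendsto _).mono_left nhdsWithin_le_nhds, ?_⟩
    filter_upwards [self_mem_nhdsWithin] with x hx
    exact fun h => hx (Complex.ofReal_injective h)
  refine ht.frequently (Filter.Eventually.frequently ?_)
  have : ∀ᶠ x in nhds (b+1), b < x := eventually_gt_nhds (by linarith)
  filter_upwards [nhdsWithin_le_nhds this] with x hx
  exact h x hx

lemma slPair_symm (K : Type) [Field K] [NumberField K] : (slPair K).symm.Λ₀ = (slPair K).Λ₀ := by
  have hn := sl_npos K
  refine sl_analytic_eq (slPair K).symm.differentiable_Λ₀ (slPair K).differentiable_Λ₀ ((Module.finrank ℚ K : ℝ)/2) ?_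
  intro x hx
  obtain ⟨σ, hσ, rfl⟩ : ∃ σ : ℝ, 1 < σ ∧ Module.finrank ℚ K * σ / 2 = x := by
    refine ⟨2 * x / Module.finrank ℚ K, ?_, by field_simp⟩
    rw [lt_div_iff₀ hn]; linarith
  rw [WeakFEPair.Λ₀_eq, WeakFEPair.Λ₀_eq,
    (sl_mellin_val _ (slRep_bij K) (slPair K) rfl rfl rfl hσ).2,
    (sl_mellin_val _ (slRep_dual_bij K) (slPair K).symm rfl rfl rfl hσ).2]
  simp [slPair]

lemma sl_mellin_bound (P : WeakFEPair ℂ) (a b : ℝ) :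
    ∃ C : ℝ, 0 ≤ C ∧ ∀ s : ℂ, a ≤ s.re → s.re ≤ b → ‖P.Λ₀ s‖ ≤ C := by
  have hP := P.isStrongFEPair_toStrongFEPair
  have hconv : ∀ s : ℂ, MellinConvergent P.f_modif s := fun s => (hP.hasMellin s).1
  have hc : ∀ x : ℝ, IntegrableOn (fun t : ℝ => t ^ (x - 1) * ‖P.f_modif t‖) (Set.Ioi 0) := by
    intro x
    have := (hconv (x : ℂ)).norm
    refine (integrableOn_congr_fun ?_ measurableSet_Ioi).mp this
    intro t ht
    simp only [norm_smul]
    rw [Complex.norm_cpow_eq_rpow_re_of_pos ht]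
    simp
  refine ⟨(∫ t in Set.Ioi (0:ℝ), t ^ (a - 1) * ‖P.f_modif t‖) + ∫ t in Set.Ioi (0:ℝ), t ^ (b - 1) * ‖P.f_modif t‖, ?_, ?_⟩
  · have : ∀ x : ℝ, 0 ≤ ∫ t in Set.Ioi (0:ℝ), t ^ (x - 1) * ‖P.f_modif t‖ := fun x =>
      setIntegral_nonneg measurableSet_Ioi fun t ht => mul_nonneg (Real.rpow_nonneg (le_of_lt ht) _) (norm_nonneg _)
    exact add_nonneg (this a) (this b)
  · intro s h1 h2
    rw [← integral_add (hc a) (hc b)]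
    refine (norm_integral_le_integral_norm _).trans ?_
    refine setIntegral_mono_on (hconv s).norm ((hc a).add (hc b)) measurableSet_Ioi fun t ht => ?_
    have ht' : 0 < t := ht
    rw [norm_smul, Complex.norm_cpow_eq_rpow_re_of_pos ht, ← add_mul]
    refine mul_le_mul_of_nonneg_right ?_ (norm_nonneg _)
    have p1 := Real.rpow_nonneg ht'.le (a - 1)
    have p2 := Real.rpow_nonneg ht'.le (b - 1)
    simp only [Complex.sub_re, Complex.one_re]
    rcases le_total 1 t with h | h
    · have := Real.rpow_le_rpow_of_exponent_le h (show s.re - 1 ≤ b - 1 by linarith)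
      linarith
    · have := Real.rpow_le_rpow_of_exponent_ge ht' h (show a - 1 ≤ s.re - 1 by linarith)
      linarith

theorem sl_xi (K : Type) [Field K] [NumberField K] : ∃ ξ : ℂ → ℂ, Differentiable ℂ ξ ∧ (∀ s, ξ (1 - s) = ξ s) ∧
    (∀ a b : ℝ, ∃ C : ℝ, 0 ≤ C ∧ ∀ s : ℂ, a ≤ s.re → s.re ≤ b → ‖ξ s‖ ≤ C * (1 + ‖s‖)^2) ∧
    ∃ c : ℝ, 0 < c ∧ ∀ σ : ℝ, 1 < σ → slZ K σ ≠ ⊤ ∧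
      ξ σ = ((c * (σ * (σ - 1)) * slD K ^ (σ/2) * slG K σ * (slZ K σ).toReal : ℝ) : ℂ) := by
  have hn := sl_npos K
  set P := slPair K with hP
  set n : ℝ := (Module.finrank ℚ K : ℝ) with hnn
  set ξ : ℂ → ℂ := fun s => s * (s - 1) * P.Λ₀ (n / 2 * s) + 2 / n * slf0 K with hξ
  have hFE : ∀ s, ξ (1 - s) = ξ s := by
    intro s
    have h1 := P.functional_equation₀ (n/2 * s)
    rw [slPair_symm K] at h1
    have h2 : (P.k : ℂ) - n/2 * s = n / 2 * (1 - s) := by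
      rw [show P.k = n/2 from rfl]; push_cast; ring
    rw [h2, show P.ε = 1 from rfl, one_smul] at h1
    simp only [hξ]
    rw [h1]; ring
  refine ⟨ξ, ?_, hFE, ?_, (slW K).toReal, ENNReal.toReal_pos (slW_pos K).ne' (slW_ne_top K), ?_⟩
  · have := P.differentiable_Λ₀
    simp only [hξ]
    fun_prop
  · intro a b
    obtain ⟨C, hC0, hC⟩ := sl_mellin_bound P (n/2 * a) (n/2 * b)
    refine ⟨C + ‖(2 / n * slf0 K : ℂ)‖, by positivity, fun s h1 h2 => ?_⟩
    have h3 := hC (n/2 * s) (by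
      rw [show (n / 2 * s : ℂ) = ((n/2 : ℝ) : ℂ) * s by push_cast; ring, Complex.re_ofReal_mul]; gcongr) (by
      rw [show (n / 2 * s : ℂ) = ((n/2 : ℝ) : ℂ) * s by push_cast; ring, Complex.re_ofReal_mul]; gcongr)
    simp only [hξ]
    have h4 : ‖s * (s - 1)‖ ≤ (1 + ‖s‖)^2 := by
      rw [norm_mul]
      have := norm_sub_le s 1
      rw [norm_one] at this
      nlinarith [norm_nonneg s, norm_nonneg (s-1)]
    have h5 : 1 ≤ (1 + ‖s‖)^2 := by nlinarith [norm_nonneg s]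
    calc _ ≤ ‖s * (s - 1) * P.Λ₀ (n/2 * s)‖ + ‖(2 / n * slf0 K : ℂ)‖ := norm_add_le _ _
      _ ≤ (1 + ‖s‖)^2 * C + ‖(2 / n * slf0 K : ℂ)‖ * (1 + ‖s‖)^2 := by
        rw [norm_mul]
        gcongr
        exact le_mul_of_one_le_right (norm_nonneg _) h5
      _ = _ := by ring
  · intro σ hσ
    obtain ⟨h1, h2⟩ := sl_mellin_val _ (slRep_bij K) P rfl rfl rfl hσ
    refine ⟨h1, ?_⟩
    have h3 : (n / 2 * (σ : ℂ)) = ((Module.finrank ℚ K * σ / 2 : ℝ) : ℂ) := by push_cast [hnn]; ring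
    simp only [hξ]
    rw [h3, WeakFEPair.Λ₀_eq, h2]
    rw [show P.f₀ = slf0 K from rfl, show P.g₀ = slf0 K from rfl, show P.ε = 1 from rfl, show P.k = n/2 from rfl, ← hnn]
    have hσ0 : (σ : ℂ) ≠ 0 := by exact_mod_cast (by linarith : σ ≠ 0)
    have hσ1 : (σ : ℂ) - 1 ≠ 0 := by
      have : σ - 1 ≠ 0 := by linarith
      exact_mod_cast this
    have hσ2 : (1 : ℂ) - σ ≠ 0 := by rw [← neg_sub]; exact neg_ne_zero.mpr hσ1
    have hn0 : (n : ℂ) ≠ 0 := by exact_mod_cast hn.ne'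
    have e1 : (((n / 2 : ℝ) : ℂ) - ((n * σ / 2 : ℝ) : ℂ)) = n / 2 * (1 - σ) := by push_cast; ring
    rw [e1]
    simp only [smul_eq_mul]
    push_cast
    generalize ((slD K : ℂ) ^ ((σ : ℂ)/2)) = X
    field_simp
    ring

end

section
open NumberField

section EulerGen
variable {M : Type*} [CommMonoidWithZero M] [UniqueFactorizationMonoid M] [Subsingleton Mˣ]

def slEu {𝕜 : Type*} [NormedField 𝕜] (f : M →*₀ 𝕜) (S : Finset M) : 𝕜 :=
  ∑' I, if (∀ p ∈ S, ¬ p ∣ I) then f I else 0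

theorem slEu_summable {𝕜 : Type*} [NormedField 𝕜] [CompleteSpace 𝕜] (f : M →*₀ 𝕜) (hf : Summable (fun I => ‖f I‖))
    (q : M → Prop) [DecidablePred q] : Summable (fun I => if q I then f I else 0) := by
  refine Summable.of_norm_bounded hf (fun I => ?_)
  split_ifs
  · exact le_rfl
  · simp

theorem slEu_insert {𝕜 : Type*} [NormedField 𝕜] [CompleteSpace 𝕜] (f : M →*₀ 𝕜) (hf : Summable (fun I => ‖f I‖))
    (S : Finset M) (hS : ∀ q ∈ S, Prime q) (p : M) (hp : Prime p) (hpS : p ∉ S) :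
    slEu f (insert p S) = (1 - f p) * slEu f S := by
  have h1 : f p * slEu f S = ∑' I, if (p ∣ I ∧ ∀ q ∈ S, ¬ q ∣ I) then f I else 0 := by
    have hinj : Function.Injective (fun J : M => p * J) := fun a b h => mul_left_cancel₀ hp.ne_zero h
    rw [← hinj.tsum_eq]
    · unfold slEu
      rw [← tsum_mul_left]
      refine tsum_congr (fun J => ?_)
      have : (∀ q ∈ S, ¬ q ∣ p * J) ↔ (∀ q ∈ S, ¬ q ∣ J) := by
        refine forall₂_congr (fun q hq => not_congr ⟨fun h => ?_, fun h => h.mul_left p⟩)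
        rcases (hS q hq).dvd_or_dvd h with h | h
        · exfalso
          have := (hS q hq).associated_of_dvd hp h
          rw [associated_iff_eq] at this
          exact hpS (this ▸ hq)
        · exact h
      simp only [this, dvd_mul_right, true_and, map_mul]
      split_ifs <;> simp
    · intro I hI
      rw [Function.mem_support] at hI
      split_ifs at hI with h
      · obtain ⟨J, rfl⟩ := h.1
        exact ⟨J, rfl⟩
      · exact absurd rfl hI
  rw [sub_mul, one_mul, h1]
  unfold slEu
  rw [← Summable.tsum_sub (slEu_summable f hf _) (slEu_summable f hf _)]
  refine tsum_congr (fun I => ?_)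
  by_cases hpI : p ∣ I <;> by_cases hq : ∀ q ∈ S, ¬ q ∣ I <;> simp [hpI, hq]

theorem slEu_bound (f : M →*₀ ℂ) (g : M →*₀ ℝ) (hfg : ∀ I, ‖f I‖ = g I) (hg : Summable g)
    (hg1 : ∀ I, g I ≤ 1) (S : Finset M) (hS : ∀ q ∈ S, Prime q) :
    ‖slEu f S‖ * slEu g S ≤ ‖∑' I, f I‖ * ∑' I, g I := by
  have hg0 : ∀ I, 0 ≤ g I := fun I => by rw [← hfg]; exact norm_nonneg _
  have hfs : Summable (fun I => ‖f I‖) := by simpa [hfg] using hg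
  have hgs : Summable (fun I => ‖g I‖) := by simpa [abs_of_nonneg (hg0 _)] using hg
  induction S using Finset.induction_on with
  | empty => simp [slEu]
  | insert p S hp ih =>
    have hpp := hS p (Finset.mem_insert_self _ _)
    have hS' : ∀ q ∈ S, Prime q := fun q hq => hS q (Finset.mem_insert_of_mem hq)
    rw [slEu_insert f hfs S hS' p hpp hp, slEu_insert g hgs S hS' p hpp hp]
    refine le_trans ?_ (ih hS')
    have hP : 0 ≤ slEu g S := tsum_nonneg (fun I => by split_ifs <;> simp [hg0])
    have h1 : ‖1 - f p‖ ≤ 1 + g p := by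
      rw [← hfg]; simpa using norm_sub_le (1:ℂ) (f p)
    rw [norm_mul]
    have h2 : ‖1 - f p‖ * (1 - g p) ≤ 1 := by
      have := hg1 p
      have := hg0 p
      nlinarith
    have h3 : 0 ≤ ‖slEu f S‖ * slEu g S := by positivity
    calc _ = (‖1 - f p‖ * (1 - g p)) * (‖slEu f S‖ * slEu g S) := by ring
      _ ≤ 1 * (‖slEu f S‖ * slEu g S) := by gcongr
      _ = _ := one_mul _

set_option maxHeartbeats 1000000 in
theorem sl_euler_lower (f : M →*₀ ℂ) (g : M →*₀ ℝ) (hfg : ∀ I, ‖f I‖ = g I) (hg : Summable g)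
    (hg1 : ∀ I, g I ≤ 1) : 1 ≤ ‖∑' I, f I‖ * ∑' I, g I := by
  have hg0 : ∀ I, 0 ≤ g I := fun I => by rw [← hfg]; exact norm_nonneg _
  have hfs : Summable (fun I => ‖f I‖) := by simpa [hfg] using hg
  have hgs : Summable (fun I => ‖g I‖) := by simpa [abs_of_nonneg (hg0 _)] using hg
  have hone : ∀ S : Finset M, (∀ q ∈ S, Prime q) → ∀ p ∈ S, ¬ p ∣ 1 := by
    intro S hS p hp h
    exact (hS p hp).not_isUnit (isUnit_of_dvd_one h)
  refine le_of_forall_pos_le_add (fun ε hε => ?_)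
  obtain ⟨T, hT⟩ := (summable_iff_vanishing_norm.mp hg) ε hε
  -- primes
  let S : Finset M := T.biUnion (fun I => if h : I ≠ 0 then (UniqueFactorizationMonoid.factors I).toFinset else ∅)
  have hS : ∀ q ∈ S, Prime q := by
    intro q hq
    simp only [S, Finset.mem_biUnion] at hq
    obtain ⟨I, _, hI⟩ := hq
    split_ifs at hI with h
    · exact UniqueFactorizationMonoid.prime_of_factor q (Multiset.mem_toFinset.mp hI)
    · simp at hI
  have hST : ∀ I ∈ T, I ≠ 0 → I ≠ 1 → ∃ p ∈ S, p ∣ I := by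
    intro I hI h0 h1
    have hu : ¬ IsUnit I := by rwa [isUnit_iff_eq_one]
    obtain ⟨p, hp⟩ := UniqueFactorizationMonoid.exists_mem_factors h0 hu
    exact ⟨p, Finset.mem_biUnion.mpr ⟨I, hI, by rw [dif_pos h0]; exact Multiset.mem_toFinset.mpr hp⟩, UniqueFactorizationMonoid.dvd_of_mem_factors hp⟩
  have hb := slEu_bound f g hfg hg hg1 S hS
  let gq : M → ℝ := fun I => if (∀ p ∈ S, ¬ p ∣ I) then g I else 0
  have hq0 : ∀ I, 0 ≤ gq I := fun I => by simp only [gq]; split_ifs <;> simp [hg0]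
  have hqs : Summable gq := slEu_summable g hgs _
  have hq1 : gq 1 = 1 := by simp only [gq]; rw [if_pos (hone S hS)]; simp
  have hQ1 : 1 ≤ slEu g S := by
    rw [← hq1]; exact hqs.le_tsum 1 (fun j _ => hq0 j)
  have hQ2 : slEu g S ≤ 1 + ε := by
    refine hqs.tsum_le_of_sum_le (fun s => ?_)
    have : ∑ I ∈ s, gq I ≤ 1 + ∑ I ∈ s \ T, g I := by
      have hh : ∀ I ∈ s, gq I ≤ (if I = 1 then 1 else 0) + (if I ∈ s \ T then g I else 0) := by
        intro I hI
        by_cases h1 : I = 1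
        · subst h1; rw [hq1, if_pos rfl]; split_ifs <;> simp
        · by_cases hIT : I ∈ T
          · by_cases h0 : I = 0
            · have : gq I = 0 := by simp only [gq]; rw [h0, map_zero]; split_ifs <;> rfl
              rw [this, if_neg h1]; split_ifs <;> simp [hg0]
            · obtain ⟨p, hp, hpI⟩ := hST I hIT h0 h1
              have : gq I = 0 := by simp only [gq]; rw [if_neg]; push Not; exact ⟨p, hp, hpI⟩
              rw [this]; simp [h1, hIT]
          · have hle : gq I ≤ g I := by
              simp only [gq]
              split_ifs
              exacts [le_rfl, hg0 _]
            rw [if_neg h1, if_pos (Finset.mem_sdiff.mpr ⟨hI, hIT⟩), zero_add]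
            exact hle
      refine (Finset.sum_le_sum hh).trans ?_
      rw [Finset.sum_add_distrib]
      gcongr
      · rw [Finset.sum_ite_eq']; split_ifs <;> norm_num
      · rw [Finset.sum_ite_mem]
        rw [Finset.inter_eq_right.mpr Finset.sdiff_subset]
    have h2 := hT (s \ T) Finset.sdiff_disjoint
    rw [Real.norm_eq_abs] at h2
    linarith [le_abs_self (∑ I ∈ s \ T, g I)]
  have hP : 1 - ε ≤ ‖slEu f S‖ := by
    have hd : ‖slEu f S - 1‖ ≤ slEu g S - 1 := by
      let fq : M → ℂ := fun I => if (∀ p ∈ S, ¬ p ∣ I) then f I else 0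
      have hfq1 : fq 1 = 1 := by simp only [fq]; rw [if_pos (hone S hS)]; simp
      have hfqs : Summable fq := slEu_summable f hfs _
      have e1 := hfqs.tsum_eq_add_tsum_ite 1
      have e2 := hqs.tsum_eq_add_tsum_ite 1
      rw [hfq1] at e1
      rw [hq1] at e2
      have e1' : slEu f S - 1 = ∑' n, if n = 1 then 0 else fq n := by
        rw [show slEu f S = ∑' b, fq b from rfl, e1]; ring
      have e2' : slEu g S - 1 = ∑' n, if n = 1 then 0 else gq n := by
        rw [show slEu g S = ∑' b, gq b from rfl, e2]; ring
      rw [e1', e2']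
      refine tsum_of_norm_bounded (Summable.hasSum ?_) (fun I => ?_)
      · refine Summable.of_nonneg_of_le (fun I => ?_) (fun I => ?_) hqs
        · split_ifs; exacts [le_rfl, hq0 _]
        · split_ifs; exacts [hq0 _, le_rfl]
      · split_ifs
        · simp
        · simp only [fq, gq]; split_ifs <;> simp [hfg]
    have : ‖(1:ℂ)‖ ≤ ‖slEu f S‖ + ‖slEu f S - 1‖ := by
      calc ‖(1:ℂ)‖ = ‖slEu f S - (slEu f S - 1)‖ := by congr 1; ring
        _ ≤ _ := norm_sub_le _ _
    rw [norm_one] at this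
    linarith
  nlinarith [norm_nonneg (slEu f S)]

end EulerGen


def slNf (K : Type) [Field K] [NumberField K] (s : ℂ) (hs : 0 < s.re) : Ideal (𝓞 K) →*₀ ℂ where
  toFun I := (Ideal.absNorm I : ℂ) ^ (-s)
  map_zero' := by
    have : s ≠ 0 := fun h => by simp [h] at hs
    simp [this]
  map_one' := by simp
  map_mul' I J := by
    rw [map_mul]; push_cast
    exact_mod_cast Complex.natCast_mul_natCast_cpow _ _ _

def slNr (K : Type) [Field K] [NumberField K] (s : ℝ) (hs : 0 < s) : Ideal (𝓞 K) →*₀ ℝ where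
  toFun I := (Ideal.absNorm I : ℝ) ^ (-s)
  map_zero' := by
    simp [Real.zero_rpow (neg_ne_zero.mpr hs.ne')]
  map_one' := by simp
  map_mul' I J := by
    rw [map_mul]; push_cast
    exact Real.mul_rpow (by positivity) (by positivity)

def slZc (K : Type) [Field K] [NumberField K] (s : ℂ) : ℂ :=
  ∑' I : {I : Ideal (𝓞 K) // I ≠ ⊥}, (Ideal.absNorm (I : Ideal (𝓞 K)) : ℂ) ^ (-s)

lemma slZc_eq (K : Type) [Field K] [NumberField K] (s : ℂ) (hs : 0 < s.re) :
    slZc K s = ∑' I, slNf K s hs I := by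
  have := tsum_subtype_eq_of_support_subset (f := slNf K s hs) (s := {I : Ideal (𝓞 K) | I ≠ ⊥}) (by
    intro I hI h
    exact hI (by rw [h]; exact map_zero (slNf K s hs)))
  exact this

lemma slZr_eq (K : Type) [Field K] [NumberField K] (s : ℝ) (hs : 0 < s) :
    (slZ K s).toReal = ∑' I, slNr K s hs I := by
  have := tsum_subtype_eq_of_support_subset (f := slNr K s hs) (s := {I : Ideal (𝓞 K) | I ≠ ⊥}) (by
    intro I hI h
    exact hI (by rw [h]; exact map_zero (slNr K s hs)))
  rw [← this, slZ, ENNReal.tsum_toReal_eq (by simp)]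
  refine tsum_congr (fun I => ?_)
  rw [ENNReal.toReal_ofReal (by positivity)]
  rfl

lemma slNr_summable (K : Type) [Field K] [NumberField K] (s : ℝ) (hs : 0 < s) (h : slZ K s ≠ ⊤) :
    Summable (slNr K s hs) := by
  have h1 := ENNReal.summable_toReal h
  have h2 : Summable ((slNr K s hs) ∘ (fun I : {I : Ideal (𝓞 K) // I ≠ ⊥} => (I : Ideal (𝓞 K)))) := by
    refine h1.congr (fun I => ?_)
    rw [ENNReal.toReal_ofReal (by positivity)]
    rfl
  refine (Function.Injective.summable_iff Subtype.val_injective ?_).mp h2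
  intro I hI
  have : I = ⊥ := by
    by_contra h
    exact hI ⟨⟨I, h⟩, rfl⟩
  rw [this]; exact map_zero (slNr K s hs)

lemma slNr_le_one (K : Type) [Field K] [NumberField K] (s : ℝ) (hs : 0 < s) (I) : slNr K s hs I ≤ 1 := by
  by_cases h : I = ⊥
  · rw [h]; exact (map_zero (slNr K s hs)).le.trans zero_le_one
  · refine Real.rpow_le_one_of_one_le_of_nonpos ?_ (by linarith)
    have : Ideal.absNorm I ≠ 0 := by rwa [Ne, Ideal.absNorm_eq_zero_iff]
    exact_mod_cast Nat.one_le_iff_ne_zero.mpr this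

lemma slNf_norm (K : Type) [Field K] [NumberField K] (s : ℂ) (hs : 0 < s.re) (I) :
    ‖slNf K s hs I‖ = slNr K s.re hs I := by
  by_cases h : I = ⊥
  · rw [h]
    have e1 := map_zero (slNf K s hs)
    have e2 := map_zero (slNr K s.re hs)
    rw [Ideal.zero_eq_bot] at e1 e2
    rw [e1, e2, norm_zero]
  · have : Ideal.absNorm I ≠ 0 := by rwa [Ne, Ideal.absNorm_eq_zero_iff]
    exact Complex.norm_natCast_cpow_of_pos (Nat.pos_of_ne_zero this) _

lemma slZc_lower (K : Type) [Field K] [NumberField K] (s : ℂ) (hs : 0 < s.re) (h : slZ K s.re ≠ ⊤) :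
    1 ≤ ‖slZc K s‖ * (slZ K s.re).toReal := by
  rw [slZc_eq K s hs, slZr_eq K _ hs]
  exact sl_euler_lower _ _ (slNf_norm K s hs) (slNr_summable K _ hs h) (slNr_le_one K _ hs)

lemma slZc_upper (K : Type) [Field K] [NumberField K] (s : ℂ) (hs : 0 < s.re) (h : slZ K s.re ≠ ⊤) :
    ‖slZc K s‖ ≤ (slZ K s.re).toReal := by
  rw [slZc_eq K s hs, slZr_eq K _ hs]
  exact tsum_of_norm_bounded (slNr_summable K _ hs h).hasSum (fun I => (slNf_norm K s hs I).le)

lemma slZr_anti (K : Type) [Field K] [NumberField K] {s t : ℝ} (hst : s ≤ t) (h : slZ K s ≠ ⊤) :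
    (slZ K t).toReal ≤ (slZ K s).toReal := by
  refine ENNReal.toReal_mono h (ENNReal.tsum_le_tsum (fun I => ENNReal.ofReal_le_ofReal ?_))
  refine Real.rpow_le_rpow_of_exponent_le ?_ (by linarith)
  have : Ideal.absNorm (I : Ideal (𝓞 K)) ≠ 0 := by rw [Ne, Ideal.absNorm_eq_zero_iff]; exact I.2
  exact_mod_cast Nat.one_le_iff_ne_zero.mpr this

lemma slZr_one_le (K : Type) [Field K] [NumberField K] {s : ℝ} (hs : 0 < s) (h : slZ K s ≠ ⊤) :
    1 ≤ (slZ K s).toReal := by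
  rw [slZr_eq K _ hs]
  have := (slNr_summable K _ hs h).le_tsum 1 (fun j _ => by
    show (0:ℝ) ≤ (Ideal.absNorm j : ℝ) ^ (-s); positivity)
  rwa [map_one] at this

lemma slZc_real (K : Type) [Field K] [NumberField K] {s : ℝ} (hs : 0 < s) :
    slZc K s = ((slZ K s).toReal : ℂ) := by
  rw [slZc_eq K s (by simpa using hs), slZr_eq K _ hs, Complex.ofReal_tsum]
  refine tsum_congr (fun I => ?_)
  show (Ideal.absNorm I : ℂ) ^ (-(s:ℂ)) = (((Ideal.absNorm I : ℝ) ^ (-s) : ℝ) : ℂ)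
  rw [Complex.ofReal_cpow (by positivity)]
  push_cast; rfl

end

section
open NumberField

lemma sl_beta_bound (z : ℂ) (d : ℝ) :
    ‖Complex.betaIntegral z d‖ ≤ ‖Complex.betaIntegral z.re d‖ := by
  have key : Complex.betaIntegral z.re d = ((∫ x in (0:ℝ)..1, ‖(x : ℂ) ^ (z - 1) * (1 - (x : ℂ)) ^ ((d:ℂ) - 1)‖ : ℝ) : ℂ) := by
    unfold Complex.betaIntegral
    rw [← intervalIntegral.integral_ofReal]
    rw [intervalIntegral.integral_of_le zero_le_one, intervalIntegral.integral_of_le zero_le_one,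
      MeasureTheory.integral_Ioc_eq_integral_Ioo, MeasureTheory.integral_Ioc_eq_integral_Ioo]
    refine MeasureTheory.setIntegral_congr_fun measurableSet_Ioo ?_
    intro x hx
    have hx0 : 0 < x := hx.1
    have hx1 : 0 < 1 - x := by linarith [hx.2]
    have e : (1 - (x:ℂ)) = ((1 - x : ℝ) : ℂ) := by push_cast; rfl
    simp only [norm_mul]
    rw [e, Complex.norm_cpow_eq_rpow_re_of_pos hx0, Complex.norm_cpow_eq_rpow_re_of_pos hx1]
    push_cast
    rw [Complex.ofReal_cpow hx0.le, Complex.ofReal_cpow hx1.le]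
    push_cast
    simp
  rw [key, Complex.norm_real]
  refine (intervalIntegral.norm_integral_le_integral_norm (by norm_num)).trans (le_abs_self _)

lemma sl_Gamma_ratio (z : ℂ) (hz : 0 < z.re) (d : ℝ) (hd : 0 < d) :
    ‖Complex.Gamma z‖ * Real.Gamma (z.re + d) ≤ ‖Complex.Gamma (z + d)‖ * Real.Gamma z.re := by
  have h1 := congrArg norm (Complex.Gamma_mul_Gamma_eq_betaIntegral hz (t := (d:ℂ)) (by simpa using hd))
  have h2 := congrArg norm (Complex.Gamma_mul_Gamma_eq_betaIntegral (s := (z.re : ℂ)) (by simpa using hz) (t := (d:ℂ)) (by simpa using hd))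
  have h3 := sl_beta_bound z d
  rw [norm_mul, norm_mul] at h1 h2
  rw [← Complex.ofReal_add] at h2
  simp only [Complex.Gamma_ofReal, Complex.norm_real, Real.norm_eq_abs] at h1 h2
  have p1 := Real.Gamma_pos_of_pos hz
  have p2 := Real.Gamma_pos_of_pos hd
  have p3 := Real.Gamma_pos_of_pos (add_pos hz hd)
  rw [abs_of_pos p2] at h1 h2
  rw [abs_of_pos p1, abs_of_pos p3] at h2
  refine le_of_mul_le_mul_right ?_ p2
  calc _ = (‖Complex.Gamma z‖ * Real.Gamma d) * Real.Gamma (z.re + d) := by ring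
    _ = ‖Complex.Gamma (z + d)‖ * ‖Complex.betaIntegral z d‖ * Real.Gamma (z.re + d) := by rw [h1]
    _ ≤ ‖Complex.Gamma (z + d)‖ * ‖Complex.betaIntegral z.re d‖ * Real.Gamma (z.re + d) := by gcongr
    _ = ‖Complex.Gamma (z + d)‖ * (Real.Gamma z.re * Real.Gamma d) := by rw [h2]; ring
    _ = _ := by ring

lemma sl_Gamma_decay (X δ : ℝ) (hX : 1 < X) (hδ : 0 < δ) :
    Real.Gamma X * (X - 1) ^ δ ≤ Real.Gamma (X + δ) := by
  have h := Real.Gamma_mul_add_mul_le_rpow_Gamma_mul_rpow_Gamma (s := X - 1) (t := X + δ)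
    (a := δ / (1 + δ)) (b := 1 / (1 + δ)) (by linarith) (by linarith) (by positivity) (by positivity) (by field_simp; ring)
  have e : δ / (1 + δ) * (X - 1) + 1 / (1 + δ) * (X + δ) = X := by field_simp; ring
  rw [e] at h
  have g1 : 0 < Real.Gamma (X - 1) := Real.Gamma_pos_of_pos (by linarith)
  have g2 : 0 < Real.Gamma X := Real.Gamma_pos_of_pos (by linarith)
  have g3 : 0 < Real.Gamma (X + δ) := Real.Gamma_pos_of_pos (by linarith)
  have hx : 0 < X - 1 := by linarith
  have e2 : Real.Gamma X = (X - 1) * Real.Gamma (X - 1) := by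
    have := Real.Gamma_add_one hx.ne'
    rw [← this]; congr 1; ring
  have hl := Real.log_le_log g2 h
  rw [Real.log_mul (by positivity) (by positivity), Real.log_rpow g1, Real.log_rpow g3] at hl
  have hl2 : Real.log (Real.Gamma X) = Real.log (X - 1) + Real.log (Real.Gamma (X - 1)) := by
    rw [e2, Real.log_mul hx.ne' g1.ne']
  rw [← Real.log_le_log_iff (by positivity) g3, Real.log_mul (by positivity) (by positivity), Real.log_rpow hx]
  have hl3 : (1 + δ) * Real.log (Real.Gamma X) ≤ δ * Real.log (Real.Gamma (X-1)) + Real.log (Real.Gamma (X + δ)) := by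
    have := mul_le_mul_of_nonneg_left hl (by linarith : 0 ≤ 1 + δ)
    refine this.trans (le_of_eq ?_)
    field_simp
  nlinarith

lemma sl_Gamma_half (t : ℝ) : Real.exp (-(Real.pi * |t|)) ≤ ‖Complex.Gamma (1/2 + t * Complex.I)‖ := by
  have h := Complex.Gamma_mul_Gamma_one_sub (1/2 + t * Complex.I)
  have e : (1 - (1/2 + t * Complex.I) : ℂ) = (starRingEnd ℂ) (1/2 + t * Complex.I) := by
    apply Complex.ext
    · simp; norm_num
    · simp
  rw [e, Complex.Gamma_conj] at h
  have h2 := congrArg norm h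
  rw [norm_mul, Complex.norm_conj, norm_div] at h2
  have e3 : Complex.sin (Real.pi * (1/2 + t * Complex.I)) = ((Real.cosh (Real.pi * t) : ℝ) : ℂ) := by
    have : (Real.pi * (1/2 + t * Complex.I) : ℂ) = Real.pi / 2 - (-(Real.pi * t * Complex.I)) := by ring
    rw [this, Complex.sin_pi_div_two_sub, Complex.cos_neg, Complex.cos_mul_I]
    push_cast; rfl
  rw [e3, Complex.norm_real, Complex.norm_real, Real.norm_eq_abs, Real.norm_eq_abs, abs_of_pos Real.pi_pos, abs_of_pos (Real.cosh_pos _)] at h2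
  set G := ‖Complex.Gamma (1/2 + t * Complex.I)‖ with hG
  have hc : Real.cosh (Real.pi * t) ≤ Real.exp (Real.pi * |t|) := by
    rw [← Real.cosh_abs, abs_mul, abs_of_pos Real.pi_pos, Real.cosh_eq]
    have : Real.exp (-(Real.pi * |t|)) ≤ Real.exp (Real.pi * |t|) := Real.exp_le_exp.mpr (by have := Real.pi_pos; have := abs_nonneg t; nlinarith)
    linarith
  have hE : Real.exp (-(Real.pi * |t|)) ≤ 1 := by rw [Real.exp_le_one_iff]; have := Real.pi_pos; have := abs_nonneg t; nlinarith
  have hE0 := Real.exp_pos (-(Real.pi * |t|))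
  have h5 : Real.exp (-(Real.pi * |t|)) ≤ G * G := by
    rw [h2, le_div_iff₀ (Real.cosh_pos _)]
    calc _ ≤ Real.exp (-(Real.pi * |t|)) * Real.exp (Real.pi * |t|) := by gcongr
      _ = 1 := by rw [← Real.exp_add]; simp
      _ ≤ Real.pi := by linarith [Real.pi_gt_three]
  by_contra hcon
  push Not at hcon
  have := norm_nonneg (Complex.Gamma (1/2 + t * Complex.I))
  rw [← hG] at this
  nlinarith

/-- exponential lower bound for Gamma in a strip -/
lemma sl_Gamma_strip (b : ℝ) : ∃ c : ℝ, 0 < c ∧ ∀ z : ℂ, 1/2 < z.re → z.re ≤ b →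
    c * Real.exp (-(Real.pi * |z.im|)) ≤ ‖Complex.Gamma z‖ := by
  obtain hb | hb := lt_or_ge b (1/2)
  · exact ⟨1, one_pos, fun z h1 h2 => by linarith⟩
  have hcont : ContinuousOn Real.Gamma (Set.Icc (1/2) b) := by
    intro x hx
    refine (Real.differentiableAt_Gamma ?_).continuousAt.continuousWithinAt
    intro m hm
    have := hx.1
    have : (0:ℝ) ≤ m := by positivity
    linarith
  obtain ⟨x0, hx0, hmin⟩ := isCompact_Icc.exists_isMinOn (Set.nonempty_Icc.mpr hb) hcont
  have hg0 : 0 < Real.Gamma x0 := Real.Gamma_pos_of_pos (by linarith [hx0.1])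
  have hh : 0 < Real.Gamma (1/2) := Real.Gamma_pos_of_pos (by norm_num)
  refine ⟨Real.Gamma x0 / Real.Gamma (1/2), by positivity, fun z h1 h2 => ?_⟩
  have hr := sl_Gamma_ratio (1/2 + z.im * Complex.I) (by simp) (z.re - 1/2) (by linarith)
  have e1 : (1/2 + z.im * Complex.I : ℂ).re = 1/2 := by simp
  have e2 : (1/2 + z.im * Complex.I + ((z.re - 1/2 : ℝ) : ℂ) : ℂ) = z := by
    apply Complex.ext <;> simp
  rw [e1, e2] at hr
  have e3 : 1/2 + (z.re - 1/2) = z.re := by ring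
  rw [e3] at hr
  have hm : Real.Gamma x0 ≤ Real.Gamma z.re := hmin ⟨h1.le, h2⟩
  have h3 := sl_Gamma_half z.im
  rw [div_mul_eq_mul_div, div_le_iff₀ hh]
  refine le_trans ?_ hr
  rw [mul_comm]
  gcongr

lemma sl_Gamma_slope (m : ℕ) (hm : 1 ≤ m) (u v : ℝ) (hu : 0 < u) (huv : u < v) (hv : v < m) :
    Real.Gamma v ≤ (m:ℝ) ^ (v - u) * Real.Gamma u := by
  have hm0 : (0:ℝ) < m := by exact_mod_cast hm
  have s1 := Real.convexOn_log_Gamma.slope_mono_adjacent (x := u) (y := v) (z := m) hu hm0 huv hv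
  have s2 := Real.convexOn_log_Gamma.slope_mono_adjacent (x := v) (y := m) (z := m + 1) (show (0:ℝ) < v by linarith) (show (0:ℝ) < m + 1 by linarith) hv (by linarith)
  have e : Real.log (Real.Gamma (m + 1)) = Real.log m + Real.log (Real.Gamma m) := by
    rw [Real.Gamma_add_one hm0.ne', Real.log_mul hm0.ne' (Real.Gamma_pos_of_pos hm0).ne']
  simp only [Function.comp_apply] at s1 s2
  rw [e] at s2
  have s3 := s1.trans s2
  rw [show (m:ℝ) + 1 - m = 1 by ring, div_one, div_le_iff₀ (by linarith)] at s3
  have gu := Real.Gamma_pos_of_pos hu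
  have gv := Real.Gamma_pos_of_pos (hu.trans huv)
  rw [← Real.log_le_log_iff gv (by positivity), Real.log_mul (by positivity) gu.ne', Real.log_rpow hm0]
  nlinarith

end

section
open NumberField

def slqm (m : ℕ) : ℝ := 1 / (Real.pi * m)
lemma slqm_pos {m : ℕ} (hm : 0 < m) : 0 < slqm m := by
  unfold slqm; have := Real.pi_pos; positivity
lemma slqm_le {m : ℕ} (hm : 0 < m) : slqm m ≤ 1 := by
  unfold slqm
  have h := Real.pi_gt_three
  have : (1:ℝ) ≤ m := by exact_mod_cast hm
  rw [div_le_one (by positivity)]; nlinarith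

def slGw (m : ℕ) (s : ℂ) : ℂ := (slqm m : ℂ) ^ ((m:ℂ) * s / 2) * Complex.Gamma ((m:ℂ) * s / 2)
def slRw (m : ℕ) (σ : ℝ) : ℝ := (slqm m) ^ ((m:ℝ) * σ / 2) * Real.Gamma ((m:ℝ) * σ / 2)
def slIw (m : ℕ) (s : ℂ) : ℂ := (slqm m : ℂ) ^ (-((m:ℂ) * s / 2)) * (Complex.Gamma ((m:ℂ) * s / 2))⁻¹

def slGC (K : Type) [Field K] [NumberField K] (s : ℂ) : ℂ := ∏ w : InfinitePlace K, slGw w.mult s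
def slGi (K : Type) [Field K] [NumberField K] (s : ℂ) : ℂ := ∏ w : InfinitePlace K, slIw w.mult s

lemma slG_eq (K : Type) [Field K] [NumberField K] (σ : ℝ) : slG K σ = ∏ w : InfinitePlace K, slRw w.mult σ := rfl

lemma slMult_pos {K : Type} [Field K] (w : InfinitePlace K) : 0 < w.mult := InfinitePlace.mult_pos

lemma slRw_pos {m : ℕ} (hm : 0 < m) {σ : ℝ} (hσ : 0 < σ) : 0 < slRw m σ :=
  mul_pos (Real.rpow_pos_of_pos (slqm_pos hm) _) (Real.Gamma_pos_of_pos (by positivity))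

lemma slGw_real {m : ℕ} (hm : 0 < m) (σ : ℝ) : slGw m σ = (slRw m σ : ℂ) := by
  unfold slGw slRw
  push_cast
  rw [Complex.ofReal_cpow (slqm_pos hm).le, ← Complex.Gamma_ofReal]
  push_cast; rfl

lemma slGC_real (K : Type) [Field K] [NumberField K] (σ : ℝ) : slGC K σ = (slG K σ : ℂ) := by
  rw [slG_eq, slGC]; push_cast
  exact Finset.prod_congr rfl (fun w _ => slGw_real (slMult_pos w) σ)

lemma slRe (m : ℕ) (s : ℂ) : ((m:ℂ) * s / 2).re = (m:ℝ) * s.re / 2 := by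
  have : ((m:ℂ) * s / 2) = ((m / 2 : ℝ) : ℂ) * s := by push_cast; ring
  rw [this, Complex.re_ofReal_mul]; ring
lemma slIm (m : ℕ) (s : ℂ) : ((m:ℂ) * s / 2).im = (m:ℝ) * s.im / 2 := by
  have : ((m:ℂ) * s / 2) = ((m / 2 : ℝ) : ℂ) * s := by push_cast; ring
  rw [this, Complex.im_ofReal_mul]; ring

lemma slGw_norm {m : ℕ} (hm : 0 < m) (s : ℂ) :
    ‖slGw m s‖ = (slqm m) ^ ((m:ℝ) * s.re / 2) * ‖Complex.Gamma ((m:ℂ) * s / 2)‖ := by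
  unfold slGw
  rw [norm_mul, Complex.norm_cpow_eq_rpow_re_of_pos (slqm_pos hm), slRe]

lemma slGw_inv {m : ℕ} (hm : 0 < m) (s : ℂ) (hs : 0 < s.re) : slIw m s * slGw m s = 1 := by
  unfold slIw slGw
  have h1 : (slqm m : ℂ) ≠ 0 := by exact_mod_cast (slqm_pos hm).ne'
  have h2 : Complex.Gamma ((m:ℂ) * s / 2) ≠ 0 := Complex.Gamma_ne_zero_of_re_pos (by rw [slRe]; positivity)
  rw [Complex.cpow_neg]
  have h3 : (slqm m : ℂ) ^ ((m:ℂ) * s / 2) ≠ 0 := by simp [Complex.cpow_eq_zero_iff, h1]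
  field_simp

lemma slGi_mul (K : Type) [Field K] [NumberField K] (s : ℂ) (hs : 0 < s.re) : slGi K s * slGC K s = 1 := by
  unfold slGi slGC
  rw [← Finset.prod_mul_distrib]
  exact Finset.prod_eq_one (fun w _ => slGw_inv (slMult_pos w) s hs)

lemma slIw_diff {m : ℕ} (hm : 0 < m) : Differentiable ℂ (slIw m) := by
  have h1 : (slqm m : ℂ) ≠ 0 := by exact_mod_cast (slqm_pos hm).ne'
  have hl : Differentiable ℂ (fun s : ℂ => (m:ℂ) * s / 2) := by fun_prop
  unfold slIw
  refine Differentiable.mul ?_ ?_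
  · intro s
    exact (hl s).neg.const_cpow (Or.inl h1)
  · exact Complex.differentiable_one_div_Gamma.comp hl

lemma slGi_diff (K : Type) [Field K] [NumberField K] : Differentiable ℂ (slGi K) := by
  unfold slGi
  exact Differentiable.fun_finsetProd (fun w _ => slIw_diff (slMult_pos w))

lemma slGw_ratio {m : ℕ} (hm : 0 < m) (z : ℂ) (hz : 0 < z.re) (d : ℝ) (hd : 0 < d) :
    ‖slGw m z‖ * slRw m (z.re + d) ≤ ‖slGw m (z + d)‖ * slRw m z.re := by
  rw [slGw_norm hm, slGw_norm hm]
  unfold slRw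
  have hm' : (0:ℝ) < m := by exact_mod_cast hm
  have h := sl_Gamma_ratio ((m:ℂ) * z / 2) (by rw [slRe]; positivity) ((m:ℝ) * d / 2) (by positivity)
  rw [slRe] at h
  have e1 : (m:ℂ) * z / 2 + (((m:ℝ) * d / 2 : ℝ) : ℂ) = (m:ℂ) * (z + d) / 2 := by push_cast; ring
  have e2 : (m:ℝ) * z.re / 2 + (m:ℝ) * d / 2 = (m:ℝ) * (z.re + d) / 2 := by ring
  rw [e1, e2] at h
  simp only [Complex.add_re, Complex.ofReal_re]
  have p1 := Real.rpow_pos_of_pos (slqm_pos hm) ((m:ℝ) * z.re / 2)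
  have p2 := Real.rpow_pos_of_pos (slqm_pos hm) ((m:ℝ) * (z.re + d) / 2)
  calc _ = (slqm m ^ ((m:ℝ) * z.re / 2) * slqm m ^ ((m:ℝ) * (z.re + d) / 2)) * (‖Complex.Gamma ((m:ℂ) * z / 2)‖ * Real.Gamma ((m:ℝ) * (z.re + d) / 2)) := by ring
    _ ≤ (slqm m ^ ((m:ℝ) * z.re / 2) * slqm m ^ ((m:ℝ) * (z.re + d) / 2)) * (‖Complex.Gamma ((m:ℂ) * (z + d) / 2)‖ * Real.Gamma ((m:ℝ) * z.re / 2)) := by gcongr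
    _ = _ := by ring

lemma slGC_ratio (K : Type) [Field K] [NumberField K] (z : ℂ) (hz : 0 < z.re) (d : ℝ) (hd : 0 < d) :
    ‖slGC K z‖ * slG K (z.re + d) ≤ ‖slGC K (z + d)‖ * slG K z.re := by
  rw [slG_eq, slG_eq, slGC, slGC, norm_prod, norm_prod, ← Finset.prod_mul_distrib, ← Finset.prod_mul_distrib]
  refine Finset.prod_le_prod (fun w _ => ?_) (fun w _ => slGw_ratio (slMult_pos w) z hz d hd)
  exact mul_nonneg (norm_nonneg _) (slRw_pos (slMult_pos w) (by linarith)).le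

lemma slRw_decay {m : ℕ} (hm : 0 < m) (X d R : ℝ) (hd : 0 < d) (hR : 0 < R) (hX : 2 * Real.pi * R + 2 ≤ X) :
    slRw m X * R ^ ((m:ℝ) * d / 2) ≤ slRw m (X + d) := by
  have hm' : (1:ℝ) ≤ m := by exact_mod_cast hm
  have hpi := Real.pi_pos
  have hX1 : Real.pi * m * R ≤ m * X / 2 - 1 := by nlinarith
  have hX2 : 1 < m * X / 2 := by have : 0 < Real.pi * m * R := by positivity
                                 linarith
  have h := sl_Gamma_decay (m * X / 2) (m * d / 2) hX2 (by positivity)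
  have hq := slqm_pos hm
  have hR2 : R ≤ slqm m * (m * X / 2 - 1) := by
    unfold slqm
    rw [one_div, ← div_eq_inv_mul, le_div_iff₀ (by positivity)]; linarith
  unfold slRw
  have e : (m:ℝ) * (X + d) / 2 = m * X / 2 + m * d / 2 := by ring
  rw [e, Real.rpow_add hq]
  have g := Real.Gamma_pos_of_pos (lt_trans one_pos hX2)
  calc _ ≤ slqm m ^ ((m:ℝ) * X / 2) * Real.Gamma (m * X / 2) * (slqm m * (m * X / 2 - 1)) ^ ((m:ℝ) * d / 2) := by gcongr
    _ = slqm m ^ ((m:ℝ) * X / 2) * slqm m ^ ((m:ℝ) * d / 2) * (Real.Gamma (m * X / 2) * (m * X / 2 - 1) ^ ((m:ℝ) * d / 2)) := by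
      rw [Real.mul_rpow hq.le (by linarith)]; ring
    _ ≤ _ := by gcongr

lemma slG_decay (K : Type) [Field K] [NumberField K] (d : ℝ) (hd : 0 < d) (B : ℝ) (hB : 0 < B) :
    ∃ A : ℝ, ∀ X, A ≤ X → slG K X * B ≤ slG K (X + d) := by
  have hn := sl_npos K
  set n : ℝ := (Module.finrank ℚ K : ℝ)
  set R := B ^ (2 / (n * d)) with hR
  have hR0 : 0 < R := Real.rpow_pos_of_pos hB _
  refine ⟨2 * Real.pi * R + 2, fun X hX => ?_⟩
  have hX0 : 0 < X := by have := Real.pi_pos; have : 0 < 2 * Real.pi * R := by positivity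
                         linarith
  have e : B = ∏ w : InfinitePlace K, R ^ ((w.mult:ℝ) * d / 2) := by
    rw [Finset.prod_congr rfl (fun w _ => show R ^ ((w.mult:ℝ) * d / 2) = R ^ ((w.mult:ℝ) * (d / 2)) by ring_nf)]
    rw [← Real.rpow_sum_of_pos hR0, ← Finset.sum_mul, sl_sum_mult, hR, ← Real.rpow_mul hB.le]
    have : 2 / (n * d) * (n * (d / 2)) = 1 := by field_simp
    show B = B ^ (2 / (n * d) * (n * (d / 2)))
    rw [this, Real.rpow_one]
  rw [slG_eq, slG_eq]
  nth_rewrite 1 [e]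
  rw [← Finset.prod_mul_distrib]
  refine Finset.prod_le_prod (fun w _ => ?_) (fun w _ => slRw_decay (slMult_pos w) X d R hd hR0 hX)
  exact mul_nonneg (slRw_pos (slMult_pos w) hX0).le (by positivity)

lemma slGw_strip {m : ℕ} (hm : 0 < m) (b : ℝ) : ∃ c : ℝ, 0 < c ∧ ∀ s : ℂ, 1 < s.re → s.re ≤ b →
    c * Real.exp (-(Real.pi / 2 * |s.im|) * m) ≤ ‖slGw m s‖ := by
  have hm' : (1:ℝ) ≤ m := by exact_mod_cast hm
  obtain ⟨c, hc, h⟩ := sl_Gamma_strip (m * b / 2)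
  refine ⟨slqm m ^ ((m:ℝ) * b / 2) * c, mul_pos (Real.rpow_pos_of_pos (slqm_pos hm) _) hc, fun s h1 h2 => ?_⟩
  have := h ((m:ℂ) * s / 2) (by rw [slRe]; nlinarith) (by rw [slRe]; gcongr)
  rw [slGw_norm hm, mul_assoc]
  refine mul_le_mul ?_ ?_ (by positivity) (Real.rpow_nonneg (slqm_pos hm).le _)
  · exact Real.rpow_le_rpow_of_exponent_ge (slqm_pos hm) (slqm_le hm) (by gcongr)
  · refine le_trans (le_of_eq ?_) this
    rw [slIm, abs_div, abs_mul, abs_of_pos (by linarith : (0:ℝ) < m), abs_two]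
    congr 2; ring

lemma slGC_strip (K : Type) [Field K] [NumberField K] (b : ℝ) : ∃ c : ℝ, 0 < c ∧ ∃ M : ℝ, 0 ≤ M ∧
    ∀ s : ℂ, 1 < s.re → s.re ≤ b → c * Real.exp (-(M * |s.im|)) ≤ ‖slGC K s‖ := by
  choose c hc h using fun w : InfinitePlace K => slGw_strip (slMult_pos w) b
  refine ⟨∏ w, c w, Finset.prod_pos (fun w _ => hc w), Real.pi / 2 * (∑ w : InfinitePlace K, (w.mult : ℝ)), ?_, fun s h1 h2 => ?_⟩
  · have := Real.pi_pos; positivity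
  have e : Real.exp (-(Real.pi / 2 * (∑ w : InfinitePlace K, (w.mult : ℝ)) * |s.im|)) = ∏ w : InfinitePlace K, Real.exp (-(Real.pi / 2 * |s.im|) * w.mult) := by
    rw [← Real.exp_sum, ← Finset.mul_sum]; congr 1; ring
  rw [e, ← Finset.prod_mul_distrib, slGC, norm_prod]
  exact Finset.prod_le_prod (fun w _ => by have := hc w; positivity) (fun w _ => h w s h1 h2)

lemma slRw_anti {m : ℕ} (hm : 0 < m) (x y : ℝ) (hx : 1 < x) (hxy : x < y) (hy : y < 2) :
    slRw m y ≤ Real.exp (-((y - x) / 2) * m) * slRw m x := by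
  have hm' : (1:ℝ) ≤ m := by exact_mod_cast hm
  have h := sl_Gamma_slope m hm (m * x / 2) (m * y / 2) (by positivity) (by nlinarith) (by nlinarith)
  unfold slRw
  have hq := slqm_pos hm
  have e : (m:ℝ) * y / 2 = m * x / 2 + m * (y - x) / 2 := by ring
  have e' : (m:ℝ) * y / 2 - m * x / 2 = m * (y - x) / 2 := by ring
  rw [e'] at h
  have h2 : slqm m ^ ((m:ℝ) * y / 2) = slqm m ^ ((m:ℝ) * x / 2) * slqm m ^ ((m:ℝ) * (y-x) / 2) := by
    rw [e, Real.rpow_add hq]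
  rw [h2]
  have h3 : slqm m ^ ((m:ℝ) * (y-x) / 2) * (m:ℝ) ^ ((m:ℝ) * (y-x) / 2) ≤ Real.exp (-((y - x) / 2) * m) := by
    rw [← Real.mul_rpow hq.le (by linarith)]
    have e4 : slqm m * m = Real.pi⁻¹ := by unfold slqm; field_simp
    have e5 : Real.pi⁻¹ ≤ Real.exp (-1) := by
      rw [Real.exp_neg]
      exact inv_anti₀ (Real.exp_pos _) (by linarith [Real.exp_one_lt_d9, Real.pi_gt_three])
    rw [e4]
    calc Real.pi⁻¹ ^ ((m:ℝ) * (y-x) / 2) ≤ Real.exp (-1) ^ ((m:ℝ) * (y-x) / 2) := by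
          have : 0 ≤ y - x := by linarith
          have := Real.pi_pos
          gcongr
      _ = _ := by rw [← Real.exp_mul]; congr 1; ring
  have g := Real.Gamma_pos_of_pos (show 0 < (m:ℝ) * x / 2 by positivity)
  have q1 := Real.rpow_pos_of_pos hq ((m:ℝ) * x / 2)
  have q2 := Real.rpow_pos_of_pos hq ((m:ℝ) * (y-x) / 2)
  calc _ ≤ slqm m ^ ((m:ℝ) * x / 2) * slqm m ^ ((m:ℝ) * (y-x) / 2) * ((m:ℝ) ^ ((m:ℝ) * (y-x) / 2) * Real.Gamma (m * x / 2)) := by gcongr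
    _ = (slqm m ^ ((m:ℝ) * (y-x) / 2) * (m:ℝ) ^ ((m:ℝ) * (y-x) / 2)) * (slqm m ^ ((m:ℝ) * x / 2) * Real.Gamma (m * x / 2)) := by ring
    _ ≤ _ := by gcongr

lemma slG_anti (K : Type) [Field K] [NumberField K] (hn : 1 < Module.finrank ℚ K) (x y : ℝ) (hx : 1 < x) (hxy : x < y) (hy : y < 2) :
    y * slG K y ≤ x * slG K x := by
  have h1 : slG K y ≤ Real.exp (-(y - x)) * slG K x := by
    have h2 : slG K y ≤ Real.exp (-((y - x) / 2) * Module.finrank ℚ K) * slG K x := by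
      rw [← sl_sum_mult, Finset.mul_sum, Real.exp_sum, slG_eq, slG_eq, ← Finset.prod_mul_distrib]
      exact Finset.prod_le_prod (fun w _ => (slRw_pos (slMult_pos w) (by linarith)).le)
        (fun w _ => slRw_anti (slMult_pos w) x y hx hxy hy)
    refine h2.trans ?_
    have := slG_pos K (show 0 < x by linarith)
    have hn2 : (2:ℝ) ≤ Module.finrank ℚ K := by exact_mod_cast hn
    gcongr
    nlinarith
  have h3 : y ≤ x * Real.exp (y - x) := by
    have := Real.add_one_le_exp (y - x)
    nlinarith
  have gx := slG_pos K (show 0 < x by linarith)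
  calc y * slG K y ≤ (x * Real.exp (y - x)) * (Real.exp (-(y - x)) * slG K x) := by
        have := slG_pos K (show 0 < y by linarith)
        gcongr
    _ = x * slG K x * (Real.exp (y - x) * Real.exp (-(y - x))) := by ring
    _ = _ := by rw [← Real.exp_add]; simp

end

section
open NumberField

structure slXi (K : Type) [Field K] [NumberField K] (ξ : ℂ → ℂ) (c : ℝ) : Prop where
  diff : Differentiable ℂ ξ
  FE : ∀ s, ξ (1 - s) = ξ s
  growth : ∀ a b : ℝ, ∃ C : ℝ, 0 ≤ C ∧ ∀ s : ℂ, a ≤ s.re → s.re ≤ b → ‖ξ s‖ ≤ C * (1 + ‖s‖)^2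
  cpos : 0 < c
  fin : ∀ σ : ℝ, 1 < σ → slZ K σ ≠ ⊤
  rep : ∀ s : ℂ, 1 < s.re → ξ s = (c:ℂ) * (s * (s - 1)) * (slD K : ℂ) ^ (s / 2) * slGC K s * slZc K s
  conj : ∀ s, ξ ((starRingEnd ℂ) s) = (starRingEnd ℂ) (ξ s)

def slE (K : Type) [Field K] [NumberField K] (c : ℝ) (s : ℂ) : ℂ := (c:ℂ) * (s * (s - 1)) * (slD K : ℂ) ^ (s / 2)

lemma slD_ne (K : Type) [Field K] [NumberField K] : (slD K : ℂ) ≠ 0 := by exact_mod_cast (slD_pos K).ne'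

lemma slE_diff (K : Type) [Field K] [NumberField K] (c : ℝ) : Differentiable ℂ (slE K c) := by
  unfold slE
  refine Differentiable.mul (by fun_prop) ?_
  intro s
  exact (differentiableAt_id.div_const 2).const_cpow (Or.inl (slD_ne K))

lemma slE_ne (K : Type) [Field K] [NumberField K] {c : ℝ} (hc : 0 < c) {s : ℂ} (h0 : s ≠ 0) (h1 : s ≠ 1) : slE K c s ≠ 0 := by
  unfold slE
  have : (slD K : ℂ) ^ (s / 2) ≠ 0 := by simp [Complex.cpow_eq_zero_iff, slD_ne K]
  have hc' : (c:ℂ) ≠ 0 := by exact_mod_cast hc.ne'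
  exact mul_ne_zero (mul_ne_zero hc' (mul_ne_zero h0 (sub_ne_zero.mpr h1))) this

lemma sl_conj_of_real {f : ℂ → ℂ} (hf : Differentiable ℂ f) (b : ℝ)
    (h : ∀ x : ℝ, b < x → (starRingEnd ℂ) (f x) = f x) (s : ℂ) : f ((starRingEnd ℂ) s) = (starRingEnd ℂ) (f s) := by
  have hd : Differentiable ℂ ((starRingEnd ℂ) ∘ f ∘ (starRingEnd ℂ)) := by
    intro z
    have := (hf ((starRingEnd ℂ) z)).conj_conj
    rwa [Complex.conj_conj] at this
  have := sl_analytic_eq hd hf b (fun x hx => by simp only [Function.comp_apply, Complex.conj_ofReal]; exact h x hx)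
  have h2 := congrFun this s
  simp only [Function.comp_apply] at h2
  rw [← h2, Complex.conj_conj]

theorem sl_main (K : Type) [Field K] [NumberField K] (zeta : ℂ → ℂ) (hd : DifferentiableOn ℂ zeta {s : ℂ | s ≠ 1})
    (hz : ∀ s : ℂ, 1 < s.re → zeta s = slZc K s) :
    ∃ ξ c, slXi K ξ c ∧ ∀ s, s ≠ 1 → zeta s * slE K c s = ξ s * slGi K s := by
  obtain ⟨ξ, hdiff, hFE, hgr, c, hc, hrep⟩ := sl_xi K
  have hreal : ∀ σ : ℝ, 1 < σ → ξ σ = slE K c σ * slGC K σ * slZc K σ := by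
    intro σ hσ
    rw [(hrep σ hσ).2, slZc_real K (by linarith), slGC_real, slE]
    push_cast
    rw [Complex.ofReal_cpow (slD_pos K).le]
    push_cast; rfl
  have key : ∀ s, s ≠ 1 → zeta s * slE K c s = ξ s * slGi K s := by
    have hopen : IsOpen {s : ℂ | s ≠ 1} := isOpen_ne
    have h1 : AnalyticOnNhd ℂ (fun s => zeta s * slE K c s) {s : ℂ | s ≠ 1} :=
      (hd.mul (slE_diff K c).differentiableOn).analyticOnNhd hopen
    have h2 : AnalyticOnNhd ℂ (fun s => ξ s * slGi K s) {s : ℂ | s ≠ 1} :=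
      ((hdiff.mul (slGi_diff K)).differentiableOn).analyticOnNhd hopen
    have hpre : IsPreconnected {s : ℂ | s ≠ 1} := (isConnected_compl_singleton_of_one_lt_rank (by simp) (1:ℂ)).isPreconnected
    have hb : ((2:ℝ):ℂ) ∈ {s : ℂ | s ≠ 1} := by norm_num
    refine h1.eqOn_of_preconnected_of_frequently_eq h2 hpre hb ?_
    have ht : Filter.Tendsto (fun x : ℝ => (x : ℂ)) (nhdsWithin 2 {2}ᶜ) (nhdsWithin ((2 : ℝ) : ℂ) {((2 : ℝ) : ℂ)}ᶜ) := by
      refine tendsto_nhdsWithin_iff.mpr ⟨(Complex.continuous_ofReal.tendsto _).mono_left nhdsWithin_le_nhds, ?_⟩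
      filter_upwards [self_mem_nhdsWithin] with x hx
      exact fun h => hx (Complex.ofReal_injective h)
    refine ht.frequently (Filter.Eventually.frequently ?_)
    have : ∀ᶠ x in nhds (2:ℝ), 1 < x := eventually_gt_nhds (by norm_num)
    filter_upwards [nhdsWithin_le_nhds this] with x hx
    rw [hz x (by simpa using hx), hreal x hx]
    have := slGi_mul K x (by simpa using (by linarith : 0 < x))
    linear_combination (- slE K c x * slZc K x) * this
  refine ⟨ξ, c, ⟨hdiff, hFE, hgr, hc, fun σ h => (hrep σ h).1, ?_, ?_⟩, key⟩
  · intro s hs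
    have h1 : s ≠ 1 := fun h => by rw [h] at hs; simp at hs
    have h2 := key s h1
    have h3 := slGi_mul K s (by linarith)
    rw [hz s hs] at h2
    have : ξ s = slE K c s * slGC K s * slZc K s := by
      linear_combination (-ξ s) * h3 - slGC K s * h2
    rw [this, slE]
  · exact sl_conj_of_real hdiff 1 (fun x hx => by rw [(hrep x hx).2, Complex.conj_ofReal])

lemma sl_zero (K : Type) [Field K] [NumberField K] (zeta ξ : ℂ → ℂ) (c : ℝ)
    (key : ∀ s, s ≠ 1 → zeta s * slE K c s = ξ s * slGi K s) (ρ : ℂ) (h0 : zeta ρ = 0) (h1 : 0 < ρ.re) (h2 : ρ.re < 1) :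
    ξ ρ = 0 := by
  have hne : ρ ≠ 1 := fun h => by rw [h] at h2; simp at h2
  have := key ρ hne
  rw [h0, zero_mul] at this
  have h3 := slGi_mul K ρ h1
  linear_combination (-ξ ρ) * h3 - slGC K ρ * this

lemma sl_zero_deriv (K : Type) [Field K] [NumberField K] (zeta ξ : ℂ → ℂ) (c : ℝ) (hd : DifferentiableOn ℂ zeta {s : ℂ | s ≠ 1})
    (hξ : Differentiable ℂ ξ)
    (key : ∀ s, s ≠ 1 → zeta s * slE K c s = ξ s * slGi K s) (ρ : ℂ) (h0 : zeta ρ = 0) (h1 : 0 < ρ.re) (h2 : ρ.re < 1)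
    (hder : deriv zeta ρ = 0) : deriv ξ ρ = 0 := by
  have hne : ρ ≠ 1 := fun h => by rw [h] at h2; simp at h2
  have hz := sl_zero K zeta ξ c key ρ h0 h1 h2
  have hnh : {s : ℂ | s ≠ 1} ∈ nhds ρ := isOpen_ne.mem_nhds hne
  have e : (fun s => zeta s * slE K c s) =ᶠ[nhds ρ] (fun s => ξ s * slGi K s) := by
    filter_upwards [hnh] with s hs using key s hs
  have d := e.deriv_eq
  have d1 : HasDerivAt (fun s => zeta s * slE K c s) _ ρ := ((hd.differentiableAt hnh).hasDerivAt).mul (slE_diff K c ρ).hasDerivAt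
  have d2 : HasDerivAt (fun s => ξ s * slGi K s) _ ρ := ((hξ ρ).hasDerivAt).mul (slGi_diff K ρ).hasDerivAt
  rw [d1.deriv, d2.deriv, h0, hder, hz] at d
  simp only [zero_mul, add_zero] at d
  have h3 := slGi_mul K ρ h1
  linear_combination (-deriv ξ ρ) * h3 - slGC K ρ * d

/-- factor out two zeros -/
lemma sl_factor (ξ : ℂ → ℂ) (hξ : Differentiable ℂ ξ) (ρ₁ ρ₂ : ℂ) (h1 : ξ ρ₁ = 0)
    (h2 : (ρ₁ ≠ ρ₂ ∧ ξ ρ₂ = 0) ∨ (ρ₁ = ρ₂ ∧ deriv ξ ρ₁ = 0)) :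
    ∃ g : ℂ → ℂ, Differentiable ℂ g ∧ ∀ s, ξ s = (s - ρ₁) * (s - ρ₂) * g s := by
  have ds : ∀ (f : ℂ → ℂ) (a : ℂ), Differentiable ℂ f → Differentiable ℂ (dslope f a) := by
    intro f a hf
    rw [← differentiableOn_univ] at hf ⊢
    exact (Complex.differentiableOn_dslope Filter.univ_mem).mpr hf
  set f := dslope ξ ρ₁ with hf
  have hf1 : ∀ s, (s - ρ₁) * f s = ξ s := by
    intro s
    have := sub_smul_dslope ξ ρ₁ s
    rwa [h1, sub_zero, smul_eq_mul] at this
  have hf2 : f ρ₂ = 0 := by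
    rcases h2 with ⟨hne, h⟩ | ⟨he, h⟩
    · have := hf1 ρ₂
      rw [h] at this
      exact (mul_eq_zero.mp this).resolve_left (sub_ne_zero.mpr hne.symm)
    · rw [← he, hf, dslope_same, h]
  refine ⟨dslope f ρ₂, ds _ _ (ds _ _ hξ), fun s => ?_⟩
  have := sub_smul_dslope f ρ₂ s
  rw [hf2, sub_zero, smul_eq_mul] at this
  rw [mul_assoc, this, hf1]

end

section
open NumberField

lemma slD_one_le (K : Type) [Field K] [NumberField K] : 1 ≤ slD K := by
  have := slD_pos K
  unfold slD at *
  have h : 0 < (discr K).natAbs := by exact_mod_cast this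
  exact_mod_cast h

lemma sl_normmono (z : ℂ) (hz : 0 ≤ z.re) (d : ℝ) (hd : 0 ≤ d) : ‖z‖ ≤ ‖z + d‖ := by
  rw [← sq_le_sq₀ (norm_nonneg _) (norm_nonneg _), Complex.sq_norm, Complex.sq_norm, Complex.normSq_apply, Complex.normSq_apply]
  simp only [Complex.add_re, Complex.add_im, Complex.ofReal_re, Complex.ofReal_im]
  nlinarith [mul_nonneg hz hd]

lemma slXi_norm {K : Type} [Field K] [NumberField K] {ξ : ℂ → ℂ} {c : ℝ} (h : slXi K ξ c) (s : ℂ) (hs : 1 < s.re) :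
    ‖ξ s‖ = c * (‖s‖ * ‖s - 1‖) * slD K ^ (s.re / 2) * ‖slGC K s‖ * ‖slZc K s‖ := by
  rw [h.rep s hs]
  simp only [norm_mul]
  rw [Complex.norm_cpow_eq_rpow_re_of_pos (slD_pos K), Complex.norm_real, Real.norm_eq_abs, abs_of_pos h.cpos]
  congr 4
  rw [show s / 2 = s / ((2:ℝ):ℂ) by simp, Complex.div_ofReal_re]

lemma slXi_lower {K : Type} [Field K] [NumberField K] {ξ : ℂ → ℂ} {c : ℝ} (h : slXi K ξ c) (a b : ℝ) (ha : 1 < a) :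
    ∃ k : ℝ, 0 < k ∧ ∃ M : ℝ, 0 ≤ M ∧ ∀ w : ℂ, a ≤ w.re → w.re ≤ b → k * Real.exp (-(M * |w.im|)) ≤ ‖ξ w‖ := by
  obtain ⟨k, hk, M, hM, hG⟩ := slGC_strip K b
  have hZ := slZr_one_le K (by linarith) (h.fin a ha)
  have hc := h.cpos
  refine ⟨c * (1 * (a - 1)) * 1 * k * (1 / (slZ K a).toReal), ?_, M, hM, fun w h1 h2 => ?_⟩
  · have : 0 < a - 1 := by linarith
    positivity
  have hw : 1 < w.re := by linarith
  rw [slXi_norm h w hw]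
  have e1 : 1 ≤ ‖w‖ := by linarith [Complex.re_le_norm w]
  have e2 : a - 1 ≤ ‖w - 1‖ := by
    have := Complex.re_le_norm (w - 1)
    simp at this; linarith
  have e3 : 1 ≤ slD K ^ (w.re / 2) := Real.one_le_rpow (slD_one_le K) (by linarith)
  have e4 := hG w hw h2
  have e5 : 1 / (slZ K a).toReal ≤ ‖slZc K w‖ := by
    rw [div_le_iff₀ (by linarith)]
    refine (slZc_lower K w (by linarith) (h.fin _ hw)).trans ?_
    exact mul_le_mul_of_nonneg_left (slZr_anti K h1 (h.fin a ha)) (norm_nonneg _)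
  have ha' : 0 < a - 1 := by linarith
  calc _ = c * (1 * (a - 1)) * 1 * (k * Real.exp (-(M * |w.im|))) * (1 / (slZ K a).toReal) := by ring
    _ ≤ _ := by gcongr

lemma slXi_shift {K : Type} [Field K] [NumberField K] {ξ : ℂ → ℂ} {c : ℝ} (h : slXi K ξ c) (d : ℝ) (hd : 0 < d) (T : ℝ) (hT : 0 < T) :
    ∃ A : ℝ, ∀ z : ℂ, A ≤ z.re → T * ‖ξ z‖ ≤ ‖ξ (z + d)‖ := by
  set Z := (slZ K 2).toReal with hZd
  have hZ : 1 ≤ Z := slZr_one_le K (by norm_num) (h.fin 2 (by norm_num))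
  obtain ⟨A, hA⟩ := slG_decay K d hd (T * Z ^ 2) (by positivity)
  refine ⟨max A 2, fun z hz => ?_⟩
  have hz1 : A ≤ z.re := (le_max_left _ _).trans hz
  have hz2 : 2 ≤ z.re := (le_max_right _ _).trans hz
  have hc := h.cpos
  have hre : (z + d).re = z.re + d := by simp
  rw [slXi_norm h z (by linarith), slXi_norm h (z + d) (by rw [hre]; linarith), hre]
  have gX := slG_pos K (show 0 < z.re by linarith)
  have gXd := slG_pos K (show 0 < z.re + d by linarith)
  have r1 := slGC_ratio K z (by linarith) d hd
  have r2 := hA _ hz1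
  have r3 : T * Z ^ 2 * ‖slGC K z‖ ≤ ‖slGC K (z + d)‖ := by
    refine le_of_mul_le_mul_right ?_ gX
    calc _ = ‖slGC K z‖ * (slG K z.re * (T * Z^2)) := by ring
      _ ≤ ‖slGC K z‖ * slG K (z.re + d) := by gcongr
      _ ≤ _ := r1
  have n1 := sl_normmono z (by linarith) d hd.le
  have n2 : ‖z - 1‖ ≤ ‖z + d - 1‖ := by
    have := sl_normmono (z - 1) (by simp; linarith) d hd.le
    rwa [show z - 1 + (d:ℂ) = z + d - 1 by ring] at this
  have n3 : slD K ^ (z.re / 2) ≤ slD K ^ ((z.re + d) / 2) :=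
    Real.rpow_le_rpow_of_exponent_le (slD_one_le K) (by linarith)
  have z1 : ‖slZc K z‖ ≤ Z := (slZc_upper K z (by linarith) (h.fin _ (by linarith))).trans
    (slZr_anti K hz2 (h.fin 2 (by norm_num)))
  have z2 : 1 ≤ ‖slZc K (z + d)‖ * Z := by
    refine (slZc_lower K (z + d) (by rw [hre]; linarith) (h.fin _ (by rw [hre]; linarith))).trans ?_
    gcongr
    exact slZr_anti K (by rw [hre]; linarith) (h.fin 2 (by norm_num))
  have hD := slD_pos K
  have z3 : ‖slZc K z‖ ≤ Z ^ 2 * ‖slZc K (z + d)‖ := by nlinarith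
  calc _ = c * (‖z‖ * ‖z - 1‖) * slD K ^ (z.re / 2) * (T * ‖slGC K z‖) * ‖slZc K z‖ := by ring
    _ ≤ c * (‖z + d‖ * ‖z + d - 1‖) * slD K ^ ((z.re + d) / 2) * (T * ‖slGC K z‖) * (Z ^ 2 * ‖slZc K (z + d)‖) := by gcongr
    _ = c * (‖z + d‖ * ‖z + d - 1‖) * slD K ^ ((z.re + d) / 2) * (T * Z ^ 2 * ‖slGC K z‖) * ‖slZc K (z + d)‖ := by ring
    _ ≤ _ := by gcongr

lemma sl_poly_exp (H t : ℝ) (hH : 0 ≤ H) (ht : 0 ≤ t) : 1 + (H + t) ≤ (1 + H) * Real.exp t := by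
  have := Real.add_one_le_exp t
  nlinarith

lemma sl_growth {K : Type} [Field K] [NumberField K] {ξ : ℂ → ℂ} {c : ℝ} (h : slXi K ξ c) (ρ₁ ρ₂ : ℂ)
    (g : ℂ → ℂ) (hg : ∀ s, ξ s = (s - ρ₁) * (s - ρ₂) * g s) (a A : ℝ) (ha : 1 < a) (hA : 0 < A) :
    ∃ C M T : ℝ, 0 ≤ C ∧ 0 < M ∧ ∀ s : ℂ, -A ≤ s.re → s.re ≤ a → T ≤ |s.im| →
      ‖g s / g (2 * a - s)‖ ≤ C * Real.exp (M * |s.im|) := by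
  obtain ⟨C, hC, hup⟩ := h.growth (-A) a
  obtain ⟨k, hk, M, hM, hlow⟩ := slXi_lower h a (2 * a + A) ha
  set H := 3 * a + A + ‖ρ₁‖ + ‖ρ₂‖ with hH
  have hH0 : 0 ≤ H := by positivity
  refine ⟨C * (1 + H) ^ 4 / k, M + 4, |ρ₁.im| + |ρ₂.im| + 1, by positivity, by linarith, fun s h1 h2 h3 => ?_⟩
  set w : ℂ := 2 * a - s with hw
  set t := |s.im| with ht
  have ht0 : 0 ≤ t := abs_nonneg _
  have hwre : w.re = 2 * a - s.re := by simp [hw]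
  have hwim : |w.im| = t := by simp [hw, ht]
  have hs : ‖s‖ ≤ a + A + t := by
    refine (Complex.norm_le_abs_re_add_abs_im s).trans ?_
    have : |s.re| ≤ a + A := abs_le.mpr ⟨by linarith, by linarith⟩
    linarith
  have hwn : ‖w‖ ≤ 3 * a + A + t := by
    have : ‖w‖ ≤ ‖(2 * a : ℂ)‖ + ‖s‖ := norm_sub_le _ _
    have h2a : ‖(2 * a : ℂ)‖ = 2 * a := by
      rw [show (2 * a : ℂ) = ((2 * a : ℝ) : ℂ) by push_cast; rfl, Complex.norm_real, Real.norm_eq_abs, abs_of_pos (by linarith)]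
    linarith
  have hE := sl_poly_exp H t hH0 ht0
  have hs' : 1 + ‖s‖ ≤ (1 + H) * Real.exp t := by
    have := norm_nonneg ρ₁; have := norm_nonneg ρ₂; linarith
  have hw1 : ‖w - ρ₁‖ ≤ (1 + H) * Real.exp t := by
    have := norm_sub_le w ρ₁; have := norm_nonneg ρ₂; linarith
  have hw2 : ‖w - ρ₂‖ ≤ (1 + H) * Real.exp t := by
    have := norm_sub_le w ρ₂; have := norm_nonneg ρ₁; linarith
  have d1 : 1 ≤ ‖s - ρ₁‖ := by
    have := Complex.abs_im_le_norm (s - ρ₁)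
    have h' := abs_sub_abs_le_abs_sub s.im ρ₁.im
    rw [Complex.sub_im] at this
    have := abs_nonneg ρ₂.im
    linarith
  have d2 : 1 ≤ ‖s - ρ₂‖ := by
    have := Complex.abs_im_le_norm (s - ρ₂)
    have h' := abs_sub_abs_le_abs_sub s.im ρ₂.im
    rw [Complex.sub_im] at this
    have := abs_nonneg ρ₁.im
    linarith
  have g1 : ‖g s‖ ≤ C * ((1 + H) * Real.exp t) ^ 2 := by
    calc ‖g s‖ = 1 * 1 * ‖g s‖ := by ring
      _ ≤ ‖s - ρ₁‖ * ‖s - ρ₂‖ * ‖g s‖ := by gcongr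
      _ = ‖ξ s‖ := by rw [hg s, norm_mul, norm_mul]
      _ ≤ C * (1 + ‖s‖)^2 := hup s h1 h2
      _ ≤ _ := by gcongr
  have g2 : k * Real.exp (-(M * t)) ≤ ((1 + H) * Real.exp t) ^ 2 * ‖g w‖ := by
    have := hlow w (by rw [hwre]; linarith) (by rw [hwre]; linarith)
    rw [hwim, hg w, norm_mul, norm_mul] at this
    refine this.trans ?_
    rw [sq]
    gcongr
  have hgw : 0 < ‖g w‖ := by
    by_contra hcon
    have : ‖g w‖ = 0 := le_antisymm (not_lt.mp hcon) (norm_nonneg _)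
    rw [this, mul_zero] at g2
    have : 0 < k * Real.exp (-(M * t)) := by positivity
    linarith
  rw [norm_div, div_le_iff₀ hgw]
  refine g1.trans ?_
  have hexp : Real.exp t ^ 4 = Real.exp (4 * t) := by rw [← Real.exp_nat_mul]; norm_num
  calc C * ((1 + H) * Real.exp t) ^ 2 = C * ((1 + H) * Real.exp t) ^ 2 / k * Real.exp (M * t) * (k * Real.exp (-(M * t))) := by
        rw [Real.exp_neg]; field_simp
    _ ≤ C * ((1 + H) * Real.exp t) ^ 2 / k * Real.exp (M * t) * (((1 + H) * Real.exp t) ^ 2 * ‖g w‖) := by gcongr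
    _ = C * (1 + H) ^ 4 / k * (Real.exp (M * t) * Real.exp t ^ 4) * ‖g w‖ := by ring
    _ = _ := by rw [hexp, ← Real.exp_add]; congr 3; ring

theorem sl_PL {K : Type} [Field K] [NumberField K] {ξ : ℂ → ℂ} {c : ℝ} (h : slXi K ξ c) (ρ₁ ρ₂ : ℂ)
    (h1 : 0 < ρ₁.re) (h2 : 0 < ρ₂.re) (h1' : ρ₁.re < 1) (h2' : ρ₂.re < 1)
    (hP : ∀ x : ℝ, (starRingEnd ℂ) ((x - ρ₁) * (x - ρ₂)) = (x - ρ₁) * (x - ρ₂))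
    (g : ℂ → ℂ) (hgd : Differentiable ℂ g) (hg : ∀ s, ξ s = (s - ρ₁) * (s - ρ₂) * g s)
    (x y : ℝ) (hx : 1 < x) (hxy : x < y) : ‖g x‖ ≤ ‖g y‖ := by
  have hgc : ∀ s, g ((starRingEnd ℂ) s) = (starRingEnd ℂ) (g s) := by
    refine sl_conj_of_real hgd 1 (fun u hu => ?_)
    have n1 : ((u:ℂ) - ρ₁) ≠ 0 := sub_ne_zero.mpr (fun e => by rw [← e] at h1'; simp at h1'; linarith)
    have n2 : ((u:ℂ) - ρ₂) ≠ 0 := sub_ne_zero.mpr (fun e => by rw [← e] at h2'; simp at h2'; linarith)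
    have e := hg u
    have e2 := h.conj u
    rw [Complex.conj_ofReal, e, map_mul, hP u] at e2
    exact (mul_left_cancel₀ (mul_ne_zero n1 n2) e2).symm
  set a := (x + y) / 2 with ha
  have ha1 : 1 < a := by linarith
  obtain ⟨A0, hA0⟩ := slXi_shift h (2 * a - 1) (by linarith) 4 (by norm_num)
  set A := max (max A0 1) (max ‖(2 * a - 2 * ρ₁ : ℂ)‖ ‖(2 * a - 2 * ρ₂ : ℂ)‖) with hA
  have hAA : A0 ≤ A := (le_max_left _ _).trans (le_max_left _ _)
  have hA1 : 1 ≤ A := (le_max_right _ _).trans (le_max_left _ _)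
  have hAr1 : ‖(2 * a - 2 * ρ₁ : ℂ)‖ ≤ A := (le_max_left _ _).trans (le_max_right _ _)
  have hAr2 : ‖(2 * a - 2 * ρ₂ : ℂ)‖ ≤ A := (le_max_right _ _).trans (le_max_right _ _)
  have hgne : ∀ w : ℂ, 1 < w.re → g w ≠ 0 := by
    intro w hw h0
    obtain ⟨k, hk, M, _, hl⟩ := slXi_lower h w.re w.re hw
    have := hl w le_rfl le_rfl
    rw [hg w, h0, mul_zero, norm_zero] at this
    have : 0 < k * Real.exp (-(M * |w.im|)) := by positivity
    linarith
  have hre : ∀ s : ℂ, (2 * a - s : ℂ).re = 2 * a - s.re := fun s => by simp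
  set G : ℂ → ℂ := fun s => g s / g (2 * a - s) with hG
  have hGd : ∀ s : ℂ, s.re ≤ a → DifferentiableAt ℂ G s := by
    intro s hs
    refine (hgd s).div ?_ (hgne _ (by rw [hre]; linarith))
    exact (hgd _).comp s (by fun_prop)
  have hcl : closure (Complex.re ⁻¹' Set.Ioo (-A) a) ⊆ Complex.re ⁻¹' Set.Icc (-A) a := by
    refine closure_minimal (Set.preimage_mono Set.Ioo_subset_Icc_self) (isClosed_Icc.preimage Complex.continuous_re)
  have hbound : ‖G x‖ ≤ 1 := by
    refine PhragmenLindelof.vertical_strip (a := -A) (b := a) ?_ ?_ ?_ ?_ ?_ ?_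
    · refine ⟨fun s hs => (hGd s hs.2.le).differentiableWithinAt, fun s hs => (hGd s (hcl hs).2).continuousAt.continuousWithinAt⟩
    · obtain ⟨C, M, T, hC, hM, hgr⟩ := sl_growth h ρ₁ ρ₂ g hg a A ha1 (by linarith)
      set κ := Real.pi / (a - -A) / 2 with hκ
      have hκ0 : 0 < κ := by have := Real.pi_pos; have : 0 < a - -A := by linarith
                             positivity
      refine ⟨κ, by rw [hκ]; rw [hκ] at hκ0; linarith, M / κ, ?_⟩
      refine Asymptotics.IsBigO.of_bound C ?_
      have e1 : ∀ᶠ s : ℂ in Filter.comap (abs ∘ Complex.im) Filter.atTop ⊓ Filter.principal (Complex.re ⁻¹' Set.Ioo (-A) a), T ≤ |s.im| :=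
        Filter.Eventually.filter_mono inf_le_left (Filter.tendsto_comap.eventually (Filter.eventually_ge_atTop T))
      have e2 : ∀ᶠ s : ℂ in Filter.comap (abs ∘ Complex.im) Filter.atTop ⊓ Filter.principal (Complex.re ⁻¹' Set.Ioo (-A) a), s ∈ Complex.re ⁻¹' Set.Ioo (-A) a :=
        Filter.Eventually.filter_mono inf_le_right (Filter.mem_principal_self _)
      filter_upwards [e1, e2] with s hs1 hs2
      refine (hgr s hs2.1.le hs2.2.le hs1).trans ?_
      rw [Real.norm_eq_abs, abs_of_pos (Real.exp_pos _)]
      refine mul_le_mul_of_nonneg_left (Real.exp_le_exp.mpr ?_) hC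
      have := Real.add_one_le_exp (κ * |s.im|)
      calc M * |s.im| = M / κ * (κ * |s.im|) := by field_simp
        _ ≤ _ := mul_le_mul_of_nonneg_left (by linarith) (by positivity)
    · intro s hs
      have hz := hA0 (1 - s) (by simp [hs]; linarith)
      rw [show (1 - s + ((2 * a - 1 : ℝ) : ℂ) : ℂ) = 2 * a - s by push_cast; ring, h.FE] at hz
      have hw : g (2 * a - s) ≠ 0 := hgne _ (by rw [hre, hs]; linarith)
      have key : ∀ ρ : ℂ, 0 < ρ.re → ‖(2 * a - 2 * ρ : ℂ)‖ ≤ A → A ≤ ‖s - ρ‖ ∧ ‖(2 * a - s - ρ : ℂ)‖ ≤ 2 * ‖s - ρ‖ := by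
        intro ρ hρ hr
        have p1 : A ≤ ‖s - ρ‖ := by
          have := Complex.abs_re_le_norm (s - ρ)
          have h5 := neg_abs_le (s - ρ).re
          rw [Complex.sub_re, hs] at *
          linarith
        refine ⟨p1, ?_⟩
        calc ‖(2 * a - s - ρ : ℂ)‖ = ‖(2 * a - 2 * ρ : ℂ) - (s - ρ)‖ := by congr 1; ring
          _ ≤ ‖(2 * a - 2 * ρ : ℂ)‖ + ‖s - ρ‖ := norm_sub_le _ _
          _ ≤ _ := by linarith
      obtain ⟨k1, k1'⟩ := key ρ₁ h1 hAr1
      obtain ⟨k2, k2'⟩ := key ρ₂ h2 hAr2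
      have q1 : 0 < ‖s - ρ₁‖ := by linarith
      have q2 : 0 < ‖s - ρ₂‖ := by linarith
      rw [hG]
      simp only
      rw [norm_div, div_le_one (norm_pos_iff.mpr hw)]
      rw [hg s, hg (2 * a - s), norm_mul, norm_mul, norm_mul, norm_mul] at hz
      have : ‖s - ρ₁‖ * ‖s - ρ₂‖ * ‖g s‖ * 4 ≤ ‖s - ρ₁‖ * ‖s - ρ₂‖ * ‖g (2 * a - s)‖ * 4 := by
        calc _ = 4 * (‖s - ρ₁‖ * ‖s - ρ₂‖ * ‖g s‖) := by ring
          _ ≤ _ := hz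
          _ ≤ (2 * ‖s - ρ₁‖) * (2 * ‖s - ρ₂‖) * ‖g (2 * a - s)‖ := by gcongr
          _ = _ := by ring
      have h6 := le_of_mul_le_mul_right this (by norm_num)
      exact le_of_mul_le_mul_left h6 (by positivity)
    · intro s hs
      have : (2 * a - s : ℂ) = (starRingEnd ℂ) s := by
        apply Complex.ext
        · simp [hs]; ring
        · simp
      rw [hG]
      simp only
      rw [this, hgc, norm_div, Complex.norm_conj]
      exact div_self_le_one _
    · simp; linarith
    · simp; linarith
  rw [hG] at hbound
  simp only at hbound
  rw [show (2 * a - x : ℂ) = y by rw [ha]; push_cast; ring, norm_div, div_le_one (norm_pos_iff.mpr (hgne _ (by simp; linarith)))] at hbound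
  exact hbound

end

section
open NumberField

lemma sl_log_gt (K : Type) [Field K] [NumberField K] (hΔ : 3 ≤ (discr K).natAbs) : 1 < Real.log ((discr K).natAbs : ℝ) := by
  have h : (3:ℝ) ≤ ((discr K).natAbs : ℝ) := by exact_mod_cast hΔ
  rw [Real.lt_log_iff_exp_lt (by linarith)]
  linarith [Real.exp_one_lt_d9]

lemma sl_exp_eighth : Real.exp (1/8) < 1.14 := by
  have h : Real.exp (1/8) ^ 8 = Real.exp 1 := by rw [← Real.exp_nat_mul]; norm_num
  by_contra hc
  push Not at hc
  have : (1.14:ℝ) ^ 8 ≤ Real.exp (1/8) ^ 8 := by gcongr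
  rw [h] at this
  have := Real.exp_one_lt_d9
  norm_num at *
  linarith

lemma sl_final {K : Type} [Field K] [NumberField K] {ξ : ℂ → ℂ} {c : ℝ} (h : slXi K ξ c)
    (hn : 1 < Module.finrank ℚ K) (hΔ : 3 ≤ (discr K).natAbs) (L : ℝ) (hL : L = Real.log ((discr K).natAbs : ℝ)) (ρ₁ ρ₂ : ℂ)
    (h1 : 0 < ρ₁.re) (h2 : 0 < ρ₂.re) (h1' : ρ₁.re < 1) (h2' : ρ₂.re < 1)
    (hP : ∀ x : ℝ, (starRingEnd ℂ) ((x - ρ₁) * (x - ρ₂)) = (x - ρ₁) * (x - ρ₂))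
    (hz1 : ξ ρ₁ = 0) (hz2 : (ρ₁ ≠ ρ₂ ∧ ξ ρ₂ = 0) ∨ (ρ₁ = ρ₂ ∧ deriv ξ ρ₁ = 0))
    (hq : 1.52 * (‖((1 + 3 / (4 * L) : ℝ) : ℂ) - ρ₁‖ * ‖((1 + 3 / (4 * L) : ℝ) : ℂ) - ρ₂‖) ≤
      ‖((1 + 1 / L : ℝ) : ℂ) - ρ₁‖ * ‖((1 + 1 / L : ℝ) : ℂ) - ρ₂‖) : False := by
  have hL1 : 1 < L := hL ▸ sl_log_gt K hΔ
  have hL0 : 0 < L := by linarith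
  obtain ⟨g, hgd, hg⟩ := sl_factor ξ h.diff ρ₁ ρ₂ hz1 hz2
  set x : ℝ := 1 + 3 / (4 * L) with hx
  set y : ℝ := 1 + 1 / L with hy
  have hx1 : 1 < x := by rw [hx]; have : 0 < 3 / (4 * L) := by positivity
                         linarith
  have hyx : y - x = 1 / (4 * L) := by rw [hx, hy]; field_simp; ring
  have hxy : x < y := by have : 0 < 1 / (4 * L) := by positivity
                         linarith
  have hy2 : y < 2 := by rw [hy]; have : 1 / L < 1 := by rw [div_lt_one hL0]; exact hL1
                         linarith
  have hgg := sl_PL h ρ₁ ρ₂ h1 h2 h1' h2' hP g hgd hg x y hx1 hxy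
  have nx : ∀ u : ℝ, 1 < u → ‖ξ u‖ = c * (u * (u - 1)) * slD K ^ (u / 2) * slG K u * (slZ K u).toReal := by
    intro u hu
    rw [slXi_norm h u (by simpa using hu), slGC_real, slZc_real K (by linarith)]
    simp only [Complex.norm_real, Complex.ofReal_re, Real.norm_eq_abs]
    rw [abs_of_pos (slG_pos K (by linarith)), abs_of_nonneg ENNReal.toReal_nonneg, abs_of_pos (by linarith : 0 < u),
      show (u:ℂ) - 1 = ((u - 1 : ℝ) : ℂ) by push_cast; rfl, Complex.norm_real, Real.norm_eq_abs, abs_of_pos (by linarith : 0 < u - 1)]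
  set Px := ‖(x:ℂ) - ρ₁‖ * ‖(x:ℂ) - ρ₂‖ with hPx
  set Py := ‖(y:ℂ) - ρ₁‖ * ‖(y:ℂ) - ρ₂‖ with hPy
  have hPx0 : 0 < Px := by
    have n1 : ((x:ℂ) - ρ₁) ≠ 0 := sub_ne_zero.mpr (fun e => by rw [← e] at h1'; simp at h1'; linarith)
    have n2 : ((x:ℂ) - ρ₂) ≠ 0 := sub_ne_zero.mpr (fun e => by rw [← e] at h2'; simp at h2'; linarith)
    exact mul_pos (norm_pos_iff.mpr n1) (norm_pos_iff.mpr n2)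
  have ex : ‖ξ x‖ = Px * ‖g x‖ := by rw [hg x, norm_mul, norm_mul]
  have ey : ‖ξ y‖ = Py * ‖g y‖ := by rw [hg y, norm_mul, norm_mul]
  have hPy0 : 0 ≤ Py := by positivity
  have hcmp : ‖ξ x‖ * Py ≤ ‖ξ y‖ * Px := by
    rw [ex, ey]
    calc Px * ‖g x‖ * Py ≤ Px * ‖g y‖ * Py := by gcongr
      _ = _ := by ring
  have hc := h.cpos
  have hDp := slD_pos K
  have hZx := slZr_one_le K (by linarith) (h.fin x hx1)
  have hZ := slZr_anti K hxy.le (h.fin x hx1)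
  have hGa := slG_anti K hn x y hx1 hxy hy2
  have hGx := slG_pos K (show 0 < x by linarith)
  have hGy := slG_pos K (show 0 < y by linarith)
  have hD : slD K ^ (y / 2) = slD K ^ (x / 2) * Real.exp (1/8) := by
    rw [show y / 2 = x / 2 + (y - x) / 2 by ring, Real.rpow_add hDp, hyx]
    congr 1
    rw [Real.rpow_def_of_pos hDp]
    congr 1
    have : Real.log (slD K) = L := hL.symm
    rw [this]; field_simp; norm_num
  have hup : ‖ξ y‖ ≤ (c * x * slD K ^ (x/2) * slG K x * (slZ K x).toReal) * ((y - 1) * Real.exp (1/8)) := by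
    rw [nx y (by linarith), hD]
    have hy1 : 0 < y - 1 := by linarith
    calc _ = c * (y - 1) * (slD K ^ (x/2) * Real.exp (1/8)) * (y * slG K y) * (slZ K y).toReal := by ring
      _ ≤ c * (y - 1) * (slD K ^ (x/2) * Real.exp (1/8)) * (x * slG K x) * (slZ K x).toReal := by gcongr
      _ = _ := by ring
  set W := c * x * slD K ^ (x/2) * slG K x * (slZ K x).toReal with hW
  have hW0 : 0 < W := by
    have : 0 < x := by linarith
    have : 0 < (slZ K x).toReal := by linarith
    positivity
  have hxW : ‖ξ x‖ = W * (x - 1) := by rw [nx x hx1, hW]; ring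
  rw [hxW] at hcmp
  have h7 : W * ((x - 1) * Py) ≤ W * ((y - 1) * Real.exp (1/8) * Px) := by
    calc _ = W * (x - 1) * Py := by ring
      _ ≤ _ := hcmp
      _ ≤ W * ((y - 1) * Real.exp (1/8)) * Px := by gcongr
      _ = _ := by ring
  have h8 := le_of_mul_le_mul_left h7 hW0
  have hx3 : x - 1 = (1 / (4 * L)) * 3 := by rw [hx]; field_simp; ring
  have hy3 : y - 1 = (1 / (4 * L)) * 4 := by rw [hy]; field_simp; ring
  rw [hx3, hy3] at h8
  have h9 : 3 * Py ≤ 4 * Real.exp (1/8) * Px := by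
    refine le_of_mul_le_mul_left ?_ (show 0 < 1 / (4 * L) by positivity)
    linarith
  have := sl_exp_eighth
  have h10 : Real.exp (1/8) * Px < 1.14 * Px := by gcongr
  norm_num at h10 hq h9
  linarith

lemma sl_real_case {K : Type} [Field K] [NumberField K] {ξ : ℂ → ℂ} {c : ℝ} (h : slXi K ξ c)
    (hn : 1 < Module.finrank ℚ K) (hΔ : 3 ≤ (discr K).natAbs) (ρ₁ ρ₂ : ℂ)
    (h1 : 0 < ρ₁.re) (h2 : 0 < ρ₂.re) (h1' : ρ₁.re < 1) (h2' : ρ₂.re < 1)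
    (i1 : ρ₁.im = 0) (i2 : ρ₂.im = 0)
    (r1 : 1 - (4 * Real.log ((discr K).natAbs : ℝ))⁻¹ ≤ ρ₁.re) (r2 : 1 - (4 * Real.log ((discr K).natAbs : ℝ))⁻¹ ≤ ρ₂.re)
    (hz1 : ξ ρ₁ = 0) (hz2 : (ρ₁ ≠ ρ₂ ∧ ξ ρ₂ = 0) ∨ (ρ₁ = ρ₂ ∧ deriv ξ ρ₁ = 0)) : False := by
  have hL1 := sl_log_gt K hΔ
  set L := Real.log ((discr K).natAbs : ℝ) with hL
  have hL0 : 0 < L := by linarith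
  have e1 : ρ₁ = ((ρ₁.re : ℝ) : ℂ) := by apply Complex.ext <;> simp [i1]
  have e2 : ρ₂ = ((ρ₂.re : ℝ) : ℂ) := by apply Complex.ext <;> simp [i2]
  refine sl_final h hn hΔ L hL ρ₁ ρ₂ h1 h2 h1' h2' ?_ hz1 hz2 ?_
  · intro x
    rw [e1, e2, map_mul, map_sub, map_sub, Complex.conj_ofReal, Complex.conj_ofReal, Complex.conj_ofReal]
  · have hp : 0 < L⁻¹ := by positivity
    have n : ∀ (u b : ℝ), 0 < u → b < 1 → ‖((1 + u : ℝ) : ℂ) - ((b : ℝ) : ℂ)‖ = 1 + u - b := by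
      intro u b hu hb
      rw [← Complex.ofReal_sub, Complex.norm_real, Real.norm_eq_abs, abs_of_pos (by linarith)]
    have q1 : 3 / (4 * L) = 3 / 4 * L⁻¹ := by field_simp
    have q2 : 1 / L = L⁻¹ := by simp
    have q3 : (4 * L)⁻¹ = 1 / 4 * L⁻¹ := by field_simp
    rw [q3] at r1 r2
    rw [q1, q2, e1, e2, n _ _ (by positivity) h1', n _ _ (by positivity) h2', n _ _ hp h1', n _ _ hp h2']
    generalize L⁻¹ = ℓ at *
    generalize ρ₁.re = b1 at *
    generalize ρ₂.re = b2 at *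
    have k1 : 5 / 4 * (1 + 3 / 4 * ℓ - b1) ≤ 1 + ℓ - b1 := by linarith
    have k2 : 5 / 4 * (1 + 3 / 4 * ℓ - b2) ≤ 1 + ℓ - b2 := by linarith
    have p1 : 0 < 1 + 3 / 4 * ℓ - b1 := by linarith
    have p2 : 0 < 1 + 3 / 4 * ℓ - b2 := by linarith
    calc 1.52 * ((1 + 3 / 4 * ℓ - b1) * (1 + 3 / 4 * ℓ - b2)) ≤ (5 / 4 * (1 + 3 / 4 * ℓ - b1)) * (5 / 4 * (1 + 3 / 4 * ℓ - b2)) := by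
          have := mul_pos p1 p2
          norm_num
          linarith
      _ ≤ _ := by
          have p3 : 0 ≤ 1 + ℓ - b1 := by linarith
          gcongr

lemma sl_conj_case {K : Type} [Field K] [NumberField K] {ξ : ℂ → ℂ} {c : ℝ} (h : slXi K ξ c)
    (hn : 1 < Module.finrank ℚ K) (hΔ : 3 ≤ (discr K).natAbs) (ρ : ℂ)
    (h1 : 0 < ρ.re) (h1' : ρ.re < 1) (i1 : ρ.im ≠ 0)
    (r1 : 1 - (4 * Real.log ((discr K).natAbs : ℝ))⁻¹ ≤ ρ.re) (r2 : |ρ.im| ≤ (4 * Real.log ((discr K).natAbs : ℝ))⁻¹)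
    (hz1 : ξ ρ = 0) : False := by
  have hL1 := sl_log_gt K hΔ
  set L := Real.log ((discr K).natAbs : ℝ) with hL
  have hL0 : 0 < L := by linarith
  have hne : ρ ≠ (starRingEnd ℂ) ρ := by
    intro e
    have := congrArg Complex.im e
    rw [Complex.conj_im] at this
    exact i1 (by linarith)
  refine sl_final h hn hΔ L hL ρ ((starRingEnd ℂ) ρ) h1 (by simpa using h1) h1' (by simpa using h1') ?_ hz1
    (Or.inl ⟨hne, by rw [h.conj, hz1, map_zero]⟩) ?_
  · intro x
    rw [map_mul, map_sub, map_sub, Complex.conj_ofReal, Complex.conj_conj, mul_comm]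
  · have n : ∀ u : ℝ, ‖((u : ℝ) : ℂ) - ρ‖ * ‖((u : ℝ) : ℂ) - (starRingEnd ℂ) ρ‖ = (u - ρ.re) ^ 2 + ρ.im ^ 2 := by
      intro u
      have : ((u : ℝ) : ℂ) - (starRingEnd ℂ) ρ = (starRingEnd ℂ) (((u : ℝ) : ℂ) - ρ) := by simp
      rw [this, Complex.norm_conj, ← sq, Complex.sq_norm, Complex.normSq_apply]
      simp; ring
    have hp : 0 < L⁻¹ := by positivity
    have q1 : 3 / (4 * L) = 3 / 4 * L⁻¹ := by field_simp
    have q2 : 1 / L = L⁻¹ := by simp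
    have q3 : (4 * L)⁻¹ = 1 / 4 * L⁻¹ := by field_simp
    rw [q3] at r1 r2
    have r3 : ρ.im ^ 2 ≤ (1 / 4 * L⁻¹) ^ 2 := sq_le_sq' (by linarith [neg_abs_le ρ.im]) (by linarith [le_abs_self ρ.im])
    rw [q1, q2, n, n]
    generalize L⁻¹ = ℓ at *
    generalize ρ.im = v at *
    obtain ⟨u, hu⟩ : ∃ u, u = 1 - ρ.re := ⟨_, rfl⟩
    have e : ρ.re = 1 - u := by linarith
    rw [e] at *
    have hu0 : 0 < u := by linarith
    have hu1 : u ≤ 1 / 4 * ℓ := by linarith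
    norm_num
    nlinarith [mul_nonneg hu0.le (sub_nonneg.mpr hu1), mul_nonneg hp.le (sub_nonneg.mpr hu1), sq_nonneg ℓ]

end

/-- A number field `K ≠ ℚ` has at most one non-trivial zero `ρ = β + iγ` of `ζ_K` with
`|γ| ≤ (4 log Δ)⁻¹` and `β ≥ 1 - (4 log Δ)⁻¹`; such a zero must be real and simple
(a simple zero of the analytic function `ζ_K` being one where the derivative does not
vanish). -/
theorem siegel_landau_zero_unique_real_simple
    (K : Type) [Field K] [NumberField K]
    (hdeg : 1 < Module.finrank ℚ K)
    (hΔ : 3 ≤ (NumberField.discr K).natAbs)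
    (zeta : ℂ → ℂ) (hzeta : IsDedekindZeta K zeta) :
    (∀ ρ₁ ρ₂ : ℂ,
      (zeta ρ₁ = 0 ∧ 0 < ρ₁.re ∧ ρ₁.re < 1 ∧
        |ρ₁.im| ≤ (4 * Real.log ((NumberField.discr K).natAbs))⁻¹ ∧
        1 - (4 * Real.log ((NumberField.discr K).natAbs))⁻¹ ≤ ρ₁.re) →
      (zeta ρ₂ = 0 ∧ 0 < ρ₂.re ∧ ρ₂.re < 1 ∧
        |ρ₂.im| ≤ (4 * Real.log ((NumberField.discr K).natAbs))⁻¹ ∧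
        1 - (4 * Real.log ((NumberField.discr K).natAbs))⁻¹ ≤ ρ₂.re) →
      ρ₁ = ρ₂) ∧
    (∀ ρ : ℂ,
      (zeta ρ = 0 ∧ 0 < ρ.re ∧ ρ.re < 1 ∧
        |ρ.im| ≤ (4 * Real.log ((NumberField.discr K).natAbs))⁻¹ ∧
        1 - (4 * Real.log ((NumberField.discr K).natAbs))⁻¹ ≤ ρ.re) →
      ρ.im = 0 ∧ deriv zeta ρ ≠ 0) := by
  obtain ⟨ξ, c, h, key⟩ := sl_main K zeta hzeta.1 hzeta.2
  have him : ∀ ρ : ℂ,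
      (zeta ρ = 0 ∧ 0 < ρ.re ∧ ρ.re < 1 ∧
        |ρ.im| ≤ (4 * Real.log ((NumberField.discr K).natAbs))⁻¹ ∧
        1 - (4 * Real.log ((NumberField.discr K).natAbs))⁻¹ ≤ ρ.re) → ρ.im = 0 := by
    rintro ρ ⟨h0, h1, h2, h3, h4⟩
    by_contra hne
    exact sl_conj_case h hdeg hΔ ρ h1 h2 hne h4 h3 (sl_zero K zeta ξ c key ρ h0 h1 h2)
  refine ⟨fun ρ₁ ρ₂ a b => ?_, fun ρ a => ⟨him ρ a, fun hder => ?_⟩⟩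
  · have i1 := him ρ₁ a
    have i2 := him ρ₂ b
    obtain ⟨a0, a1, a2, a3, a4⟩ := a
    obtain ⟨b0, b1, b2, b3, b4⟩ := b
    by_contra hne
    exact sl_real_case h hdeg hΔ ρ₁ ρ₂ a1 b1 a2 b2 i1 i2 a4 b4
      (sl_zero K zeta ξ c key ρ₁ a0 a1 a2) (Or.inl ⟨hne, sl_zero K zeta ξ c key ρ₂ b0 b1 b2⟩)
  · have i1 := him ρ a
    obtain ⟨a0, a1, a2, a3, a4⟩ := a
    exact sl_real_case h hdeg hΔ ρ ρ a1 a1 a2 a2 i1 i1 a4 a4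
      (sl_zero K zeta ξ c key ρ a0 a1 a2)
      (Or.inr ⟨rfl, sl_zero_deriv K zeta ξ c hzeta.1 h.diff key ρ a0 a1 a2 hder⟩)

end
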